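/- There is a universal constant C with the following property. Let Λ ∈ M_n(ℝ) be a nonzero diagonal matrix with tr Λ = 0, let U be a Haar-distributed random matrix in the unitary group U(n), and define A = U Λ U*. Let B be the upper-left k×k submatrix of A (k ≥ 2), and set M = (√(n²−1)/‖Λ‖_HS)·B. Let μ_{k^{-1/2}M} denote the empirical spectral measure of k^{-1/2}M, i.e., the average of the point masses at the k eigenvalues of k^{-1/2}M, and let ρ_sc denote the semicircle law on [−2,2], with density (1/2π)√(4−t²). Then E W₁( μ_{k^{-1/2}M}, ρ_sc ) ≤ 18 k² √n · (‖Λ‖_op²/‖Λ‖_HS²) + C √(log k)/k, where W₁ denotes the L¹-Wasserstein (Kantorovich) distance between probability measures on ℝ. -/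

import Mathlib

open MeasureTheory ProbabilityTheory Matrix
open scoped Matrix ENNReal

universe u

/-- Entrywise (Borel product) measurable structure on matrices. -/
instance matrixMeasurableSpace {m n α : Type*} [MeasurableSpace α] :
    MeasurableSpace (Matrix m n α) :=
  inferInstanceAs (MeasurableSpace (m → n → α))

/-- Hilbert–Schmidt norm of a real square matrix. -/
noncomputable def hsNormR {n : ℕ} (M : Matrix (Fin n) (Fin n) ℝ) : ℝ :=
  Real.sqrt ((M * Mᵀ).trace)

/-- Operator (ℓ²→ℓ²) norm of a real square matrix. -/
noncomputable def opNormR {n : ℕ} (M : Matrix (Fin n) (Fin n) ℝ) : ℝ :=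
  ‖Matrix.toEuclideanCLM (𝕜 := ℝ) M‖

/-- L¹-Wasserstein (Kantorovich) distance between measures on ℝ, in dual form. -/
noncomputable def W1m (μ ν : Measure ℝ) : ℝ :=
  ⨆ f : {f : ℝ → ℝ // LipschitzWith 1 f}, |(∫ x, f.1 x ∂μ) - ∫ x, f.1 x ∂ν|

open scoped Classical in
/-- Empirical spectral measure of a (Hermitian) matrix. -/
noncomputable def esd {k : ℕ} (M : Matrix (Fin k) (Fin k) ℂ) : Measure ℝ :=
  if h : M.IsHermitian then
    (k : ℝ≥0∞)⁻¹ • ∑ i : Fin k, Measure.dirac (h.eigenvalues i)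
  else 0

/-- The semicircle law, with density √(4−t²)/(2π) on [−2,2]. -/
noncomputable def semicircle : Measure ℝ :=
  MeasureTheory.volume.withDensity fun t =>
    ENNReal.ofReal (Real.sqrt (4 - t ^ 2) / (2 * Real.pi))

section Proof
set_option autoImplicit false
open MeasureTheory ProbabilityTheory Matrix Filter Topology
open scoped Matrix ENNReal NNReal


-- Part PA
/-- density of the semicircle law -/
noncomputable def scd (x : ℝ) : ℝ := Real.sqrt (4 - x ^ 2) / (2 * Real.pi)

lemma scd_cont : Continuous scd := by unfold scd; fun_prop

lemma scd_nonneg (x : ℝ) : 0 ≤ scd x := by unfold scd; positivity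

lemma scd_zero {x : ℝ} (h : x ∉ Set.Ioc (-2 : ℝ) 2) : scd x = 0 := by
  unfold scd
  rw [Real.sqrt_eq_zero'.2, zero_div]
  simp only [Set.mem_Ioc, not_and_or, not_lt, not_le] at h
  rcases h with h | h <;> nlinarith

lemma sc_integral {E : Type*} [NormedAddCommGroup E] [NormedSpace ℝ E] (f : ℝ → E) :
    ∫ x, f x ∂semicircle = ∫ x in (-2 : ℝ)..2, scd x • f x := by
  unfold semicircle
  rw [integral_withDensity_eq_integral_toReal_smul]
  · rw [intervalIntegral.integral_of_le (by norm_num), setIntegral_eq_integral_of_forall_compl_eq_zero]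
    · congr 1; ext x
      rw [ENNReal.toReal_ofReal]; · rfl
      exact scd_nonneg x
    · intro x hx; rw [scd_zero hx, zero_smul]
  · exact (ENNReal.measurable_ofReal.comp scd_cont.measurable)
  · exact Filter.Eventually.of_forall fun x => ENNReal.ofReal_lt_top

lemma sc_integrable {E : Type*} [NormedAddCommGroup E] [NormedSpace ℝ E] (f : ℝ → E) (hf : Continuous f) :
    Integrable f semicircle := by
  unfold semicircle
  rw [integrable_withDensity_iff_integrable_smul']
  · have : Integrable (fun x => scd x • f x) := by
      rw [← integrableOn_iff_integrable_of_support_subset (s := Set.Icc (-2:ℝ) 2)]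
      · exact ((scd_cont.smul hf).continuousOn).integrableOn_Icc
      · intro x hx
        by_contra h
        apply hx
        simp only
        rw [scd_zero, zero_smul]
        intro h2; exact h ⟨h2.1.le, h2.2⟩
    refine this.congr (Filter.Eventually.of_forall fun x => ?_)
    simp only
    rw [ENNReal.toReal_ofReal]; · rfl
    exact scd_nonneg x
  · exact (ENNReal.measurable_ofReal.comp scd_cont.measurable)
  · exact Filter.Eventually.of_forall fun x => ENNReal.ofReal_lt_top

lemma sc_one : ∫ x in (-2 : ℝ)..2, scd x = 1 := by
  have h := integral_sqrt_one_sub_sq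
  have h2 : ∫ x in (-2 : ℝ)..2, scd x = ∫ x in (-2 : ℝ)..2, (1 / Real.pi) * Real.sqrt (1 - (x / 2) ^ 2) := by
    congr 1; ext x; unfold scd
    rw [show (4 - x ^ 2) = 2 ^ 2 * (1 - (x/2)^2) by ring, Real.sqrt_mul (by positivity), Real.sqrt_sq (by norm_num)]
    field_simp
  rw [h2, intervalIntegral.integral_const_mul, intervalIntegral.integral_comp_div (fun x => Real.sqrt (1 - x ^ 2)) (by norm_num : (2:ℝ) ≠ 0)]
  norm_num [h]
  field_simp

instance sc_prob : IsProbabilityMeasure semicircle := by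
  constructor
  have h : IsFiniteMeasure semicircle := by
    have := sc_integrable (fun _ : ℝ => (1:ℝ)) continuous_const
    exact (integrable_const_iff_isFiniteMeasure one_ne_zero).1 this
  have h1 : (∫ _x, (1:ℝ) ∂semicircle) = 1 := by
    rw [sc_integral]; simpa using sc_one
  rw [integral_const, smul_eq_mul, mul_one, measureReal_def] at h1
  rw [← ENNReal.toReal_eq_one_iff]; exact h1

lemma sc_ae : ∀ᵐ x ∂semicircle, x ∈ Set.Icc (-2 : ℝ) 2 := by
  have hm : Measurable (fun t : ℝ => ENNReal.ofReal (Real.sqrt (4 - t ^ 2) / (2 * Real.pi))) :=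
    (ENNReal.measurable_ofReal.comp scd_cont.measurable)
  unfold semicircle
  rw [ae_withDensity_iff hm]
  refine Filter.Eventually.of_forall fun x hx => ?_
  by_contra h
  apply hx
  have := scd_zero (x := x) (fun h2 => h ⟨h2.1.le, h2.2⟩)
  unfold scd at this
  rw [this, ENNReal.ofReal_zero]

/-- `(4-x²)^{3/2}` derivative -/
lemma sq32_deriv (x : ℝ) : HasDerivAt (fun x : ℝ => (4 - x ^ 2) * Real.sqrt (4 - x ^ 2)) (-3 * x * Real.sqrt (4 - x ^ 2)) x := by
  have h1 : HasDerivAt (fun y : ℝ => y * Real.sqrt y) (3/2 * Real.sqrt (4 - x ^ 2)) (4 - x ^ 2) := by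
    have e : (fun y : ℝ => y * Real.sqrt y) = fun y => (max y 0) ^ (3/2 : ℝ) := by
      ext y
      rcases le_total 0 y with h | h
      · rw [max_eq_left h, Real.sqrt_eq_rpow]
        rcases h.eq_or_lt with h | h
        · subst h; rw [Real.zero_rpow (by norm_num)]; simp
        nth_rw 1 [← Real.rpow_one y]
        rw [← Real.rpow_add h]; norm_num
      · rw [max_eq_right h, Real.sqrt_eq_zero'.2 h, Real.zero_rpow (by norm_num)]; simp
    set y := 4 - x ^ 2
    rcases lt_trichotomy y 0 with h | h | h
    · rw [Real.sqrt_eq_zero'.2 h.le]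
      have : (fun y : ℝ => y * Real.sqrt y) =ᶠ[nhds y] fun _ => 0 := by
        filter_upwards [eventually_lt_nhds h] with z hz
        rw [Real.sqrt_eq_zero'.2 hz.le, mul_zero]
      rw [mul_zero]
      exact (hasDerivAt_const y (0:ℝ)).congr_of_eventuallyEq this
    · rw [h, Real.sqrt_zero, mul_zero, hasDerivAt_iff_tendsto_slope]
      have : Filter.Tendsto (fun z : ℝ => Real.sqrt z) (nhdsWithin 0 {0}ᶜ) (nhds 0) := by
        have := (Real.continuous_sqrt.tendsto 0)
        rw [Real.sqrt_zero] at this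
        exact this.mono_left nhdsWithin_le_nhds
      refine this.congr' ?_
      filter_upwards [self_mem_nhdsWithin] with z hz
      have : z ≠ 0 := hz
      simp [slope_def_field]; field_simp
    · have h2 := (hasDerivAt_id y).mul (Real.hasDerivAt_sqrt h.ne')
      refine h2.congr_deriv ?_
      simp only [id]
      have := Real.mul_self_sqrt h.le
      have h3 : Real.sqrt y ≠ 0 := (Real.sqrt_pos.2 h).ne'
      field_simp; nlinarith
  have h2 : HasDerivAt (fun x : ℝ => 4 - x ^ 2) (-(2 * x)) x := by
    simpa using (hasDerivAt_pow 2 x).const_sub 4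
  have h3 := HasDerivAt.comp x h1 h2
  refine h3.congr_deriv ?_
  ring

/-- IBP for the semicircle: ∫ ((4-x²) F' - 3 x F) dρ = 0 -/
lemma sc_ibp (F F' : ℝ → ℝ) (hF : ∀ x, HasDerivAt F (F' x) x) (hF' : Continuous F') :
    ∫ x, ((4 - x ^ 2) * F' x - 3 * x * F x) ∂semicircle = 0 := by
  have hFc : Continuous F := continuous_iff_continuousAt.2 fun x => (hF x).continuousAt
  rw [sc_integral]
  have : ∀ x ∈ Set.uIcc (-2:ℝ) 2, HasDerivAt (fun x => (2 * Real.pi)⁻¹ * ((4 - x ^ 2) * Real.sqrt (4 - x ^ 2) * F x))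
      (scd x • ((4 - x ^ 2) * F' x - 3 * x * F x)) x := by
    intro x _
    refine (((sq32_deriv x).mul (hF x)).const_mul ((2 * Real.pi)⁻¹)).congr_deriv ?_
    unfold scd; rw [smul_eq_mul]; ring
  rw [intervalIntegral.integral_eq_sub_of_hasDerivAt this]
  · norm_num
  · apply Continuous.intervalIntegrable
    have := scd_cont
    fun_prop

lemma sc_second : ∫ x, x ^ 2 ∂semicircle = 1 := by
  have h := sc_ibp (fun x => x) (fun _ => 1) (fun x => hasDerivAt_id x) continuous_const
  have e : (fun x : ℝ => (4 - x ^ 2) * 1 - 3 * x * x) = fun x => 4 - 4 * x ^ 2 := by ext x; ring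
  rw [e, integral_sub, integral_const_mul] at h
  · simp at h; linarith
  · exact integrable_const _
  · exact sc_integrable _ (by fun_prop)

-- Part PA2
instance fact8 : Fact ((0:ℝ) < 8) := ⟨by norm_num⟩


lemma fourierCoeff_shift (F : C(AddCircle (8:ℝ), ℂ)) (h : AddCircle (8:ℝ)) (m : ℤ) :
    fourierCoeff (fun x => F (x + h)) m = fourier m h * fourierCoeff F m := by
  unfold fourierCoeff
  rw [← integral_add_right_eq_self (μ := AddCircle.haarAddCircle) (fun t : AddCircle (8:ℝ) => fourier (-m) t • F t) h,
    ← integral_const_mul]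
  congr 1; ext t
  have : (fourier (-m) (t + h) : ℂ) = fourier (-m) t * fourier (-m) h := by
    simp only [fourier_apply, smul_add, AddCircle.toCircle_add, Circle.coe_mul]
  have h2 : (fourier m h : ℂ) * fourier (-m) h = 1 := by
    rw [← fourier_add]; simp
  rw [this, smul_eq_mul, smul_eq_mul]
  linear_combination (-(fourier (-m) t * F (t + h))) * h2

lemma fourier_bessel (G : C(AddCircle (8:ℝ), ℂ)) (B : ℝ) (hG : ∀ x, ‖G x‖ ≤ B) (s : Finset ℤ) :
    ∑ m ∈ s, ‖fourierCoeff G m‖ ^ 2 ≤ B ^ 2 := by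
  have hB : 0 ≤ B := (norm_nonneg _).trans (hG 0)
  let f := ContinuousMap.toLp (E := ℂ) 2 (AddCircle.haarAddCircle (T := 8)) ℂ G
  have h1 := hasSum_sq_fourierCoeff f
  have h2 : ∀ m, fourierCoeff f m = fourierCoeff G m := fun m => fourierCoeff_toLp G m
  simp_rw [h2] at h1
  refine (sum_le_hasSum s (fun _ _ => by positivity) h1).trans ?_
  have h3 : (f : AddCircle (8:ℝ) → ℂ) =ᵐ[AddCircle.haarAddCircle] G := ContinuousMap.coeFn_toLp _ _
  have h4 : ∫ t, ‖f t‖ ^ 2 ∂AddCircle.haarAddCircle = ∫ t, ‖G t‖ ^ 2 ∂(AddCircle.haarAddCircle (T := 8)) :=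
    integral_congr_ae (by filter_upwards [h3] with x hx; rw [hx])
  rw [h4]
  calc _ ≤ ∫ t, B ^ 2 ∂(AddCircle.haarAddCircle (T := 8)) := by
        apply integral_mono_of_nonneg (Eventually.of_forall fun _ => by positivity) (integrable_const _)
        exact Eventually.of_forall fun x => pow_le_pow_left₀ (norm_nonneg _) (hG x) 2
    _ = _ := by simp

/-- frequencies -/
noncomputable def om (m : ℤ) : ℝ := Real.pi * m / 4

lemma fourier_om (m : ℤ) (x : ℝ) : (fourier m (x : AddCircle (8:ℝ)) : ℂ) = Complex.exp (Complex.I * (om m * x : ℝ)) := by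
  rw [fourier_coe_apply]; congr 1; unfold om; push_cast; ring

lemma fourier_sobolev (F : C(AddCircle (8:ℝ), ℂ)) (hF : ∀ x h : ℝ, ‖F (x + h : ℝ) - F (x:ℝ)‖ ≤ |h|) (s : Finset ℤ) :
    ∑ m ∈ s, (om m) ^ 2 * ‖fourierCoeff F m‖ ^ 2 ≤ 1 := by
  have key : ∀ h : ℝ, ∑ m ∈ s, ‖Complex.exp (Complex.I * (om m * h : ℝ)) - 1‖ ^ 2 * ‖fourierCoeff F m‖ ^ 2 ≤ h ^ 2 := by
    intro h
    let G : C(AddCircle (8:ℝ), ℂ) := ⟨fun x => F (x + (h : AddCircle (8:ℝ))) - F x, by fun_prop⟩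
    have hG : ∀ x, ‖G x‖ ≤ |h| := by
      intro x
      induction x using QuotientAddGroup.induction_on with
      | H x => exact hF x h
    have h1 := fourier_bessel G _ hG s
    rw [sq_abs] at h1
    refine le_trans (le_of_eq (Finset.sum_congr rfl fun m _ => ?_)) h1
    rw [← mul_pow, ← norm_mul]; congr 2
    have e1 : fourierCoeff (G : AddCircle (8:ℝ) → ℂ) m = fourierCoeff ((fun x => F (x + (h : AddCircle (8:ℝ)))) + (fun x => (-1 : ℂ) * F x)) m := by
      congr 1; ext x; simp [G]; ring
    rw [e1, fourierCoeff.add, Pi.add_apply, fourierCoeff.const_mul, fourierCoeff_shift, fourier_om]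
    · ring
    · exact (ContinuousMap.continuous (⟨fun x => F (x + (h : AddCircle (8:ℝ))), by fun_prop⟩ : C(AddCircle (8:ℝ), ℂ))).integrable_of_hasCompactSupport (HasCompactSupport.of_compactSpace _)
    · exact (by fun_prop : Continuous fun x => (-1 : ℂ) * F x).integrable_of_hasCompactSupport (HasCompactSupport.of_compactSpace _)
  have lim : ∀ m : ℤ, Tendsto (fun h : ℝ => ‖(Complex.exp (Complex.I * (om m * h : ℝ)) - 1)‖ ^ 2 / h ^ 2) (𝓝[≠] 0) (𝓝 (om m ^ 2)) := by
    intro m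
    have hd : HasDerivAt (fun h : ℝ => Complex.exp (Complex.I * (om m * h : ℝ))) (Complex.I * om m) 0 := by
      have h1 : HasDerivAt (fun h : ℝ => Complex.I * (om m * h : ℝ)) (Complex.I * om m) 0 := by
        have : HasDerivAt (fun h : ℝ => ((om m * h : ℝ) : ℂ)) (om m : ℂ) 0 := by
          have := ((hasDerivAt_id (0:ℝ)).const_mul (om m)).ofReal_comp
          simpa using this
        exact this.const_mul _
      have h2 := h1.cexp
      simpa using h2
    have h2 := (hd.tendsto_slope.norm).pow 2
    refine (h2.congr fun h => ?_).trans (le_of_eq ?_)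
    · rw [slope_def_module]; simp [mul_pow]; ring
    · simp
  have lim2 : Tendsto (fun h : ℝ => ∑ m ∈ s, (‖(Complex.exp (Complex.I * (om m * h : ℝ)) - 1)‖ ^ 2 / h ^ 2) * ‖fourierCoeff F m‖ ^ 2)
     (𝓝[≠] 0) (𝓝 (∑ m ∈ s, (om m) ^ 2 * ‖fourierCoeff F m‖ ^ 2)) :=
    tendsto_finsetSum _ fun m _ => (lim m).mul_const _
  refine le_of_tendsto lim2 ?_
  filter_upwards [self_mem_nhdsWithin] with h hh
  have hp : 0 < h ^ 2 := by have : h ≠ 0 := hh; positivity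
  have := key h
  rw [← div_le_one hp, Finset.sum_div] at this
  refine le_trans (le_of_eq (Finset.sum_congr rfl fun m _ => by ring)) this

/-- difference of characteristic functions at frequency `om m` -/
noncomputable def Dm (μ : Measure ℝ) (m : ℤ) : ℂ :=
  (∫ x : ℝ, Complex.exp (Complex.I * (om m * x : ℝ)) ∂μ) - ∫ x : ℝ, Complex.exp (Complex.I * (om m * x : ℝ)) ∂semicircle

lemma norm_expI (y : ℝ) : ‖Complex.exp (Complex.I * (y : ℝ))‖ = 1 := by
  rw [mul_comm]; exact Complex.norm_exp_ofReal_mul_I y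

lemma norm_char_le (μ : Measure ℝ) [IsProbabilityMeasure μ] (w : ℝ) :
    ‖∫ x : ℝ, Complex.exp (Complex.I * (w * x : ℝ)) ∂μ‖ ≤ 1 := by
  have := norm_integral_le_of_norm_le_const (μ := μ) (f := fun x : ℝ => Complex.exp (Complex.I * (w * x : ℝ))) (C := 1)
    (Eventually.of_forall fun x => (norm_expI _).le)
  simpa using this

lemma Dm_le (μ : Measure ℝ) [IsProbabilityMeasure μ] (m : ℤ) : ‖Dm μ m‖ ≤ 2 := by
  refine (norm_sub_le _ _).trans ?_
  have := norm_char_le μ (om m)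
  have := norm_char_le semicircle (om m)
  linarith

lemma om_ne {m : ℤ} (h : m ≠ 0) : om m ≠ 0 := by
  unfold om; have := Real.pi_ne_zero; have : (m:ℝ) ≠ 0 := by exact_mod_cast h
  positivity

lemma om_sq_summable : Summable fun m : ℤ => 1 / om m ^ 2 := by
  have h := Real.summable_one_div_int_pow.2 (by norm_num : 1 < 2)
  refine (h.mul_left (16 / Real.pi ^ 2)).congr fun m => ?_
  unfold om
  rcases eq_or_ne m 0 with rfl | hm
  · simp
  have := Real.pi_ne_zero; have : (m:ℝ) ≠ 0 := by exact_mod_cast hm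
  field_simp; norm_num

lemma Dm_summable (μ : Measure ℝ) [IsProbabilityMeasure μ] : Summable fun m : ℤ => ‖Dm μ m‖ ^ 2 / om m ^ 2 := by
  refine Summable.of_nonneg_of_le (fun m => by positivity) (fun m => ?_) (om_sq_summable.mul_left 4)
  rw [mul_one_div]
  gcongr
  have := Dm_le μ m
  have := norm_nonneg (Dm μ m)
  nlinarith

lemma Dm_zero (μ : Measure ℝ) [IsProbabilityMeasure μ] : Dm μ 0 = 0 := by
  simp [Dm, om]

lemma per_bound (μ : Measure ℝ) [IsProbabilityMeasure μ] (g : ℝ → ℝ) (hg : ∀ x y, |g x - g y| ≤ |x - y|)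
    (hp : Function.Periodic g 8) (s : ℝ) (hs : 0 < s) :
    |∫ x, g x ∂μ - ∫ x, g x ∂semicircle| ≤ 1 / 2 * (s + (∑' m : ℤ, ‖Dm μ m‖ ^ 2 / om m ^ 2) / s) := by
  have hgc : Continuous g := by
    have : LipschitzWith 1 g := LipschitzWith.of_dist_le_mul fun x y => by simpa [Real.dist_eq] using hg x y
    exact this.continuous
  have hp' : Function.Periodic (fun x => (g x : ℂ)) 8 := fun x => by simp [hp x]
  let F : C(AddCircle (8:ℝ), ℂ) := ⟨hp'.lift, by
    apply Continuous.quotient_lift; fun_prop⟩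
  have hF : ∀ x : ℝ, F (x : AddCircle (8:ℝ)) = g x := fun x => rfl
  have hsob := fourier_sobolev F (fun x h => by
    rw [hF, hF, ← Complex.ofReal_sub, Complex.norm_real, Real.norm_eq_abs]
    simpa using hg (x + h) x)
  have hS1 : Summable fun m : ℤ => om m ^ 2 * ‖fourierCoeff F m‖ ^ 2 :=
    summable_of_sum_le (fun m => by positivity) hsob
  have hT1 : ∑' m : ℤ, om m ^ 2 * ‖fourierCoeff F m‖ ^ 2 ≤ 1 := hS1.tsum_le_of_sum_le hsob
  have hcn : Summable fun m : ℤ => ‖fourierCoeff F m‖ := by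
    have h0 : Summable fun m : ℤ => (if m = 0 then ‖fourierCoeff F 0‖ else 0) :=
      summable_of_ne_finset_zero (s := {0}) (fun m hm => by simp at hm; simp [hm])
    refine Summable.of_nonneg_of_le (fun _ => norm_nonneg _) (fun m => ?_) (h0.add (hS1.add om_sq_summable))
    rcases eq_or_ne m 0 with rfl | hm
    · simp [om]
    · simp only [hm, if_false, zero_add]
      have h1 := om_ne hm
      have h2 : om m ^ 2 * ‖fourierCoeff F m‖ ^ 2 + 1 / om m ^ 2 - 2 * ‖fourierCoeff F m‖
         = (|om m| * ‖fourierCoeff F m‖ - 1 / |om m|) ^ 2 := by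
        have : |om m| ≠ 0 := abs_ne_zero.2 h1
        rw [← sq_abs (om m)]; field_simp; ring
      nlinarith [norm_nonneg (fourierCoeff F m), sq_nonneg (|om m| * ‖fourierCoeff F m‖ - 1 / |om m|)]
  have hc : Summable (fourierCoeff F) := hcn.of_norm
  have hpt := has_pointwise_sum_fourier_series_of_summable hc
  have hIntg : ∀ ν : Measure ℝ, IsProbabilityMeasure ν →
      HasSum (fun m : ℤ => fourierCoeff F m * ∫ x : ℝ, Complex.exp (Complex.I * (om m * x : ℝ)) ∂ν) (∫ x, (g x : ℂ) ∂ν) := by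
    intro ν hν
    have hexp : ∀ m : ℤ, Integrable (fun x : ℝ => Complex.exp (Complex.I * (om m * x : ℝ))) ν := fun m =>
      Integrable.of_bound (by fun_prop) 1 (Eventually.of_forall fun x => (norm_expI _).le)
    have h1 := hasSum_integral_of_summable_integral_norm (μ := ν)
      (F := fun (m : ℤ) (x : ℝ) => fourierCoeff F m * Complex.exp (Complex.I * (om m * x : ℝ)))
      (fun m => (hexp m).const_mul _) (by
        simp only [norm_mul, norm_expI, mul_one]
        simpa using hcn)
    simp only [integral_const_mul] at h1
    have h3 : ∀ x : ℝ, (∑' m : ℤ, fourierCoeff F m * Complex.exp (Complex.I * (om m * x : ℝ))) = (g x : ℂ) := by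
      intro x
      have h2 := hpt (x : AddCircle (8:ℝ))
      rw [hF] at h2
      rw [← h2.tsum_eq]
      refine tsum_congr fun m => ?_
      rw [fourier_om, smul_eq_mul]
    simp only [h3] at h1
    exact h1
  have hD : HasSum (fun m : ℤ => fourierCoeff F m * Dm μ m) (∫ x, (g x : ℂ) ∂μ - ∫ x, (g x : ℂ) ∂semicircle) := by
    refine ((hIntg μ inferInstance).sub (hIntg semicircle inferInstance)).congr_fun fun m => ?_
    unfold Dm; ring
  have hterm : ∀ m : ℤ, ‖fourierCoeff F m * Dm μ m‖ ≤ 1 / 2 * (s * (om m ^ 2 * ‖fourierCoeff F m‖ ^ 2) + (‖Dm μ m‖ ^ 2 / om m ^ 2) / s) := by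
    intro m
    rcases eq_or_ne m 0 with rfl | hm
    · rw [Dm_zero]; simp; positivity
    rw [norm_mul]
    have h1 : |om m| ≠ 0 := abs_ne_zero.2 (om_ne hm)
    have h3 := Real.sq_sqrt hs.le
    have h4 : Real.sqrt s ≠ 0 := (Real.sqrt_pos.2 hs).ne'
    have h2 : (s * (om m ^ 2 * ‖fourierCoeff F m‖ ^ 2) + (‖Dm μ m‖ ^ 2 / om m ^ 2) / s) - 2 * (‖fourierCoeff F m‖ * ‖Dm μ m‖)
         = (Real.sqrt s * |om m| * ‖fourierCoeff F m‖ - ‖Dm μ m‖ / |om m| / Real.sqrt s) ^ 2 := by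
        rw [← sq_abs (om m)]; nth_rw 1 2 [← h3]; field_simp; ring
    nlinarith [sq_nonneg (Real.sqrt s * |om m| * ‖fourierCoeff F m‖ - ‖Dm μ m‖ / |om m| / Real.sqrt s)]
  have hsum : HasSum (fun m : ℤ => 1 / 2 * (s * (om m ^ 2 * ‖fourierCoeff F m‖ ^ 2) + (‖Dm μ m‖ ^ 2 / om m ^ 2) / s))
     (1 / 2 * (s * (∑' m : ℤ, om m ^ 2 * ‖fourierCoeff F m‖ ^ 2) + (∑' m : ℤ, ‖Dm μ m‖ ^ 2 / om m ^ 2) / s)) :=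
    ((hS1.hasSum.mul_left s).add ((Dm_summable μ).hasSum.div_const s)).mul_left _
  have hfin := tsum_of_norm_bounded hsum hterm
  rw [hD.tsum_eq, integral_complex_ofReal, integral_complex_ofReal, ← Complex.ofReal_sub, Complex.norm_real, Real.norm_eq_abs] at hfin
  refine hfin.trans ?_
  have := mul_le_mul_of_nonneg_left hT1 hs.le
  linarith

-- Part PA3
/-- triangle wave -/
noncomputable def tri (x : ℝ) : ℝ := 2 - ‖((x - 2 : ℝ) : AddCircle (8:ℝ))‖

lemma tri_per : Function.Periodic tri 8 := by
  intro x; unfold tri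
  rw [show x + 8 - 2 = (x - 2) + 8 by ring, AddCircle.coe_add_period]

lemma addCircle_norm_le (x : ℝ) : ‖(x : AddCircle (8:ℝ))‖ ≤ |x| :=
  QuotientAddGroup.norm_mk_le_norm (S := AddSubgroup.zmultiples (8:ℝ)) (m := x)

lemma tri_lip (x y : ℝ) : |tri x - tri y| ≤ |x - y| := by
  unfold tri
  rw [show ∀ a b : ℝ, 2 - a - (2 - b) = b - a by intros; ring]
  refine (abs_norm_sub_norm_le _ _).trans ?_
  rw [← AddCircle.coe_sub]
  refine (addCircle_norm_le _).trans ?_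
  rw [show y - 2 - (x - 2) = -(x - y) by ring, abs_neg]

lemma tri_id {x : ℝ} (h : x ∈ Set.Icc (-2 : ℝ) 2) : tri x = x := by
  unfold tri
  rw [(AddCircle.norm_coe_eq_abs_iff (8:ℝ) (by norm_num)).2]
  · rw [abs_of_nonpos (by linarith [h.2])]; ring
  · rw [abs_of_nonpos (by linarith [h.2]), abs_of_pos (by norm_num)]; linarith [h.1]

lemma tri_abs (x : ℝ) : |tri x| ≤ 2 := by
  unfold tri
  have h := AddCircle.norm_le_half_period (8:ℝ) (x := ((x - 2 : ℝ) : AddCircle (8:ℝ))) (by norm_num)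
  rw [abs_of_pos (by norm_num : (0:ℝ) < 8)] at h
  have := norm_nonneg ((x - 2 : ℝ) : AddCircle (8:ℝ))
  rw [abs_le]; constructor <;> linarith

lemma tri_dist (x : ℝ) : |x - tri x| ≤ 1 / 2 * (x ^ 2 - tri x ^ 2) := by
  have ht := sq_le_sq' (abs_le.1 (tri_abs x)).1 (abs_le.1 (tri_abs x)).2
  rcases le_total x (-2) with h | h
  · have h2 : tri (-2) = -2 := tri_id (by norm_num)
    have h3 := tri_lip x (-2)
    rw [h2, abs_of_nonpos (by linarith : x - -2 ≤ 0)] at h3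
    have h4 : |x - tri x| ≤ 2 * (-2 - x) := by
      have := abs_le.1 h3
      rw [abs_le]; constructor <;> linarith
    nlinarith
  rcases le_total x 2 with h' | h'
  · rw [tri_id ⟨h, h'⟩]; simp
  · have h2 : tri 2 = 2 := tri_id (by norm_num)
    have h3 := tri_lip x 2
    rw [h2, abs_of_nonneg (by linarith : 0 ≤ x - 2)] at h3
    have h4 : |x - tri x| ≤ 2 * (x - 2) := by
      have := abs_le.1 h3
      rw [abs_le]; constructor <;> linarith
    nlinarith

lemma tri_sq_lip (x y : ℝ) : |tri x ^ 2 / 4 - tri y ^ 2 / 4| ≤ |x - y| := by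
  have h1 := tri_lip x y
  have h2 : |tri x + tri y| ≤ 4 := (abs_add_le _ _).trans (by linarith [tri_abs x, tri_abs y])
  rw [show tri x ^ 2 / 4 - tri y ^ 2 / 4 = (tri x - tri y) * ((tri x + tri y) / 4) by ring, abs_mul, abs_div,
    abs_of_pos (by norm_num : (0:ℝ) < 4)]
  have : |tri x + tri y| / 4 ≤ 1 := by linarith
  nlinarith [abs_nonneg (tri x - tri y)]

lemma lip_integrable (μ : Measure ℝ) [IsProbabilityMeasure μ] (h2 : Integrable (fun x : ℝ => x ^ 2) μ)
    (f : ℝ → ℝ) (hf : LipschitzWith 1 f) : Integrable f μ := by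
  refine Integrable.mono' (g := fun x => |f 0| + (1 + x ^ 2)) ((integrable_const _).add ((integrable_const _).add h2))
    hf.continuous.aestronglyMeasurable (Eventually.of_forall fun x => ?_)
  have := hf.dist_le_mul x 0
  simp [Real.dist_eq] at this
  have h3 : |f x| ≤ |f 0| + |x| := by
    have := abs_sub_abs_le_abs_sub (f x) (f 0); linarith
  rw [Real.norm_eq_abs]
  nlinarith [sq_nonneg (|x| - 1), sq_abs x]

/-- the Fourier bound for each Lipschitz test function -/
lemma test_bound (μ : Measure ℝ) [IsProbabilityMeasure μ] (h2 : Integrable (fun x : ℝ => x ^ 2) μ)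
    (f : ℝ → ℝ) (hf : LipschitzWith 1 f) (s : ℝ) (hs : 0 < s) :
    |∫ x, f x ∂μ - ∫ x, f x ∂semicircle| ≤
      3 / 2 * (s + (∑' m : ℤ, ‖Dm μ m‖ ^ 2 / om m ^ 2) / s) + 1 / 2 * (∫ x, x ^ 2 ∂μ - 1) := by
  have hf' : ∀ x y, |f x - f y| ≤ |x - y| := fun x y => by simpa [Real.dist_eq] using hf.dist_le_mul x y
  have htl : LipschitzWith 1 tri := LipschitzWith.of_dist_le_mul fun x y => by simpa [Real.dist_eq] using tri_lip x y
  have hftl : LipschitzWith 1 (fun x => f (tri x)) := by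
    have := hf.comp htl
    rw [one_mul] at this; exact this
  have b1 := per_bound μ (fun x => f (tri x)) (fun x y => (hf' _ _).trans (tri_lip x y)) (fun x => by simp [tri_per x]) s hs
  have b2 := per_bound μ (fun x => tri x ^ 2 / 4) tri_sq_lip (fun x => by simp [tri_per x]) s hs
  have e1 : ∫ x, f (tri x) ∂semicircle = ∫ x, f x ∂semicircle :=
    integral_congr_ae (by filter_upwards [sc_ae] with x hx; rw [tri_id hx])
  have e2 : ∫ x, tri x ^ 2 / 4 ∂semicircle = 1 / 4 := by
    rw [integral_div, ← sc_second]; congr 1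
    exact integral_congr_ae (by filter_upwards [sc_ae] with x hx; rw [tri_id hx])
  have hts : Integrable (fun x => tri x ^ 2) μ := Integrable.of_bound (by have := htl.continuous; fun_prop) 4 (Eventually.of_forall fun x => by
    have ht := sq_le_sq' (abs_le.1 (tri_abs x)).1 (abs_le.1 (tri_abs x)).2
    rw [Real.norm_eq_abs, abs_of_nonneg (by positivity)]; linarith)
  have i1 := lip_integrable μ h2 f hf
  have i2 := lip_integrable μ h2 _ hftl
  have b3 : |∫ x, f x ∂μ - ∫ x, f (tri x) ∂μ| ≤ 1 / 2 * (∫ x, x ^ 2 ∂μ - ∫ x, tri x ^ 2 ∂μ) := by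
    rw [← integral_sub i1 i2, ← integral_sub h2 hts, ← integral_const_mul]
    refine abs_integral_le_integral_abs.trans ?_
    refine integral_mono (i1.sub i2).abs ((h2.sub hts).const_mul _) fun x => ?_
    exact (hf' _ _).trans (tri_dist x)
  rw [e1] at b1
  rw [e2, integral_div] at b2
  rw [abs_le] at b1 b2 b3 ⊢
  constructor <;> linarith

lemma test_trivial (μ : Measure ℝ) [IsProbabilityMeasure μ] (h2 : Integrable (fun x : ℝ => x ^ 2) μ)
    (f : ℝ → ℝ) (hf : LipschitzWith 1 f) :
    |∫ x, f x ∂μ - ∫ x, f x ∂semicircle| ≤ 3 + ∫ x, x ^ 2 ∂μ := by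
  have hf' : ∀ x y, |f x - f y| ≤ |x - y| := fun x y => by simpa [Real.dist_eq] using hf.dist_le_mul x y
  have i1 := lip_integrable μ h2 f hf
  have i2 := sc_integrable f hf.continuous
  have b1 : |∫ x, f x ∂μ - f 0| ≤ 1 + ∫ x, x ^ 2 ∂μ := by
    have : ∫ x, f x ∂μ - f 0 = ∫ x, (f x - f 0) ∂μ := by rw [integral_sub i1 (integrable_const _)]; simp
    rw [this]
    refine abs_integral_le_integral_abs.trans ?_
    have : 1 + ∫ x, x ^ 2 ∂μ = ∫ x, (1 + x ^ 2) ∂μ := by rw [integral_add (integrable_const _) h2]; simp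
    rw [this]
    refine integral_mono (i1.sub (integrable_const _)).abs ((integrable_const _).add h2) fun x => ?_
    refine (hf' _ _).trans ?_
    rw [sub_zero]; nlinarith [sq_nonneg (|x| - 1), sq_abs x]
  have b2 : |∫ x, f x ∂semicircle - f 0| ≤ 2 := by
    have : ∫ x, f x ∂semicircle - f 0 = ∫ x, (f x - f 0) ∂semicircle := by rw [integral_sub i2 (integrable_const _)]; simp
    rw [this]
    refine abs_integral_le_integral_abs.trans ?_
    have : (2:ℝ) = ∫ x, 2 ∂semicircle := by simp
    rw [this]
    refine integral_mono_ae (i2.sub (integrable_const _)).abs (integrable_const _) ?_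
    filter_upwards [sc_ae] with x hx
    refine (hf' _ _).trans ?_
    rw [sub_zero, abs_le]; exact ⟨by linarith [hx.1], hx.2⟩
  rw [abs_le] at *
  constructor <;> linarith

lemma W1m_bdd (μ : Measure ℝ) [IsProbabilityMeasure μ] (h2 : Integrable (fun x : ℝ => x ^ 2) μ) :
    BddAbove (Set.range fun f : {f : ℝ → ℝ // LipschitzWith 1 f} => |(∫ x, f.1 x ∂μ) - ∫ x, f.1 x ∂semicircle|) :=
  ⟨_, by rintro _ ⟨f, rfl⟩; exact test_trivial μ h2 f.1 f.2⟩

instance : Nonempty {f : ℝ → ℝ // LipschitzWith 1 f} := ⟨⟨fun x => x, LipschitzWith.id⟩⟩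

lemma W1m_trivial (μ : Measure ℝ) [IsProbabilityMeasure μ] (h2 : Integrable (fun x : ℝ => x ^ 2) μ) :
    W1m μ semicircle ≤ 3 + ∫ x, x ^ 2 ∂μ :=
  ciSup_le fun f => test_trivial μ h2 f.1 f.2

lemma W1m_fourier (μ : Measure ℝ) [IsProbabilityMeasure μ] (h2 : Integrable (fun x : ℝ => x ^ 2) μ) (s : ℝ) (hs : 0 < s) :
    W1m μ semicircle ≤ 3 / 2 * (s + (∑' m : ℤ, ‖Dm μ m‖ ^ 2 / om m ^ 2) / s) + 1 / 2 * (∫ x, x ^ 2 ∂μ - 1) :=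
  ciSup_le fun f => test_bound μ h2 f.1 f.2 s hs

lemma W1m_nonneg (μ ν : Measure ℝ) : 0 ≤ W1m μ ν := Real.iSup_nonneg fun _ => abs_nonneg _

/-! spectral measures -/
section esd
variable {k : ℕ}

lemma esd_integral {M : Matrix (Fin k) (Fin k) ℂ} (h : M.IsHermitian) {E : Type*} [NormedAddCommGroup E] [NormedSpace ℝ E]
    [CompleteSpace E] (f : ℝ → E) : ∫ x, f x ∂(esd M) = (k : ℝ)⁻¹ • ∑ i, f (h.eigenvalues i) := by
  unfold esd
  rw [dif_pos h, integral_smul_measure, integral_finsetSum_measure]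
  · simp
  · intro i _; exact integrable_dirac (by simp)

lemma esd_integrable {M : Matrix (Fin k) (Fin k) ℂ} (hk : k ≠ 0) (h : M.IsHermitian) {E : Type*} [NormedAddCommGroup E]
     (f : ℝ → E) : Integrable f (esd M) := by
  unfold esd
  rw [dif_pos h]
  refine Integrable.smul_measure ?_ (by simpa using hk)
  rw [integrable_finsetSum_measure]
  intro i _; exact integrable_dirac (by simp)

lemma esd_prob {M : Matrix (Fin k) (Fin k) ℂ} (hk : k ≠ 0) (h : M.IsHermitian) : IsProbabilityMeasure (esd M) := by
  constructor
  unfold esd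
  rw [dif_pos h]
  simp
  rw [ENNReal.inv_mul_cancel] <;> simp [hk]

end esd

-- Part PA4
/-- Frobenius norm -/
noncomputable def fro {m n : Type*} [Fintype m] [Fintype n] (A : Matrix m n ℂ) : ℝ :=
  @norm _ (Matrix.frobeniusNormedAddCommGroup (m := m) (n := n) (α := ℂ)).toNorm A

section fro
variable {m n l : Type*} [Fintype m] [Fintype n] [Fintype l]

lemma fro_nonneg (A : Matrix m n ℂ) : 0 ≤ fro A := by
  let _ := Matrix.frobeniusNormedAddCommGroup (m := m) (n := n) (α := ℂ)
  exact norm_nonneg A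

lemma fro_sq (A : Matrix m n ℂ) : fro A ^ 2 = ∑ i, ∑ j, ‖A i j‖ ^ 2 := by
  unfold fro
  rw [Matrix.frobenius_norm_def, ← Real.sqrt_eq_rpow, Real.sq_sqrt (by positivity)]
  simp

lemma fro_eq (A : Matrix m n ℂ) : fro A = Real.sqrt (∑ i, ∑ j, ‖A i j‖ ^ 2) := by
  rw [← fro_sq, Real.sqrt_sq (fro_nonneg A)]

lemma fro_add_le (A B : Matrix m n ℂ) : fro (A + B) ≤ fro A + fro B := by
  let _ := Matrix.frobeniusNormedAddCommGroup (m := m) (n := n) (α := ℂ)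
  exact norm_add_le A B

lemma fro_neg (A : Matrix m n ℂ) : fro (-A) = fro A := by
  let _ := Matrix.frobeniusNormedAddCommGroup (m := m) (n := n) (α := ℂ)
  exact norm_neg A

lemma fro_sub_comm (A B : Matrix m n ℂ) : fro (A - B) = fro (B - A) := by
  let _ := Matrix.frobeniusNormedAddCommGroup (m := m) (n := n) (α := ℂ)
  exact norm_sub_rev A B

lemma fro_smul (c : ℂ) (A : Matrix m n ℂ) : fro (c • A) = ‖c‖ * fro A := by
  rw [fro_eq, fro_eq, ← Real.sqrt_sq (norm_nonneg c), ← Real.sqrt_mul (by positivity)]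
  congr 1
  simp [Finset.mul_sum, mul_pow]

lemma fro_rsmul (c : ℝ) (A : Matrix m n ℂ) : fro (c • A) = |c| * fro A := by
  have : c • A = (c : ℂ) • A := by ext i j; simp
  rw [this, fro_smul, Complex.norm_real, Real.norm_eq_abs]

lemma fro_mul_le (A : Matrix m n ℂ) (B : Matrix n l ℂ) : fro (A * B) ≤ fro A * fro B :=
  Matrix.frobenius_norm_mul A B

lemma fro_sq_trace (A : Matrix m n ℂ) : ((fro A ^ 2 : ℝ) : ℂ) = (A * Aᴴ).trace := by
  rw [fro_sq]
  simp only [Matrix.trace, Matrix.diag, Matrix.mul_apply, Matrix.conjTranspose_apply]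
  push_cast
  refine Finset.sum_congr rfl fun i _ => Finset.sum_congr rfl fun j _ => ?_
  rw [← Complex.mul_conj']; rfl

lemma fro_conjTranspose (A : Matrix m n ℂ) : fro Aᴴ = fro A := by
  rw [fro_eq, fro_eq, Finset.sum_comm]; simp

lemma fro_mul_unitary [DecidableEq n] (A : Matrix m n ℂ) (U : Matrix n n ℂ) (hU : U * Uᴴ = 1) : fro (A * U) = fro A := by
  have h : fro (A * U) ^ 2 = fro A ^ 2 := by
    apply Complex.ofReal_injective
    rw [fro_sq_trace, fro_sq_trace, Matrix.conjTranspose_mul, Matrix.mul_assoc, ← Matrix.mul_assoc U, hU, Matrix.one_mul]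
  exact (sq_eq_sq₀ (fro_nonneg _) (fro_nonneg _)).1 h

lemma fro_unitary_mul [DecidableEq m] (A : Matrix m n ℂ) (U : Matrix m m ℂ) (hU : Uᴴ * U = 1) : fro (U * A) = fro A := by
  rw [← fro_conjTranspose, Matrix.conjTranspose_mul, fro_mul_unitary _ _ (by simpa using hU), fro_conjTranspose]

end fro

section HW
variable {k : ℕ}

lemma spectral_decomp {A : Matrix (Fin k) (Fin k) ℂ} (hA : A.IsHermitian) :
    A = (hA.eigenvectorUnitary : Matrix (Fin k) (Fin k) ℂ) * diagonal (fun i => (hA.eigenvalues i : ℂ)) *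
      (hA.eigenvectorUnitary : Matrix (Fin k) (Fin k) ℂ)ᴴ := by
  have := hA.spectral_theorem
  rw [Unitary.conjStarAlgAut_apply] at this
  exact this

lemma fro_sq_eig {A : Matrix (Fin k) (Fin k) ℂ} (hA : A.IsHermitian) : fro A ^ 2 = ∑ i, hA.eigenvalues i ^ 2 := by
  set U := (hA.eigenvectorUnitary : Matrix (Fin k) (Fin k) ℂ)
  have hU1 : Uᴴ * U = 1 := Matrix.mem_unitaryGroup_iff'.1 hA.eigenvectorUnitary.2
  have hU2 : U * Uᴴ = 1 := Matrix.mem_unitaryGroup_iff.1 hA.eigenvectorUnitary.2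
  have h : fro A = fro (diagonal (fun i => (hA.eigenvalues i : ℂ))) := by
    nth_rw 1 [spectral_decomp hA]
    rw [fro_mul_unitary _ _ (by simpa using hU1), fro_unitary_mul _ _ hU1]
  rw [h, fro_sq]
  refine Finset.sum_congr rfl fun i _ => ?_
  rw [Finset.sum_eq_single i] <;> simp +contextual [Matrix.diagonal_apply]
  intro b hb h; exact absurd h.symm hb

lemma test_perturb (hk : k ≠ 0) {A B : Matrix (Fin k) (Fin k) ℂ} (hA : A.IsHermitian) (hB : B.IsHermitian)
    (f : ℝ → ℝ) (hf : ∀ x y, |f x - f y| ≤ |x - y|) :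
    |(∑ i, f (hA.eigenvalues i)) - ∑ i, f (hB.eigenvalues i)| ≤ Real.sqrt k * fro (A - B) := by
  set U := (hA.eigenvectorUnitary : Matrix (Fin k) (Fin k) ℂ) with hUd
  have hU1 : Uᴴ * U = 1 := Matrix.mem_unitaryGroup_iff'.1 hA.eigenvectorUnitary.2
  have hU2 : U * Uᴴ = 1 := Matrix.mem_unitaryGroup_iff.1 hA.eigenvectorUnitary.2
  set V := (hB.eigenvectorUnitary : Matrix (Fin k) (Fin k) ℂ) with hVd
  have hV1 : Vᴴ * V = 1 := Matrix.mem_unitaryGroup_iff'.1 hB.eigenvectorUnitary.2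
  have hV2 : V * Vᴴ = 1 := Matrix.mem_unitaryGroup_iff.1 hB.eigenvectorUnitary.2
  set α := hA.eigenvalues
  set β := hB.eigenvalues
  set P := Uᴴ * V with hP
  have hP1 : P * Pᴴ = 1 := by
    rw [hP, conjTranspose_mul, conjTranspose_conjTranspose, Matrix.mul_assoc, ← Matrix.mul_assoc V, hV2, Matrix.one_mul, hU1]
  have hP2 : Pᴴ * P = 1 := by
    rw [hP, conjTranspose_mul, conjTranspose_conjTranspose, Matrix.mul_assoc, ← Matrix.mul_assoc U, hU2, Matrix.one_mul, hV1]
  have hrow : ∀ i, ∑ j, ‖P i j‖ ^ 2 = 1 := by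
    intro i
    have := congrFun (congrFun hP1 i) i
    simp only [Matrix.mul_apply, Matrix.conjTranspose_apply, Matrix.one_apply_eq] at this
    apply Complex.ofReal_injective
    rw [Complex.ofReal_one, ← this]; push_cast
    exact Finset.sum_congr rfl fun j _ => by rw [← Complex.mul_conj']; rfl
  have hcol : ∀ j, ∑ i, ‖P i j‖ ^ 2 = 1 := by
    intro i
    have := congrFun (congrFun hP2 i) i
    simp only [Matrix.mul_apply, Matrix.conjTranspose_apply, Matrix.one_apply_eq] at this
    apply Complex.ofReal_injective
    rw [Complex.ofReal_one, ← this]; push_cast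
    exact Finset.sum_congr rfl fun j _ => by rw [← Complex.conj_mul']; rfl
  have hfro : fro (A - B) ^ 2 = ∑ i, ∑ j, (α i - β j) ^ 2 * ‖P i j‖ ^ 2 := by
    have h1 : fro (A - B) = fro (Uᴴ * (A - B) * V) := by
      rw [fro_mul_unitary _ _ hV2, fro_unitary_mul _ _ (by simpa using hU2)]
    have h2 : Uᴴ * (A - B) * V = diagonal (fun i => (α i : ℂ)) * P - P * diagonal (fun i => (β i : ℂ)) := by
      have e1 : Uᴴ * A = diagonal (fun i => (α i : ℂ)) * Uᴴ := by
        nth_rw 1 [spectral_decomp hA]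
        rw [← hUd, ← Matrix.mul_assoc, ← Matrix.mul_assoc, hU1, Matrix.one_mul]
      have e2 : B * V = V * diagonal (fun i => (β i : ℂ)) := by
        nth_rw 1 [spectral_decomp hB]
        rw [← hVd, Matrix.mul_assoc, hV1, Matrix.mul_one]
      rw [Matrix.mul_sub, Matrix.sub_mul, e1, Matrix.mul_assoc Uᴴ B, e2, hP, Matrix.mul_assoc, Matrix.mul_assoc]
    rw [h1, h2, fro_sq]
    refine Finset.sum_congr rfl fun i _ => Finset.sum_congr rfl fun j _ => ?_
    rw [Matrix.sub_apply, Matrix.diagonal_mul, Matrix.mul_diagonal, mul_comm (P i j), ← sub_mul, norm_mul, mul_pow,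
      ← Complex.ofReal_sub, Complex.norm_real, Real.norm_eq_abs, sq_abs]
  have e : (∑ i, f (α i)) - ∑ i, f (β i) = ∑ i, ∑ j, (f (α i) - f (β j)) * ‖P i j‖ ^ 2 := by
    simp_rw [sub_mul, Finset.sum_sub_distrib]
    congr 1
    · exact Finset.sum_congr rfl fun i _ => by rw [← Finset.mul_sum, hrow, mul_one]
    · rw [Finset.sum_comm]; exact Finset.sum_congr rfl fun i _ => by rw [← Finset.mul_sum, hcol, mul_one]
  rw [e]
  rw [← Real.sqrt_sq (fro_nonneg (A - B)), ← Real.sqrt_mul (by positivity)]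
  apply Real.le_sqrt_of_sq_le
  rw [sq_abs, hfro]
  have cs := Finset.sum_mul_sq_le_sq_mul_sq (Finset.univ : Finset (Fin k × Fin k)) (fun p => ‖P p.1 p.2‖)
    (fun p => (f (α p.1) - f (β p.2)) * ‖P p.1 p.2‖)
  simp only [Fintype.sum_prod_type] at cs
  have e3 : ∑ i, ∑ j, (f (α i) - f (β j)) * ‖P i j‖ ^ 2 = ∑ i, ∑ j, ‖P i j‖ * ((f (α i) - f (β j)) * ‖P i j‖) :=
    Finset.sum_congr rfl fun i _ => Finset.sum_congr rfl fun j _ => by ring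
  rw [e3]
  refine cs.trans ?_
  have e4 : ∑ i, ∑ j, ‖P i j‖ ^ 2 = (k : ℝ) := by simp [hrow]
  rw [e4]
  gcongr with i _ j _
  rw [mul_pow]; refine mul_le_mul_of_nonneg_right ?_ (by positivity)
  exact sq_le_sq.2 (hf _ _)

/-- the distance functional -/
noncomputable def Wsc (A : Matrix (Fin k) (Fin k) ℂ) : ℝ := W1m (esd A) semicircle

lemma Wsc_perturb (hk : k ≠ 0) {A B : Matrix (Fin k) (Fin k) ℂ} (hA : A.IsHermitian) (hB : B.IsHermitian) :
    Wsc A ≤ Wsc B + (Real.sqrt k)⁻¹ * fro (A - B) := by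
  have := esd_prob hk hA
  have := esd_prob hk hB
  refine ciSup_le fun f => ?_
  have hf' : ∀ x y, |f.1 x - f.1 y| ≤ |x - y| := fun x y => by simpa [Real.dist_eq] using f.2.dist_le_mul x y
  have h1 : |(∫ x, f.1 x ∂(esd B)) - ∫ x, f.1 x ∂semicircle| ≤ Wsc B := le_ciSup (W1m_bdd (esd B) (esd_integrable hk hB _)) f
  have h2 := test_perturb hk hA hB f.1 hf'
  have h3 : |(∫ x, f.1 x ∂(esd A)) - ∫ x, f.1 x ∂(esd B)| ≤ (Real.sqrt k)⁻¹ * fro (A - B) := by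
    rw [esd_integral hA, esd_integral hB, ← smul_sub, smul_eq_mul, abs_mul, abs_of_nonneg (by positivity)]
    refine (mul_le_mul_of_nonneg_left h2 (by positivity)).trans (le_of_eq ?_)
    have hk' : (0:ℝ) < k := by exact_mod_cast Nat.pos_of_ne_zero hk
    have h4 := Real.mul_self_sqrt hk'.le
    have h5 := (Real.sqrt_pos.2 hk').ne'
    rw [← mul_assoc]; congr 1
    rw [inv_mul_eq_div, div_eq_iff hk'.ne', inv_mul_eq_div, eq_div_iff h5, h4]
  rw [abs_le] at *
  constructor <;> linarith

lemma Wsc_abs_perturb (hk : k ≠ 0) {A B : Matrix (Fin k) (Fin k) ℂ} (hA : A.IsHermitian) (hB : B.IsHermitian) :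
    |Wsc A - Wsc B| ≤ (Real.sqrt k)⁻¹ * fro (A - B) := by
  have h1 := Wsc_perturb hk hA hB
  have h2 := Wsc_perturb hk hB hA
  rw [fro_sub_comm] at h2
  rw [abs_le]; constructor <;> linarith

lemma Wsc_nonneg (A : Matrix (Fin k) (Fin k) ℂ) : 0 ≤ Wsc A := W1m_nonneg _ _

lemma Wsc_trivial (hk : k ≠ 0) {A : Matrix (Fin k) (Fin k) ℂ} (hA : A.IsHermitian) :
    Wsc A ≤ 3 + (k:ℝ)⁻¹ * fro A ^ 2 := by
  have := esd_prob hk hA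
  refine (W1m_trivial (esd A) (esd_integrable hk hA _)).trans (le_of_eq ?_)
  rw [esd_integral hA, fro_sq_eig hA, smul_eq_mul]

lemma Wsc_fourier (hk : k ≠ 0) {A : Matrix (Fin k) (Fin k) ℂ} (hA : A.IsHermitian) (s : ℝ) (hs : 0 < s) :
    Wsc A ≤ 3 / 2 * (s + (∑' m : ℤ, ‖Dm (esd A) m‖ ^ 2 / om m ^ 2) / s) + 1 / 2 * ((k:ℝ)⁻¹ * fro A ^ 2 - 1) := by
  have := esd_prob hk hA
  refine (W1m_fourier (esd A) (esd_integrable hk hA _) s hs).trans (le_of_eq ?_)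
  rw [esd_integral hA, fro_sq_eig hA, smul_eq_mul]

end HW

-- Part PB
/-- characteristic function of the semicircle law -/
noncomputable def phi (t : ℝ) : ℝ := ∫ x, Real.cos (t * x) ∂semicircle
noncomputable def phi1 (t : ℝ) : ℝ := ∫ x, -(x * Real.sin (t * x)) ∂semicircle
noncomputable def phi2 (t : ℝ) : ℝ := ∫ x, -(x ^ 2 * Real.cos (t * x)) ∂semicircle

lemma phi_hasDerivAt (t : ℝ) : HasDerivAt phi (phi1 t) t := by
  have := hasDerivAt_integral_of_dominated_loc_of_deriv_le (μ := semicircle) (s := Set.univ) (x₀ := t)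
    (F := fun t x => Real.cos (t * x)) (F' := fun t x => -(x * Real.sin (t * x))) (bound := fun x => |x|)
    Filter.univ_mem (Eventually.of_forall fun t => by fun_prop)
    (sc_integrable _ (by fun_prop)) (by fun_prop)
    (Eventually.of_forall fun x t _ => by
      rw [Real.norm_eq_abs, abs_neg, abs_mul]
      exact mul_le_of_le_one_right (abs_nonneg _) (Real.abs_sin_le_one _))
    (sc_integrable _ (by fun_prop))
    (Eventually.of_forall fun x t _ => by
      have h : HasDerivAt (fun t : ℝ => t * x) x t := by simpa using (hasDerivAt_id t).mul_const x
      exact h.cos.congr_deriv (by ring))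
  exact this.2

lemma phi1_hasDerivAt (t : ℝ) : HasDerivAt phi1 (phi2 t) t := by
  have := hasDerivAt_integral_of_dominated_loc_of_deriv_le (μ := semicircle) (s := Set.univ) (x₀ := t)
    (F := fun t x => -(x * Real.sin (t * x))) (F' := fun t x => -(x ^ 2 * Real.cos (t * x))) (bound := fun x => x ^ 2)
    Filter.univ_mem (Eventually.of_forall fun t => by fun_prop)
    (sc_integrable _ (by fun_prop)) (by fun_prop)
    (Eventually.of_forall fun x t _ => by
      rw [Real.norm_eq_abs, abs_neg, abs_mul, abs_pow, sq_abs]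
      exact mul_le_of_le_one_right (by positivity) (Real.abs_cos_le_one _))
    (sc_integrable _ (by fun_prop))
    (Eventually.of_forall fun x t _ => by
      have h : HasDerivAt (fun t : ℝ => t * x) x t := by simpa using (hasDerivAt_id t).mul_const x
      exact (h.sin.const_mul x).neg.congr_deriv (by ring))
  exact this.2

lemma phi_ode (t : ℝ) : t * phi2 t + 3 * phi1 t + 4 * t * phi t = 0 := by
  have h := sc_ibp (fun x => Real.sin (t * x)) (fun x => t * Real.cos (t * x)) (fun x => by
      have h : HasDerivAt (fun x : ℝ => t * x) t x := by simpa using (hasDerivAt_id x).const_mul t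
      exact h.sin.congr_deriv (by ring)) (by fun_prop)
  rw [phi2, phi1, phi, ← integral_const_mul, ← integral_const_mul, ← integral_const_mul, ← integral_add, ← integral_add, ← h]
  · congr 1; ext x; ring
  all_goals exact sc_integrable _ (by fun_prop)

lemma phi_abs (t : ℝ) : |phi t| ≤ 1 := by
  have := norm_integral_le_of_norm_le_const (μ := semicircle) (f := fun x : ℝ => Real.cos (t * x)) (C := 1)
    (Eventually.of_forall fun x => Real.abs_cos_le_one _)
  unfold phi; simpa using this

lemma phi1_abs (t : ℝ) : |phi1 t| ≤ 2 := by
  have := norm_integral_le_of_norm_le_const (μ := semicircle) (f := fun x : ℝ => -(x * Real.sin (t * x))) (C := 2)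
    (by filter_upwards [sc_ae] with x hx
        rw [Real.norm_eq_abs, abs_neg, abs_mul]
        have h1 : |x| ≤ 2 := abs_le.2 hx
        have h2 := Real.abs_sin_le_one (t * x)
        nlinarith [abs_nonneg x, abs_nonneg (Real.sin (t * x))])
  unfold phi1; simpa using this

lemma phi_zero : phi 0 = 1 := by simp [phi]
lemma phi1_zero : phi1 0 = 0 := by simp [phi1]

lemma phi_decay {t : ℝ} (ht : 0 ≤ t) : t ^ 3 * phi t ^ 2 ≤ 400 := by
  rcases le_total t 1 with h1 | h1
  · have h2 := phi_abs t
    have h3 : phi t ^ 2 ≤ 1 := by rw [← sq_abs]; nlinarith [abs_nonneg (phi t)]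
    have h4 : t ^ 3 ≤ 1 := pow_le_one₀ ht h1
    nlinarith [sq_nonneg (phi t), pow_nonneg ht 3]
  let K : ℝ → ℝ := fun t => t ^ 3 * (phi1 t ^ 2 + 4 * phi t ^ 2) + 3 * t ^ 2 * (phi t * phi1 t)
  let Kd : ℝ → ℝ := fun t => -3 * t * (phi t * phi1 t)
  have hK : ∀ t : ℝ, t ≠ 0 → HasDerivAt K (Kd t) t := by
    intro t ht
    have a := phi_hasDerivAt t
    have b := phi1_hasDerivAt t
    have h := ((hasDerivAt_pow 3 t).mul ((b.pow 2).add ((a.pow 2).const_mul 4))).add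
      (((hasDerivAt_pow 2 t).const_mul 3).mul (a.mul b))
    refine h.congr_deriv ?_
    have ho := phi_ode t
    simp [Kd]
    linear_combination (2 * t ^ 2 * phi1 t + 3 * t * phi t) * ho
  have hq : ∀ t, |phi t * phi1 t| ≤ (phi1 t ^ 2 + 4 * phi t ^ 2) / 4 := by
    intro t; rw [abs_le]; constructor <;> nlinarith [sq_nonneg (phi1 t - 2 * phi t), sq_nonneg (phi1 t + 2 * phi t)]
  have hKl : ∀ t, 1 ≤ t → t ^ 3 * (phi1 t ^ 2 + 4 * phi t ^ 2) / 4 ≤ K t := by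
    intro t ht
    have h1 := (abs_le.1 (hq t)).1
    have h2 : 0 ≤ phi1 t ^ 2 + 4 * phi t ^ 2 := by positivity
    have h3 : t ^ 2 ≤ t ^ 3 := pow_le_pow_right₀ ht (by norm_num)
    have h4 : 0 ≤ t ^ 2 := by positivity
    simp only [K]
    nlinarith [mul_le_mul_of_nonneg_left h1 h4, mul_le_mul_of_nonneg_right h3 h2]
  have hKd : ∀ t, 1 ≤ t → Kd t ≤ 3 / t ^ 2 * K t := by
    intro t ht
    have h1 := (abs_le.1 (hq t)).1
    have h2 := hKl t ht
    have h5 : Kd t ≤ 3 * t * ((phi1 t ^ 2 + 4 * phi t ^ 2) / 4) := by simp only [Kd]; nlinarith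
    refine h5.trans ?_
    have h6 : 3 / t ^ 2 * (t ^ 3 * (phi1 t ^ 2 + 4 * phi t ^ 2) / 4) ≤ 3 / t ^ 2 * K t := by gcongr
    refine le_trans (le_of_eq ?_) h6
    field_simp
  have anti : AntitoneOn (fun t => K t * Real.exp (3 / t)) (Set.Ici 1) := by
    have hd : ∀ t : ℝ, 1 ≤ t → HasDerivAt (fun t => K t * Real.exp (3 / t)) ((Kd t - 3 / t ^ 2 * K t) * Real.exp (3 / t)) t := by
      intro t ht
      have h0 : t ≠ 0 := by linarith
      have h1 : HasDerivAt (fun t : ℝ => 3 / t) (-(3 / t ^ 2)) t := by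
        have := (hasDerivAt_inv h0).const_mul 3
        refine (this.congr_deriv ?_)
        field_simp
      exact ((hK t h0).mul h1.exp).congr_deriv (by ring)
    apply antitoneOn_of_deriv_nonpos (convex_Ici 1)
    · intro t ht; exact (hd t ht).continuousAt.continuousWithinAt
    · intro t ht; rw [interior_Ici] at ht; exact (hd t (le_of_lt ht)).differentiableAt.differentiableWithinAt
    · intro t ht; rw [interior_Ici] at ht
      rw [(hd t (le_of_lt ht)).deriv]
      have := hKd t (le_of_lt ht)
      exact mul_nonpos_of_nonpos_of_nonneg (by linarith) (Real.exp_nonneg _)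
  have h3 := anti (Set.mem_Ici.2 le_rfl) (Set.mem_Ici.2 h1) h1
  simp only [div_one] at h3
  have hK1 : K 1 ≤ 14 := by
    simp only [K]
    have a := phi_abs 1
    have b := phi1_abs 1
    have c : |phi 1 * phi1 1| ≤ 2 := by rw [abs_mul]; nlinarith [abs_nonneg (phi 1), abs_nonneg (phi1 1)]
    have := (abs_le.1 c).2
    nlinarith [sq_abs (phi 1), sq_abs (phi1 1), abs_nonneg (phi 1), abs_nonneg (phi1 1)]
  have hKn : 0 ≤ K t := le_trans (by positivity) (hKl t h1)
  have hKn1 : 0 ≤ K 1 := le_trans (by positivity) (hKl 1 le_rfl)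
  have h4 : K t ≤ K t * Real.exp (3 / t) := le_mul_of_one_le_right hKn (Real.one_le_exp (by positivity))
  have h5 : Real.exp 3 ≤ 21 := by
    have : Real.exp 3 = Real.exp 1 ^ 3 := by rw [← Real.exp_nat_mul]; norm_num
    rw [this]
    have := Real.exp_one_lt_d9
    calc Real.exp 1 ^ 3 ≤ 2.7182818286 ^ 3 := by gcongr
      _ ≤ 21 := by norm_num
  have h6 := hKl t h1
  have h7 : 0 ≤ t ^ 3 * phi1 t ^ 2 := by positivity
  nlinarith [Real.exp_nonneg 3]

lemma sc_char (t : ℝ) : ∫ x : ℝ, Complex.exp (Complex.I * (t * x : ℝ)) ∂semicircle = (phi t : ℂ) := by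
  have h1 : ∀ x : ℝ, Complex.exp (Complex.I * (t * x : ℝ)) = (Real.cos (t * x) : ℂ) + (Real.sin (t * x) : ℂ) * Complex.I := by
    intro x; rw [mul_comm, Complex.exp_mul_I, Complex.ofReal_cos, Complex.ofReal_sin]
  simp_rw [h1]
  rw [integral_add, integral_mul_const, integral_complex_ofReal, integral_complex_ofReal]
  · have : ∫ x, Real.sin (t * x) ∂semicircle = 0 := by
      rw [sc_integral]
      have h2 := intervalIntegral.integral_comp_neg (a := -2) (b := 2) (fun x : ℝ => scd x • Real.sin (t * x))
      simp only [neg_neg] at h2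
      have h3 : ∀ x, scd (-x) = scd x := fun x => by simp [scd]
      simp only [h3, mul_neg, Real.sin_neg, smul_neg, intervalIntegral.integral_neg] at h2
      linarith
    rw [this]; simp [phi]
  all_goals exact sc_integrable _ (by fun_prop)

/-- energy estimate for the perturbed Bessel equation -/
lemma ode_energy (K : ℝ) (hK : 0 < K) (e e1 e2 r : ℝ → ℝ) (h1 : ∀ t, HasDerivAt e (e1 t) t) (h2 : ∀ t, HasDerivAt e1 (e2 t) t)
    (hode : ∀ t, 0 < t → t ≤ K → t * e2 t + 3 * e1 t + (4 - t ^ 2 / K ^ 2) * t * e t = t * r t)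
    (hr : ∀ t, 0 < t → t ≤ K → |r t| ≤ 20 * Real.sqrt t / K ^ 2) (he : e 0 = 0) (he1 : e1 0 = 0) (t : ℝ) (ht : 0 ≤ t) (htK : t ≤ K) :
    |e t| ≤ 14 * (t * Real.sqrt t) / K ^ 2 := by
  let H : ℝ → ℝ := fun t => e1 t ^ 2 + (4 - t ^ 2 / K ^ 2) * e t ^ 2
  let Hd : ℝ → ℝ := fun t => 2 * e1 t * e2 t + (4 - t ^ 2 / K ^ 2) * (2 * e t * e1 t) - 2 * t / K ^ 2 * e t ^ 2
  have hH : ∀ t, HasDerivAt H (Hd t) t := by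
    intro t
    have h3 : HasDerivAt (fun t : ℝ => 4 - t ^ 2 / K ^ 2) (-(2 * t / K ^ 2)) t := by
      have := ((hasDerivAt_pow 2 t).div_const (K ^ 2)).const_sub 4
      simpa using this
    refine (((h2 t).pow 2).add (h3.mul ((h1 t).pow 2))).congr_deriv ?_
    simp [Hd]; ring
  have hq : ∀ t, 0 ≤ t → t ≤ K → 3 ≤ 4 - t ^ 2 / K ^ 2 := by
    intro t h0 h; have : t ^ 2 / K ^ 2 ≤ 1 := by rw [div_le_one (by positivity)]; gcongr
    linarith
  have hHn : ∀ t, 0 ≤ t → t ≤ K → 0 ≤ H t := by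
    intro t h0 h; have := hq t h0 h; simp only [H]; positivity
  have hHd : ∀ t, 0 < t → t ≤ K → Hd t ≤ 2 * (Real.sqrt (H t)) * (20 * Real.sqrt t / K ^ 2) := by
    intro t h0 h
    have hh := hode t h0 h
    have e2e : e2 t = r t - 3 * e1 t / t - (4 - t ^ 2 / K ^ 2) * e t := by
      field_simp at hh ⊢; linarith
    have a1 : |e1 t| ≤ Real.sqrt (H t) := by
      apply Real.abs_le_sqrt
      have := hq t h0.le h; simp only [H]; nlinarith [sq_nonneg (e t)]
    have a2 : Hd t = 2 * (e1 t * r t) - 6 * e1 t ^ 2 / t - 2 * t / K ^ 2 * e t ^ 2 := by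
      simp only [Hd]; rw [e2e]; ring
    have a3 : e1 t * r t ≤ Real.sqrt (H t) * (20 * Real.sqrt t / K ^ 2) := by
      refine (le_abs_self _).trans ?_; rw [abs_mul]
      exact mul_le_mul a1 (hr t h0 h) (abs_nonneg _) (Real.sqrt_nonneg _)
    have a4 : 0 ≤ 6 * e1 t ^ 2 / t := by positivity
    have a5 : 0 ≤ 2 * t / K ^ 2 * e t ^ 2 := by positivity
    rw [a2]; linarith
  have hsd : ∀ t : ℝ, 0 < t → HasDerivAt (fun t => 40 / 3 * (t * Real.sqrt t) / K ^ 2) (20 * Real.sqrt t / K ^ 2) t := by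
    intro t h0
    have := (((hasDerivAt_id t).mul (Real.hasDerivAt_sqrt h0.ne')).const_mul (40/3)).div_const (K ^ 2)
    refine this.congr_deriv ?_
    have h4 := Real.mul_self_sqrt h0.le
    have h5 := (Real.sqrt_pos.2 h0).ne'
    simp only [id]
    field_simp
    nlinarith
  have main : ∀ ε : ℝ, 0 < ε → Real.sqrt (H t) ≤ 40 / 3 * (t * Real.sqrt t) / K ^ 2 + Real.sqrt ε := by
    intro ε hε
    have hd : ∀ t, 0 < t → t ≤ K → HasDerivAt (fun t => Real.sqrt (H t + ε) - 40 / 3 * (t * Real.sqrt t) / K ^ 2)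
        (Hd t / (2 * Real.sqrt (H t + ε)) - 20 * Real.sqrt t / K ^ 2) t := by
      intro t h0 h
      have hp : H t + ε ≠ 0 := by have := hHn t h0.le h; positivity
      exact (((hH t).add_const ε).sqrt hp).sub (hsd t h0)
    have anti : AntitoneOn (fun t => Real.sqrt (H t + ε) - 40 / 3 * (t * Real.sqrt t) / K ^ 2) (Set.Icc 0 K) := by
      apply antitoneOn_of_deriv_nonpos (convex_Icc 0 K)
      · have : Continuous H := continuous_iff_continuousAt.2 fun t => (hH t).continuousAt
        fun_prop
      · intro t ht; rw [interior_Icc] at ht; exact (hd t ht.1 ht.2.le).differentiableAt.differentiableWithinAt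
      · intro t ht; rw [interior_Icc] at ht
        rw [(hd t ht.1 ht.2.le).deriv]
        have hp := hHn t ht.1.le ht.2.le
        have hsp : 0 < Real.sqrt (H t + ε) := Real.sqrt_pos.2 (by positivity)
        rw [sub_nonpos, div_le_iff₀ (by positivity)]
        refine (hHd t ht.1 ht.2.le).trans ?_
        have : Real.sqrt (H t) ≤ Real.sqrt (H t + ε) := Real.sqrt_le_sqrt (by linarith)
        have h6 : 0 ≤ 20 * Real.sqrt t / K ^ 2 := by positivity
        nlinarith
    have h0 := anti (Set.left_mem_Icc.2 hK.le) (Set.mem_Icc.2 ⟨ht, htK⟩) ht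
    have hH0 : H 0 = 0 := by simp [H, he, he1]
    simp only [hH0, zero_add, zero_mul, mul_zero, zero_div, sub_zero] at h0
    have : Real.sqrt (H t) ≤ Real.sqrt (H t + ε) := Real.sqrt_le_sqrt (by linarith)
    linarith
  have main2 : Real.sqrt (H t) ≤ 40 / 3 * (t * Real.sqrt t) / K ^ 2 := by
    apply le_of_forall_pos_le_add
    intro ε hε
    have := main (ε ^ 2) (by positivity)
    rwa [Real.sqrt_sq hε.le] at this
  have : |e t| ≤ Real.sqrt (H t) := by
    apply Real.abs_le_sqrt
    have := hq t ht htK; simp only [H]; nlinarith [sq_nonneg (e t), sq_nonneg (e1 t)]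
  refine this.trans (main2.trans ?_)
  gcongr; norm_num

-- Part PC
/-- continuous functions with exponential growth -/
def EB {X E : Type*} [NormedAddCommGroup X] [NormedAddCommGroup E] (f : X → E) : Prop :=
  Continuous f ∧ ∃ C c : ℝ, 0 ≤ C ∧ 0 ≤ c ∧ ∀ x, ‖f x‖ ≤ C * Real.exp (c * ‖x‖)

namespace EB
variable {X Y E : Type*} [NormedAddCommGroup X] [NormedAddCommGroup Y] [NormedAddCommGroup E]

lemma cont {f : X → E} (hf : EB f) : Continuous f := hf.1

lemma of_le {f : X → E} (hc : Continuous f) {F : Type*} [NormedAddCommGroup F] {g : X → F} (hg : EB g) (h : ∀ x, ‖f x‖ ≤ ‖g x‖) : EB f := by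
  obtain ⟨_, C, c, hC, hc', hb⟩ := hg
  exact ⟨hc, C, c, hC, hc', fun x => (h x).trans (hb x)⟩

lemma bdd {f : X → E} (hc : Continuous f) (C : ℝ) (h : ∀ x, ‖f x‖ ≤ C) : EB f :=
  ⟨hc, C, 0, (norm_nonneg _).trans (h 0), le_rfl, fun x => by simpa using h x⟩

lemma const (a : E) : EB (fun _ : X => a) := bdd continuous_const ‖a‖ fun _ => le_rfl

lemma add {f g : X → E} (hf : EB f) (hg : EB g) : EB (fun x => f x + g x) := by
  obtain ⟨h1, C, c, hC, hc, hb⟩ := hf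
  obtain ⟨h2, D, d, hD, hd, hb'⟩ := hg
  refine ⟨h1.add h2, C + D, c + d, by positivity, by positivity, fun x => ?_⟩
  refine (norm_add_le _ _).trans ?_
  have a1 : Real.exp (c * ‖x‖) ≤ Real.exp ((c + d) * ‖x‖) := Real.exp_le_exp.2 (by nlinarith [norm_nonneg x])
  have a2 : Real.exp (d * ‖x‖) ≤ Real.exp ((c + d) * ‖x‖) := Real.exp_le_exp.2 (by nlinarith [norm_nonneg x])
  nlinarith [hb x, hb' x]

lemma neg {f : X → E} (hf : EB f) : EB (fun x => - f x) := of_le hf.1.neg hf fun x => by simp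

lemma sub {f g : X → E} (hf : EB f) (hg : EB g) : EB (fun x => f x - g x) := by
  simpa [sub_eq_add_neg] using hf.add hg.neg

lemma sum {ι : Type*} (s : Finset ι) {f : ι → X → E} (hf : ∀ i ∈ s, EB (f i)) : EB (fun x => ∑ i ∈ s, f i x) := by
  classical
  induction s using Finset.induction_on with
  | empty => simpa using const (0 : E)
  | insert a s ha ih =>
    simp only [Finset.sum_insert ha]
    exact (hf a (by simp)).add (ih fun i hi => hf i (by simp [hi]))

lemma smul {𝕜 : Type*} [NormedField 𝕜] [NormedSpace 𝕜 E] {f : X → 𝕜} {g : X → E} (hf : EB f) (hg : EB g) : EB (fun x => f x • g x) := by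
  obtain ⟨h1, C, c, hC, hc, hb⟩ := hf
  obtain ⟨h2, D, d, hD, hd, hb'⟩ := hg
  refine ⟨h1.smul h2, C * D, c + d, by positivity, by positivity, fun x => ?_⟩
  rw [norm_smul, add_mul, Real.exp_add]
  calc _ ≤ (C * Real.exp (c * ‖x‖)) * (D * Real.exp (d * ‖x‖)) := mul_le_mul (hb x) (hb' x) (norm_nonneg _) (by positivity)
    _ = _ := by ring

lemma mul {𝕜 : Type*} [NormedField 𝕜] {f g : X → 𝕜} (hf : EB f) (hg : EB g) : EB (fun x => f x * g x) := by
  simpa using hf.smul hg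

lemma pow {𝕜 : Type*} [NormedField 𝕜] {f : X → 𝕜} (hf : EB f) (n : ℕ) : EB (fun x => f x ^ n) := by
  induction n with
  | zero => simpa using const (1:𝕜)
  | succ n ih => simpa [pow_succ] using ih.mul hf

lemma prod {𝕜 : Type*} [NormedField 𝕜] {ι : Type*} (s : Finset ι) {f : ι → X → 𝕜} (hf : ∀ i ∈ s, EB (f i)) : EB (fun x => ∏ i ∈ s, f i x) := by
  classical
  induction s using Finset.induction_on with
  | empty => simpa using const (1 : 𝕜)
  | insert a s ha ih =>
    simp only [Finset.prod_insert ha]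
    exact (hf a (by simp)).mul (ih fun i hi => hf i (by simp [hi]))

lemma comp_lip {f : Y → E} (hf : EB f) {g : X → Y} (hg : Continuous g) (a b : ℝ) (ha : 0 ≤ a) (h : ∀ x, ‖g x‖ ≤ a * ‖x‖ + b) :
    EB (fun x => f (g x)) := by
  obtain ⟨h1, C, c, hC, hc, hb⟩ := hf
  refine ⟨h1.comp hg, C * Real.exp (c * b), c * a, by positivity, by positivity, fun x => (hb _).trans ?_⟩
  rw [mul_assoc, ← Real.exp_add]
  gcongr
  have := mul_le_mul_of_nonneg_left (h x) hc
  linarith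

lemma id' : EB (fun x : X => x) := ⟨continuous_id, 1, 1, by norm_num, by norm_num, fun x => by
  have := Real.add_one_le_exp ‖x‖
  simp; linarith⟩

lemma lin {g : X → E} (hg : Continuous g) (a b : ℝ) (ha : 0 ≤ a) (h : ∀ x, ‖g x‖ ≤ a * ‖x‖ + b) : EB g :=
  comp_lip id' hg a b ha h

lemma clm [NormedSpace ℝ X] [NormedSpace ℝ E] (L : X →L[ℝ] E) : EB (fun x => L x) :=
  lin L.continuous ‖L‖ 0 (norm_nonneg _) fun x => by simpa using L.le_opNorm x

lemma ofReal {f : X → ℝ} (hf : EB f) : EB (fun x => (f x : ℂ)) := of_le (by have := hf.1; fun_prop) hf fun x => by simp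

lemma star' {f : X → ℂ} (hf : EB f) : EB (fun x => star (f x)) := of_le (continuous_star.comp hf.1) hf fun x => by simp

lemma norm' {f : X → E} (hf : EB f) : EB (fun x => ‖f x‖) := of_le hf.1.norm hf fun x => by simp

lemma coord {ι : Type*} [Fintype ι] (i : ι) : EB (fun x : ι → ℝ => x i) :=
  lin (continuous_apply i) 1 0 zero_le_one fun x => by simpa using norm_le_pi_norm x i

end EB

/-- standard gaussian on ℝ and on ι → ℝ -/
noncomputable abbrev g1 : Measure ℝ := gaussianReal 0 1
noncomputable abbrev gp (ι : Type*) [Fintype ι] : Measure (ι → ℝ) := Measure.pi fun _ => g1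

section gauss
variable {E : Type*} [NormedAddCommGroup E]

lemma g1_exp_int (c : ℝ) : Integrable (fun x : ℝ => Real.exp (c * |x|)) g1 := by
  have h1 := integrable_exp_mul_gaussianReal (μ := 0) (v := 1) c
  have h2 := integrable_exp_mul_gaussianReal (μ := 0) (v := 1) (-c)
  refine Integrable.mono' (h1.add h2) (by fun_prop) (Eventually.of_forall fun x => ?_)
  rw [Real.norm_eq_abs, abs_of_pos (Real.exp_pos _)]
  simp only [Pi.add_apply]
  rcases abs_choice x with h | h <;> rw [h]
  · have := Real.exp_pos (-c * x); linarith
  · have := Real.exp_pos (c * x); rw [show c * -x = -c * x by ring]; linarith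

lemma EB.int1 {f : ℝ → E} (hf : EB f) : Integrable f g1 := by
  obtain ⟨h1, C, c, hC, hc, hb⟩ := hf
  exact Integrable.mono' ((g1_exp_int c).const_mul C) h1.aestronglyMeasurable (Eventually.of_forall hb)

lemma EB.intp {ι : Type*} [Fintype ι] {f : (ι → ℝ) → E} (hf : EB f) : Integrable f (gp ι) := by
  obtain ⟨h1, C, c, hC, hc, hb⟩ := hf
  have h2 : Integrable (fun x : ι → ℝ => ∏ i, Real.exp (c * |x i|)) (gp ι) :=
    Integrable.fintype_prod (f := fun _ (y : ℝ) => Real.exp (c * |y|)) fun i => g1_exp_int c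
  refine Integrable.mono' (h2.const_mul C) h1.aestronglyMeasurable (Eventually.of_forall fun x => (hb x).trans ?_)
  rw [← Real.exp_sum, ← Finset.mul_sum]
  gcongr
  rw [pi_norm_le_iff_of_nonneg (by positivity)]
  intro i
  exact Finset.single_le_sum (f := fun i => |x i|) (fun i _ => abs_nonneg _) (Finset.mem_univ i)

lemma gpdf_deriv (x : ℝ) : HasDerivAt (gaussianPDFReal 0 1) (-x * gaussianPDFReal 0 1 x) x := by
  have e : gaussianPDFReal 0 1 = fun x => (Real.sqrt (2 * Real.pi * (1:ℝ≥0)))⁻¹ * Real.exp (-(x - 0) ^ 2 / (2 * (1:ℝ≥0))) := gaussianPDFReal_def 0 1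
  rw [e]
  have h1 : HasDerivAt (fun x : ℝ => -(x - 0) ^ 2 / (2 * ((1:ℝ≥0) : ℝ))) (-x) x := by
    have := ((hasDerivAt_pow 2 x).neg).div_const 2
    simp only [sub_zero, NNReal.coe_one, mul_one]
    exact this.congr_deriv (by simp; ring)
  exact (h1.exp.const_mul _).congr_deriv (by ring)

lemma g1_integrable_iff (F : ℝ → ℂ) : Integrable F g1 ↔ Integrable (fun x => gaussianPDFReal 0 1 x • F x) := by
  show Integrable F (gaussianReal 0 1) ↔ _
  rw [gaussianReal_of_var_ne_zero _ one_ne_zero, integrable_withDensity_iff_integrable_smul' (measurable_gaussianPDF 0 1)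
    (Eventually.of_forall fun x => gaussianPDF_lt_top)]
  simp only [toReal_gaussianPDF]

lemma gauss_ibp1 (F F' : ℝ → ℂ) (hF : EB F) (hF' : EB F') (hd : ∀ x, HasDerivAt F (F' x) x) :
    ∫ x, (x : ℂ) * F x ∂g1 = ∫ x, F' x ∂g1 := by
  have hxF : EB (fun x : ℝ => (x : ℂ) * F x) := (EB.id'.ofReal).mul hF
  have h1 := (g1_integrable_iff _).1 hF.int1
  have h2 := (g1_integrable_iff _).1 hF'.int1
  have h3 := (g1_integrable_iff _).1 hxF.int1
  rw [integral_gaussianReal_eq_integral_smul one_ne_zero, integral_gaussianReal_eq_integral_smul one_ne_zero]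
  have hz := integral_eq_zero_of_hasDerivAt_of_integrable
    (f := fun x => gaussianPDFReal 0 1 x • F x)
    (f' := fun x => gaussianPDFReal 0 1 x • F' x - gaussianPDFReal 0 1 x • ((x : ℂ) * F x)) (fun x => by
      refine ((gpdf_deriv x).smul (hd x)).congr_deriv ?_
      simp only [Complex.real_smul]; push_cast; ring) (h2.sub h3) h1
  rw [integral_sub h2 h3, sub_eq_zero] at hz
  exact hz.symm

lemma gp_resample {ι : Type*} [Fintype ι] [DecidableEq ι] (i : ι) :
    MeasurePreserving (fun p : (ι → ℝ) × ℝ => Function.update p.1 i p.2) ((gp ι).prod g1) (gp ι) := by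
  have hm : Measurable (fun p : (ι → ℝ) × ℝ => Function.update p.1 i p.2) := by
    rw [measurable_pi_iff]; intro j
    rcases eq_or_ne j i with rfl | h
    · simpa using measurable_snd
    · simp only [Function.update_of_ne h]; fun_prop
  refine ⟨hm, ?_⟩
  symm
  apply Measure.pi_eq
  intro s hs
  rw [Measure.map_apply hm (MeasurableSet.univ_pi hs)]
  have : (fun p : (ι → ℝ) × ℝ => Function.update p.1 i p.2) ⁻¹' Set.univ.pi s = (Set.univ.pi (Function.update s i Set.univ)) ×ˢ s i := by
    ext ⟨x, y⟩
    simp only [Set.mem_preimage, Set.mem_pi, Set.mem_univ, true_imp_iff, Set.mem_prod]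
    constructor
    · intro h
      refine ⟨fun j => ?_, by simpa using h i⟩
      rcases eq_or_ne j i with rfl | hj
      · simp
      · simpa [hj] using h j
    · rintro ⟨h1, h2⟩ j
      rcases eq_or_ne j i with rfl | hj
      · simpa using h2
      · simpa [hj] using h1 j
  rw [this, Measure.prod_prod, Measure.pi_pi, Finset.prod_eq_mul_prod_sdiff_singleton_of_mem (Finset.mem_univ i),
    Finset.prod_eq_mul_prod_sdiff_singleton_of_mem (Finset.mem_univ i) (fun j => g1 (s j))]
  simp only [Function.update_self, measure_univ, one_mul]
  rw [mul_comm]; congr 1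
  refine Finset.prod_congr rfl fun j hj => ?_
  simp at hj; rw [Function.update_of_ne hj]

lemma gp_fubini {ι : Type*} [Fintype ι] [DecidableEq ι] (i : ι) (f : (ι → ℝ) → ℂ) (hf : EB f) :
    ∫ x, f x ∂(gp ι) = ∫ x, ∫ y, f (Function.update x i y) ∂g1 ∂(gp ι) := by
  have h := gp_resample i
  rw [← h.map_eq, integral_map h.measurable.aemeasurable (by rw [h.map_eq]; exact hf.cont.aestronglyMeasurable),
    integral_prod]
  · rw [h.map_eq]
  · exact (h.integrable_comp hf.cont.aestronglyMeasurable).2 hf.intp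

lemma EB.update {ι : Type*} [Fintype ι] [DecidableEq ι] {f : (ι → ℝ) → E} (hf : EB f) (i : ι) (x : ι → ℝ) : EB (fun y : ℝ => f (Function.update x i y)) := by
  refine hf.comp_lip (continuous_const.update i continuous_id) 1 ‖x‖ zero_le_one fun y => ?_
  rw [pi_norm_le_iff_of_nonneg (by positivity)]
  intro j
  rcases eq_or_ne j i with rfl | h
  · simp
  · rw [Function.update_of_ne h]; have := norm_le_pi_norm x j; have := norm_nonneg y; linarith

lemma gauss_ibp {ι : Type*} [Fintype ι] [DecidableEq ι] (i : ι) (f f' : (ι → ℝ) → ℂ) (hf : EB f) (hf' : EB f')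
    (hd : ∀ x, HasDerivAt (fun y => f (Function.update x i y)) (f' x) (x i)) :
    ∫ x, (x i : ℂ) * f x ∂(gp ι) = ∫ x, f' x ∂(gp ι) := by
  rw [gp_fubini i _ ((EB.coord i).ofReal.mul hf), gp_fubini i _ hf']
  congr 1; ext x
  simp only [Function.update_self]
  refine gauss_ibp1 _ _ (hf.update i x) (hf'.update i x) fun y => ?_
  have := hd (Function.update x i y)
  simpa using this

end gauss

-- Part PC2
section hermite

noncomputable def heP (j : ℕ) : Polynomial ℝ := (Polynomial.hermite j).map (Int.castRingHom ℝ)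

lemma heP_zero : heP 0 = 1 := by simp [heP]

lemma heP_succ (j : ℕ) : heP (j + 1) = Polynomial.X * heP j - Polynomial.derivative (heP j) := by
  simp [heP, Polynomial.hermite_succ, Polynomial.derivative_map]

lemma heP_deriv (j : ℕ) : Polynomial.derivative (heP (j + 1)) = ((j : Polynomial ℝ) + 1) * heP j := by
  induction j with
  | zero => simp [heP_succ, heP_zero]
  | succ j ih =>
    rw [heP_succ (j + 1), Polynomial.derivative_sub, Polynomial.derivative_mul, ih, Polynomial.derivative_X,
      Polynomial.derivative_mul]
    have : Polynomial.derivative ((j : Polynomial ℝ) + 1) = 0 := by simp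
    rw [this]
    rw [heP_succ j]; push_cast; ring

lemma heP_monic (j : ℕ) : (heP j).Monic := (Polynomial.hermite_monic j).map _

lemma heP_natDegree (j : ℕ) : (heP j).natDegree = j := by
  unfold heP
  rw [(Polynomial.hermite_monic j).natDegree_map, Polynomial.natDegree_hermite]

noncomputable def hr (j : ℕ) (x : ℝ) : ℝ := (heP j).eval x / Real.sqrt (j.factorial)
noncomputable def hc (j : ℕ) (x : ℝ) : ℂ := (hr j x : ℂ)
noncomputable def sqn (n : ℕ) : ℂ := (Real.sqrt n : ℂ)

lemma sqn_mul (n : ℕ) : sqn n * sqn n = n := by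
  unfold sqn; rw [← Complex.ofReal_mul, Real.mul_self_sqrt (by positivity)]; simp

lemma sqn_zero : sqn 0 = 0 := by simp [sqn]
lemma sqn_ne (n : ℕ) : sqn (n + 1) ≠ 0 := by
  unfold sqn; rw [Complex.ofReal_ne_zero]; positivity

lemma sqrt_fact (j : ℕ) : Real.sqrt ((j + 1).factorial) = Real.sqrt ((j + 1 : ℕ)) * Real.sqrt (j.factorial) := by
  rw [Nat.factorial_succ, Nat.cast_mul, Real.sqrt_mul (by positivity)]

lemma hr_deriv (j : ℕ) (x : ℝ) : HasDerivAt (hr j) (Real.sqrt j * hr (j - 1) x) x := by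
  unfold hr
  have h := ((heP j).hasDerivAt x).div_const (Real.sqrt (j.factorial))
  refine h.congr_deriv ?_
  rcases j with _ | j
  · simp [heP_zero]
  · rw [heP_deriv, sqrt_fact]
    simp only [add_tsub_cancel_right, Polynomial.eval_mul, Polynomial.eval_add, Polynomial.eval_natCast, Polynomial.eval_one]
    have h1 : 0 < Real.sqrt ((j + 1 : ℕ)) := by positivity
    have h2 : 0 < Real.sqrt (j.factorial) := by positivity
    have h3 : Real.sqrt ((j + 1 : ℕ)) * Real.sqrt ((j + 1 : ℕ)) = (j : ℝ) + 1 := by rw [Real.mul_self_sqrt (by positivity)]; push_cast; rfl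
    rw [← h3]; field_simp

lemma hr_succ (j : ℕ) (x : ℝ) : Real.sqrt ((j + 1 : ℕ)) * hr (j + 1) x = x * hr j x - Real.sqrt j * hr (j - 1) x := by
  have h1 : 0 < Real.sqrt ((j + 1 : ℕ)) := by positivity
  have h2 : 0 < Real.sqrt (j.factorial) := by positivity
  have h := (hr_deriv j x).unique (by unfold hr; exact ((heP j).hasDerivAt x).div_const (Real.sqrt (j.factorial)))
  rw [h]
  unfold hr
  rw [heP_succ, sqrt_fact]
  simp only [Polynomial.eval_sub, Polynomial.eval_mul, Polynomial.eval_X]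
  field_simp

lemma hc_deriv (j : ℕ) (x : ℝ) : HasDerivAt (hc j) (sqn j * hc (j - 1) x) x := by
  have := (hr_deriv j x).ofReal_comp
  refine this.congr_deriv ?_
  simp [sqn, hc]

lemma hc_succ (j : ℕ) (x : ℝ) : sqn (j + 1) * hc (j + 1) x = x * hc j x - sqn j * hc (j - 1) x := by
  have := congrArg (fun y : ℝ => (y : ℂ)) (hr_succ j x)
  simpa [sqn, hc] using this

lemma hc_zero (x : ℝ) : hc 0 x = 1 := by simp [hc, hr, heP_zero]

lemma EB.poly (p : Polynomial ℝ) : EB (fun x : ℝ => p.eval x) := by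
  simp_rw [Polynomial.eval_eq_sum_range]
  exact EB.sum _ fun i _ => (EB.const _).mul (EB.id'.pow i)

lemma hr_EB (j : ℕ) : EB (hr j) := by
  unfold hr; simp_rw [div_eq_mul_inv]
  exact (EB.poly _).mul (EB.const _)

lemma hc_EB (j : ℕ) : EB (hc j) := (hr_EB j).ofReal

lemma hc_raise (i : ℕ) (F F' : ℝ → ℂ) (hF : EB F) (hF' : EB F') (hd : ∀ x, HasDerivAt F (F' x) x) :
    sqn (i + 1) * ∫ x, hc (i + 1) x * F x ∂g1 = ∫ x, hc i x * F' x ∂g1 := by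
  have h := gauss_ibp1 (fun x => hc i x * F x) (fun x => sqn i * hc (i - 1) x * F x + hc i x * F' x) ((hc_EB i).mul hF)
    ((((EB.const _).mul (hc_EB _)).mul hF).add ((hc_EB i).mul hF')) (fun x => (hc_deriv i x).mul (hd x))
  rw [integral_add (((EB.const _).mul (hc_EB _)).mul hF).int1 ((hc_EB i).mul hF').int1] at h
  rw [← integral_const_mul]
  have e : ∀ x : ℝ, sqn (i + 1) * (hc (i + 1) x * F x) = x * (hc i x * F x) - sqn i * hc (i - 1) x * F x := by
    intro x; rw [← mul_assoc, hc_succ]; ring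
  simp_rw [e]
  rw [integral_sub (EB.id'.ofReal.mul ((hc_EB i).mul hF)).int1 (((EB.const _).mul (hc_EB _)).mul hF).int1, h]
  ring

noncomputable def ex (t x : ℝ) : ℂ := Complex.exp (Complex.I * (t * x : ℝ))

lemma ex_norm (t x : ℝ) : ‖ex t x‖ = 1 := by
  unfold ex; rw [mul_comm]; exact Complex.norm_exp_ofReal_mul_I _

lemma ex_EB (t : ℝ) : EB (ex t) := EB.bdd (by unfold ex; fun_prop) 1 fun x => (ex_norm t x).le

lemma ex_EB2 : ∀ x : ℝ, Continuous (fun t => ex t x) := fun x => by unfold ex; fun_prop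

lemma ex_derivx (t x : ℝ) : HasDerivAt (ex t) (Complex.I * t * ex t x) x := by
  have h : HasDerivAt (fun x : ℝ => Complex.I * ((t * x : ℝ) : ℂ)) (Complex.I * t) x := by
    have h0 : HasDerivAt (fun x : ℝ => t * x) t x := by simpa using (hasDerivAt_id x).const_mul t
    exact h0.ofReal_comp.const_mul _
  exact h.cexp.congr_deriv (by unfold ex; ring)

lemma ex_comm (t x : ℝ) : ex t x = ex x t := by unfold ex; rw [mul_comm t x]

lemma ex_derivt (t x : ℝ) : HasDerivAt (fun t => ex t x) (Complex.I * x * ex t x) t := by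
  simp_rw [fun t => ex_comm t x]; exact ex_derivx x t

lemma ex_star (t x : ℝ) : star (ex t x) = ex (-t) x := by
  unfold ex
  rw [Complex.star_def, ← Complex.exp_conj]; congr 1; simp

lemma ex_mul_neg (t x : ℝ) : ex t x * ex (-t) x = 1 := by
  unfold ex
  rw [← Complex.exp_add]; simp

noncomputable def fij (i j : ℕ) (t : ℝ) : ℂ := ∫ x, ex t x * (hc i x * hc j x) ∂g1

lemma fij_EB (i j : ℕ) (t : ℝ) : EB (fun x => ex t x * (hc i x * hc j x)) := (ex_EB t).mul ((hc_EB i).mul (hc_EB j))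

lemma fij_comm (i j : ℕ) (t : ℝ) : fij i j t = fij j i t := by
  unfold fij; congr 1; ext x; ring

lemma fij_star (a j : ℕ) (t : ℝ) : star (fij a j t) = fij a j (-t) := by
  unfold fij
  have h : ∀ x, ex (-t) x * (hc a x * hc j x) = (starRingEnd ℂ) (ex t x * (hc a x * hc j x)) := by
    intro x
    rw [map_mul, ← Complex.star_def, ex_star]; simp [hc]
  simp_rw [h]
  rw [integral_conj]; rfl

lemma fij_rec (i j : ℕ) (t : ℝ) : sqn (i + 1) * fij (i + 1) j t = Complex.I * t * fij i j t + sqn j * fij i (j - 1) t := by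
  have h := hc_raise i (fun x => ex t x * hc j x) (fun x => Complex.I * t * ex t x * hc j x + ex t x * (sqn j * hc (j - 1) x))
    ((ex_EB t).mul (hc_EB j)) ((((EB.const _).mul (ex_EB t)).mul (hc_EB j)).add ((ex_EB t).mul ((EB.const _).mul (hc_EB _))))
    (fun x => (ex_derivx t x).mul (hc_deriv j x))
  unfold fij
  rw [← integral_const_mul (Complex.I * t), ← integral_const_mul (sqn j), ← integral_add ((fij_EB i j t).int1.const_mul _) ((fij_EB i (j-1) t).int1.const_mul _)]
  refine Eq.trans ?_ (h.trans ?_)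
  · congr 2; ext x; ring
  · congr 1; ext x; ring

lemma fij_deriv (i j : ℕ) (t : ℝ) : HasDerivAt (fij i j) (Complex.I * (sqn (i + 1) * fij (i + 1) j t + sqn i * fij (i - 1) j t)) t := by
  have hb : EB (fun x : ℝ => ‖(x : ℂ) * (hc i x * hc j x)‖) := (EB.id'.ofReal.mul ((hc_EB i).mul (hc_EB j))).norm'
  have h := hasDerivAt_integral_of_dominated_loc_of_deriv_le (μ := g1) (s := Set.univ) (x₀ := t)
    (F := fun t x => ex t x * (hc i x * hc j x)) (F' := fun t x => Complex.I * x * ex t x * (hc i x * hc j x)) (bound := fun x => ‖(x : ℂ) * (hc i x * hc j x)‖)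
    Filter.univ_mem (Eventually.of_forall fun t => (fij_EB i j t).cont.aestronglyMeasurable) (fij_EB i j t).int1
    (EB.cont ((((EB.const _).mul EB.id'.ofReal).mul (ex_EB t)).mul ((hc_EB i).mul (hc_EB j)))).aestronglyMeasurable
    (Eventually.of_forall fun x t _ => by
      simp only [norm_mul, Complex.norm_I, ex_norm, one_mul, mul_one]; exact le_rfl) hb.int1
    (Eventually.of_forall fun x t _ => (ex_derivt t x).mul_const _)
  refine h.2.congr_deriv ?_
  unfold fij
  rw [← integral_const_mul (sqn (i+1)), ← integral_const_mul (sqn i), ← integral_add ((fij_EB _ j t).int1.const_mul _) ((fij_EB _ j t).int1.const_mul _), ← integral_const_mul]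
  congr 1; ext x
  have e := hc_succ i x
  have e2 : (x : ℂ) * hc i x = sqn (i + 1) * hc (i + 1) x + sqn i * hc (i - 1) x := by rw [e]; ring
  calc Complex.I * x * ex t x * (hc i x * hc j x) = Complex.I * ex t x * hc j x * (x * hc i x) := by ring
    _ = _ := by rw [e2]; ring

lemma g1_one : ∫ _x : ℝ, (1 : ℂ) ∂g1 = 1 := by simp

lemma fij_zero (i j : ℕ) : fij i j 0 = if i = j then 1 else 0 := by
  have key : ∀ i j, sqn (i + 1) * fij (i + 1) j 0 = sqn j * fij i (j - 1) 0 := by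
    intro i j; simpa using fij_rec i j 0
  induction i generalizing j with
  | zero =>
    rcases j with _ | j
    · simp [fij, hc_zero, ex]
    · have := key j 0
      rw [fij_comm]
      simpa [sqn_zero, sqn_ne] using this
  | succ i ih =>
    have h := key i j
    rcases j with _ | j
    · simpa [sqn_zero, sqn_ne] using h
    · rw [add_tsub_cancel_right, ih] at h
      by_cases hij : i = j
      · subst hij; simpa [sqn_ne] using h
      · simpa [hij, sqn_ne] using h

lemma hc_conj (i : ℕ) (x : ℝ) : star (hc i x) = hc i x := by simp [hc]

lemma hc_orth (i j : ℕ) : ∫ x, hc i x * hc j x ∂g1 = if i = j then 1 else 0 := by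
  rw [← fij_zero]; simp [fij, ex]

lemma bessel (k i : ℕ) (t : ℝ) : ∑ j ∈ Finset.range k, ‖fij i j t‖ ^ 2 ≤ 1 := by
  set c : ℕ → ℂ := fun j => fij i j t with hcdef
  let G : ℝ → ℂ := fun x => ex t x * hc i x - ∑ j ∈ Finset.range k, c j * hc j x
  have hG : EB G := ((ex_EB t).mul (hc_EB i)).sub (EB.sum _ fun j _ => (EB.const _).mul (hc_EB j))
  have e : ∀ x, G x * star (G x) = hc i x * hc i x - ∑ j ∈ Finset.range k, star (c j) * (ex t x * (hc i x * hc j x))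
      - ∑ j ∈ Finset.range k, c j * (ex (-t) x * (hc i x * hc j x))
      + ∑ j ∈ Finset.range k, ∑ l ∈ Finset.range k, c j * star (c l) * (hc j x * hc l x) := by
    intro x
    have s1 : star (G x) = ex (-t) x * hc i x - ∑ j ∈ Finset.range k, star (c j) * hc j x := by
      simp only [G, star_sub, star_sum, star_mul', ex_star, hc_conj]
    rw [s1]
    have s2 : ∑ j ∈ Finset.range k, ∑ l ∈ Finset.range k, c j * star (c l) * (hc j x * hc l x)
      = (∑ j ∈ Finset.range k, c j * hc j x) * (∑ j ∈ Finset.range k, star (c j) * hc j x) := by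
      rw [Finset.sum_mul_sum]
      refine Finset.sum_congr rfl fun j _ => Finset.sum_congr rfl fun l _ => by ring
    have s3 : ∑ j ∈ Finset.range k, star (c j) * (ex t x * (hc i x * hc j x)) = ex t x * hc i x * (∑ j ∈ Finset.range k, star (c j) * hc j x) := by
      rw [Finset.mul_sum]; refine Finset.sum_congr rfl fun j _ => by ring
    have s4 : ∑ j ∈ Finset.range k, c j * (ex (-t) x * (hc i x * hc j x)) = ex (-t) x * hc i x * (∑ j ∈ Finset.range k, c j * hc j x) := by
      rw [Finset.mul_sum]; refine Finset.sum_congr rfl fun j _ => by ring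
    rw [s2, s3, s4]
    have := ex_mul_neg t x
    simp only [G]
    linear_combination (hc i x * hc i x) * this
  have hI : ∫ x, G x * star (G x) ∂g1 = 1 - ∑ j ∈ Finset.range k, star (c j) * c j := by
    simp_rw [e]
    have i1 : Integrable (fun x => hc i x * hc i x) g1 := ((hc_EB i).mul (hc_EB i)).int1
    have i2 : Integrable (fun x => ∑ j ∈ Finset.range k, star (c j) * (ex t x * (hc i x * hc j x))) g1 :=
      (EB.sum _ fun j _ => (EB.const _).mul (fij_EB i j t)).int1
    have i3 : Integrable (fun x => ∑ j ∈ Finset.range k, c j * (ex (-t) x * (hc i x * hc j x))) g1 :=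
      (EB.sum _ fun j _ => (EB.const _).mul (fij_EB i j (-t))).int1
    have i4 : Integrable (fun x => ∑ j ∈ Finset.range k, ∑ l ∈ Finset.range k, c j * star (c l) * (hc j x * hc l x)) g1 :=
      (EB.sum _ fun j _ => EB.sum _ fun l _ => (EB.const _).mul ((hc_EB j).mul (hc_EB l))).int1
    have i12 : Integrable (fun x => hc i x * hc i x - ∑ j ∈ Finset.range k, star (c j) * (ex t x * (hc i x * hc j x))) g1 := i1.sub i2
    have i123 : Integrable (fun x => hc i x * hc i x - ∑ j ∈ Finset.range k, star (c j) * (ex t x * (hc i x * hc j x))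
      - ∑ j ∈ Finset.range k, c j * (ex (-t) x * (hc i x * hc j x))) g1 := i12.sub i3
    rw [integral_add i123 i4, integral_sub i12 i3, integral_sub i1 i2]
    rw [integral_finsetSum _ fun j _ => ((fij_EB i j t).int1.const_mul _), integral_finsetSum _ fun j _ => ((fij_EB i j (-t)).int1.const_mul _),
      integral_finsetSum _ fun j _ => (EB.sum _ fun l _ => (EB.const _).mul ((hc_EB j).mul (hc_EB l))).int1]
    have s5 : ∀ j ∈ Finset.range k, ∫ x, ∑ l ∈ Finset.range k, c j * star (c l) * (hc j x * hc l x) ∂g1 = star (c j) * c j := by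
      intro j hj
      rw [integral_finsetSum _ fun l _ => ((hc_EB j).mul (hc_EB l)).int1.const_mul _]
      simp_rw [integral_const_mul, hc_orth]
      rw [Finset.sum_eq_single j]
      · simp; ring
      · intro b _ hb; simp [hb.symm]
      · intro h; exact absurd hj h
    rw [Finset.sum_congr rfl s5, hc_orth]
    simp_rw [integral_const_mul]
    have s6 : ∀ j, ∫ x, ex (-t) x * (hc i x * hc j x) ∂g1 = star (c j) := fun j => (fij_star i j t).symm
    have s7 : ∀ j, ∫ x, ex t x * (hc i x * hc j x) ∂g1 = c j := fun j => rfl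
    simp_rw [s6, s7]
    simp only [if_true, mul_comm (c _)]; ring
  have hp : 0 ≤ (∫ x, G x * star (G x) ∂g1).re := by
    have : (fun x => G x * star (G x)) = fun x => ((‖G x‖ ^ 2 : ℝ) : ℂ) := by
      ext x; rw [Complex.star_def, Complex.mul_conj, Complex.normSq_eq_norm_sq]
    rw [this, integral_complex_ofReal, Complex.ofReal_re]
    exact integral_nonneg fun x => by positivity
  rw [hI] at hp
  have e3 : ∑ j ∈ Finset.range k, star (c j) * c j = ((∑ j ∈ Finset.range k, ‖c j‖ ^ 2 : ℝ) : ℂ) := by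
    push_cast
    refine Finset.sum_congr rfl fun j _ => ?_
    rw [mul_comm, Complex.star_def, Complex.mul_conj, Complex.normSq_eq_norm_sq]; push_cast; rfl
  rw [e3, Complex.sub_re, Complex.ofReal_re, Complex.one_re] at hp
  linarith

end hermite

-- Part PC3
section hermite2

noncomputable def vk (k : ℕ) (t : ℝ) : ℝ := k - ∑ i ∈ Finset.range k, ∑ j ∈ Finset.range k, ‖fij i j t‖ ^ 2

lemma tele_inner (a : ℕ → ℂ) (k : ℕ) :
    ∑ i ∈ Finset.range (k + 1), inner ℝ (a i) (Complex.I * (sqn (i + 1) * a (i + 1) + sqn i * a (i - 1)))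
      = inner ℝ (a k) (Complex.I * (sqn (k + 1) * a (k + 1))) := by
  induction k with
  | zero => simp [sqn_zero]
  | succ k ih =>
    rw [Finset.sum_range_succ, ih]
    simp only [Complex.inner, add_tsub_cancel_right, sqn]
    simp [Complex.mul_re, Complex.mul_im]
    ring

lemma vk_zero (k : ℕ) : vk k 0 = 0 := by
  unfold vk
  have : ∀ i ∈ Finset.range k, ∑ j ∈ Finset.range k, ‖fij i j 0‖ ^ 2 = 1 := by
    intro i hi
    rw [Finset.sum_eq_single i]
    · simp [fij_zero]
    · intro b _ hb; simp [fij_zero, hb.symm]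
    · intro h; exact absurd hi h
  rw [Finset.sum_congr rfl this]; simp

lemma vk_le_k (k : ℕ) (t : ℝ) : vk k t ≤ k := by
  unfold vk
  have : 0 ≤ ∑ i ∈ Finset.range k, ∑ j ∈ Finset.range k, ‖fij i j t‖ ^ 2 :=
    Finset.sum_nonneg fun i _ => Finset.sum_nonneg fun j _ => by positivity
  linarith

lemma vk_le (k : ℕ) (t : ℝ) : vk (k + 1) t ≤ 2 * Real.sqrt ((k + 1 : ℕ)) * |t| := by
  let vd : ℝ → ℝ := fun t => 0 - ∑ j ∈ Finset.range (k + 1), ∑ i ∈ Finset.range (k + 1),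
    2 * inner ℝ (fij i j t) (Complex.I * (sqn (i + 1) * fij (i + 1) j t + sqn i * fij (i - 1) j t))
  have hd : ∀ t, HasDerivAt (vk (k + 1)) (vd t) t := by
    intro t
    have e : vk (k + 1) = fun t => ((k + 1 : ℕ) : ℝ) - ∑ j ∈ Finset.range (k + 1), ∑ i ∈ Finset.range (k + 1), ‖fij i j t‖ ^ 2 := by
      ext t; unfold vk; rw [Finset.sum_comm]
    rw [e]
    refine (hasDerivAt_const t _).sub ?_
    refine HasDerivAt.fun_sum fun j _ => HasDerivAt.fun_sum fun i _ => ?_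
    exact (fij_deriv i j t).norm_sq
  have hb : ∀ t, ‖vd t‖ ≤ 2 * Real.sqrt ((k + 1 : ℕ)) := by
    intro t
    have e : ∀ j, ∑ i ∈ Finset.range (k + 1), 2 * inner ℝ (fij i j t) (Complex.I * (sqn (i + 1) * fij (i + 1) j t + sqn i * fij (i - 1) j t))
        = 2 * inner ℝ (fij k j t) (Complex.I * (sqn (k + 1) * fij (k + 1) j t)) := by
      intro j
      rw [← Finset.mul_sum, tele_inner (fun i => fij i j t) k]
    simp only [vd, e, zero_sub, norm_neg]
    refine (norm_sum_le _ _).trans ?_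
    have h2 : ∀ j ∈ Finset.range (k + 1), ‖2 * inner ℝ (fij k j t) (Complex.I * (sqn (k + 1) * fij (k + 1) j t))‖
        ≤ Real.sqrt ((k + 1 : ℕ)) * (‖fij k j t‖ ^ 2 + ‖fij (k + 1) j t‖ ^ 2) := by
      intro j _
      rw [norm_mul]
      have h3 := norm_inner_le_norm (𝕜 := ℝ) (fij k j t) (Complex.I * (sqn (k + 1) * fij (k + 1) j t))
      have h4 : ‖Complex.I * (sqn (k + 1) * fij (k + 1) j t)‖ = Real.sqrt ((k + 1 : ℕ)) * ‖fij (k + 1) j t‖ := by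
        rw [norm_mul, norm_mul, Complex.norm_I, one_mul, sqn, Complex.norm_real, Real.norm_of_nonneg (Real.sqrt_nonneg _)]
      rw [h4] at h3
      have h5 : ‖(2:ℝ)‖ = 2 := by norm_num
      rw [h5]
      have h6 := two_mul_le_add_sq ‖fij k j t‖ ‖fij (k + 1) j t‖
      have h7 := Real.sqrt_nonneg ((k + 1 : ℕ) : ℝ)
      nlinarith
    refine (Finset.sum_le_sum h2).trans ?_
    rw [← Finset.mul_sum, Finset.sum_add_distrib]
    have b1 := bessel (k + 1) k t
    have b2 := bessel (k + 1) (k + 1) t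
    have h7 := Real.sqrt_nonneg ((k + 1 : ℕ) : ℝ)
    nlinarith
  have := Convex.norm_image_sub_le_of_norm_hasDerivWithin_le (s := Set.univ) (x := 0) (y := t)
    (fun x _ => (hd x).hasDerivWithinAt) (fun x _ => hb x) convex_univ (Set.mem_univ _) (Set.mem_univ _)
  rw [vk_zero, sub_zero, sub_zero] at this
  exact (le_abs_self _).trans this

noncomputable def Sk (k : ℕ) (t : ℝ) : ℂ := ∑ i ∈ Finset.range k, fij i i t

noncomputable def fd (i j : ℕ) (t : ℝ) : ℂ := Complex.I * (sqn (i + 1) * fij (i + 1) j t + sqn i * fij (i - 1) j t)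
noncomputable def fdd (i j : ℕ) (t : ℝ) : ℂ := Complex.I * (sqn (i + 1) * fd (i + 1) j t + sqn i * fd (i - 1) j t)

lemma fd_deriv (i j : ℕ) (t : ℝ) : HasDerivAt (fd i j) (fdd i j t) t :=
  (((fij_deriv (i+1) j t).const_mul _).add ((fij_deriv (i-1) j t).const_mul _)).const_mul _

noncomputable def Sk1 (k : ℕ) (t : ℝ) : ℂ := ∑ i ∈ Finset.range k, fd i i t
noncomputable def Sk2 (k : ℕ) (t : ℝ) : ℂ := ∑ i ∈ Finset.range k, fdd i i t

lemma Sk_deriv (k : ℕ) (t : ℝ) : HasDerivAt (Sk k) (Sk1 k t) t := HasDerivAt.fun_sum fun i _ => fij_deriv i i t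
lemma Sk1_deriv (k : ℕ) (t : ℝ) : HasDerivAt (Sk1 k) (Sk2 k t) t := HasDerivAt.fun_sum fun i _ => fd_deriv i i t

lemma Sk_u (k : ℕ) (t : ℝ) : Complex.I * t * Sk (k + 1) t = sqn (k + 1) * fij (k + 1) k t := by
  induction k with
  | zero =>
    have := fij_rec 0 0 t
    simp [Sk, sqn_zero] at this ⊢; exact this.symm
  | succ k ih =>
    unfold Sk at ih ⊢
    rw [Finset.sum_range_succ, mul_add, ih, fij_rec (k+1) (k+1) t, add_tsub_cancel_right]; ring

lemma Sk_zero (k : ℕ) : Sk k 0 = k := by simp [Sk, fij_zero]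

lemma Sk1_zero (k : ℕ) : Sk1 k 0 = 0 := by
  unfold Sk1 fd
  refine Finset.sum_eq_zero fun i _ => ?_
  rcases i with _ | i <;> simp [fij_zero, sqn_zero]

lemma Sk_norm_le (k : ℕ) (t : ℝ) : |t| * ‖Sk (k + 1) t‖ ≤ Real.sqrt ((k + 1 : ℕ)) := by
  have h := congrArg norm (Sk_u k t)
  rw [norm_mul, norm_mul, norm_mul, Complex.norm_I, one_mul, Complex.norm_real, Real.norm_eq_abs, sqn, Complex.norm_real, Real.norm_of_nonneg (Real.sqrt_nonneg _)] at h
  rw [h]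
  have b := bessel (k + 1) (k + 1) t
  have c := Finset.single_le_sum (f := fun j => ‖fij (k + 1) j t‖ ^ 2) (fun i _ => by positivity) (Finset.self_mem_range_succ k)
  have d : ‖fij (k + 1) k t‖ ≤ 1 := by
    have : ‖fij (k + 1) k t‖ ^ 2 ≤ 1 := c.trans b
    nlinarith [norm_nonneg (fij (k + 1) k t)]
  exact mul_le_of_le_one_right (Real.sqrt_nonneg _) d

lemma Sk_ode (k : ℕ) (t : ℝ) (ht : t ≠ 0) :
    t * Sk2 (k + 1) t + 3 * Sk1 (k + 1) t + (4 * ((k : ℂ) + 1) * t - t ^ 3) * Sk (k + 1) t = 0 := by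
  set K : ℂ := (k : ℂ) + 1 with hK
  have hK2 : sqn (k + 1) * sqn (k + 1) = K := by rw [sqn_mul]; push_cast; rfl
  have I2 : Complex.I * Complex.I = -1 := Complex.I_mul_I
  set p := fij (k + 1) (k + 1) with hp
  set q := fij k k with hq
  -- p' and q'
  have hp' : ∀ t : ℝ, HasDerivAt p (-t * p t - 2 * t * Sk (k + 1) t) t := by
    intro t
    refine (fij_deriv (k + 1) (k + 1) t).congr_deriv ?_
    have r1 := fij_rec (k + 1) (k + 1) t
    have u := Sk_u k t
    rw [add_tsub_cancel_right] at r1 ⊢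
    rw [r1, fij_comm k (k + 1), ← u]
    linear_combination (t * p t + 2 * t * Sk (k + 1) t) * I2
  have hq' : ∀ t : ℝ, HasDerivAt q (t * q t - 2 * t * Sk (k + 1) t) t := by
    intro t
    refine (fij_deriv k k t).congr_deriv ?_
    have r1 := fij_rec k k t
    have u := Sk_u k t
    rw [fij_comm (k - 1) k]
    have e : sqn k * fij k (k - 1) t = sqn (k + 1) * fij (k + 1) k t - Complex.I * t * fij k k t := by rw [r1]; ring
    rw [e, ← u]
    linear_combination (-t * q t + 2 * t * Sk (k + 1) t) * I2
  have hpq : ∀ t : ℝ, (t : ℂ) ^ 2 * Sk (k + 1) t + K * (p t - q t) = 0 := by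
    intro t
    have r1 := fij_rec k (k + 1) t
    have u := Sk_u k t
    rw [add_tsub_cancel_right, fij_comm k (k + 1)] at r1
    -- sqn p = I t u + sqn q
    have := congrArg (fun z => sqn (k + 1) * z) r1
    linear_combination this - (p t - q t) * hK2 - Complex.I * t * u + (t ^ 2 * Sk (k + 1) t) * I2
  have hS := Sk_deriv (k + 1)
  have hS1 := Sk1_deriv (k + 1)
  have ht' : ∀ t : ℝ, HasDerivAt (fun t : ℝ => (t : ℂ)) 1 t := fun t => by simpa using (hasDerivAt_id t).ofReal_comp
  have h2 : ∀ t : ℝ, (t : ℂ) * (2 * Sk (k + 1) t + t * Sk1 (k + 1) t - K * (p t + q t)) = 0 := by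
    intro t
    have hd := (((ht' t).pow 2).mul (hS t)).add (((hp' t).sub (hq' t)).const_mul K)
    have hz : HasDerivAt (fun _ : ℝ => (0 : ℂ)) 0 t := hasDerivAt_const _ _
    have := hd.unique (hz.congr_of_eventuallyEq (Eventually.of_forall fun s => hpq s))
    push_cast at this
    simp only [Pi.pow_apply] at this
    linear_combination this
  have hd := (ht' t).mul ((((hS t).const_mul 2).add ((ht' t).mul (hS1 t))).sub (((hp' t).add (hq' t)).const_mul K))
  have hz : HasDerivAt (fun _ : ℝ => (0 : ℂ)) 0 t := hasDerivAt_const _ _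
  have h3 := hd.unique (hz.congr_of_eventuallyEq (Eventually.of_forall fun s => h2 s))
  have ht0 : (t : ℂ) ≠ 0 := by exact_mod_cast ht
  have h4 : 2 * Sk (k + 1) t + t * Sk1 (k + 1) t - K * (p t + q t) = 0 := by
    have := h2 t; rcases mul_eq_zero.1 this with h | h
    · exact absurd h ht0
    · exact h
  have h5 := hpq t
  apply mul_left_cancel₀ ht0
  rw [mul_zero]
  simp only [Pi.add_apply, Pi.sub_apply, Pi.mul_apply] at h3
  linear_combination h3 - h4 - t ^ 2 * h5

end hermite2

-- Part PC4
section gk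

noncomputable def gk (k : ℕ) (τ : ℝ) : ℂ := ((k : ℂ))⁻¹ * Sk k ((Real.sqrt k)⁻¹ * τ)

lemma gk_norm_le (k : ℕ) (hk : 0 < k) (τ : ℝ) : |τ| * ‖gk k τ‖ ≤ 1 := by
  obtain ⟨k, rfl⟩ : ∃ j, k = j + 1 := ⟨k - 1, by omega⟩
  have h := Sk_norm_le k ((Real.sqrt (k + 1 : ℕ))⁻¹ * τ)
  unfold gk
  set K : ℝ := ((k + 1 : ℕ) : ℝ) with hK
  have hK0 : 0 < K := by positivity
  have hs : 0 < Real.sqrt K := Real.sqrt_pos.2 hK0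
  have hss : Real.sqrt K * Real.sqrt K = K := Real.mul_self_sqrt hK0.le
  rw [norm_mul, norm_inv, Complex.norm_natCast, ← hK]
  rw [abs_mul, abs_inv, abs_of_pos hs] at h
  rw [← mul_assoc, mul_comm |τ|, mul_assoc, inv_mul_le_iff₀ hK0, mul_one]
  rw [mul_assoc, inv_mul_le_iff₀ hs, hss] at h
  exact h

lemma Kr (k : ℕ) : ((Real.sqrt k)⁻¹) ^ 2 = (k : ℝ)⁻¹ := by
  rw [inv_pow, Real.sq_sqrt (by positivity)]

lemma gk_phi (k : ℕ) (hk : 0 < k) (τ : ℝ) (h0 : 0 ≤ τ) (h1 : τ ≤ k) :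
    ‖gk k τ - phi τ‖ ≤ 28 * (τ * Real.sqrt τ) / (k : ℝ) ^ 2 := by
  have hkp : (0:ℝ) < k := by exact_mod_cast hk
  set a : ℝ := (Real.sqrt k)⁻¹ with ha
  have ha0 : 0 < a := by positivity
  have ha2 : a ^ 2 = (k : ℝ)⁻¹ := Kr k
  let G1 : ℝ → ℂ := fun τ => ((k : ℂ))⁻¹ * (a * Sk1 k (a * τ))
  let G2 : ℝ → ℂ := fun τ => ((k : ℂ))⁻¹ * (a * (a * Sk2 k (a * τ)))
  have hlin : ∀ τ : ℝ, HasDerivAt (fun τ : ℝ => a * τ) a τ := fun τ => by simpa using (hasDerivAt_id τ).const_mul a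
  have hG : ∀ τ, HasDerivAt (gk k) (G1 τ) τ := by
    intro τ
    have h3 := HasDerivAt.scomp τ (Sk_deriv k (a * τ)) (hlin τ)
    exact (h3.const_mul ((k : ℂ))⁻¹).congr_deriv (by simp [G1])
  have hG1 : ∀ τ, HasDerivAt G1 (G2 τ) τ := by
    intro τ
    have h3 := HasDerivAt.scomp τ (Sk1_deriv k (a * τ)) (hlin τ)
    exact ((h3.const_mul (a : ℂ)).const_mul ((k : ℂ))⁻¹).congr_deriv (by simp [G2])
  have ode : ∀ τ : ℝ, 0 < τ → τ * G2 τ + 3 * G1 τ + ((4 - τ ^ 2 / (k:ℝ) ^ 2 : ℝ) : ℂ) * τ * gk k τ = 0 := by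
    intro τ hτ
    obtain ⟨j, rfl⟩ : ∃ j, k = j + 1 := ⟨k - 1, by omega⟩
    have h := Sk_ode j (a * τ) (by positivity)
    have hc2 : (a : ℂ) ^ 2 * ((j : ℂ) + 1) = 1 := by
      have : a ^ 2 * ((j : ℝ) + 1) = 1 := by rw [ha2]; push_cast; field_simp
      exact_mod_cast this
    have hj : ((j : ℂ) + 1) ≠ 0 := by exact_mod_cast Nat.succ_ne_zero j
    simp only [G1, G2, gk, ← ha]
    push_cast at h ⊢
    have e4 : (τ : ℂ) ^ 2 / ((j : ℂ) + 1) ^ 2 = τ ^ 2 * a ^ 4 := by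
      rw [div_eq_iff (pow_ne_zero _ hj)]
      linear_combination (-(τ : ℂ) ^ 2) * (a ^ 2 * (j + 1) + 1) * hc2
    rw [e4]
    linear_combination ((j : ℂ) + 1)⁻¹ * a * h - ((j : ℂ) + 1)⁻¹ * 4 * τ * Sk (j + 1) (a * τ) * hc2
  have hre : ∀ (f : ℝ → ℂ) (f' : ℂ) (t : ℝ), HasDerivAt f f' t → HasDerivAt (fun t => (f t).re) f'.re t := fun f f' t h =>
    (Complex.reCLM.hasFDerivAt.comp_hasDerivAt t h)
  have him : ∀ (f : ℝ → ℂ) (f' : ℂ) (t : ℝ), HasDerivAt f f' t → HasDerivAt (fun t => (f t).im) f'.im t := fun f f' t h =>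
    (Complex.imCLM.hasFDerivAt.comp_hasDerivAt t h)
  have g0 : gk k 0 = 1 := by
    unfold gk; rw [mul_zero, Sk_zero]; exact inv_mul_cancel₀ (by exact_mod_cast hk.ne')
  have g10 : G1 0 = 0 := by simp [G1, Sk1_zero]
  have b1 := ode_energy k hkp (fun t => (gk k t).re - phi t) (fun t => (G1 t).re - phi1 t) (fun t => (G2 t).re - phi2 t)
    (fun t => t ^ 2 / (k:ℝ) ^ 2 * phi t) (fun t => (hre _ _ t (hG t)).sub (phi_hasDerivAt t)) (fun t => (hre _ _ t (hG1 t)).sub (phi1_hasDerivAt t))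
    (fun t ht _ => by
      have o := congrArg Complex.re (ode t ht)
      simp only [Complex.add_re, Complex.mul_re, Complex.ofReal_re, Complex.ofReal_im, zero_mul, sub_zero, Complex.zero_re, Complex.mul_im,
        mul_zero, add_zero, Complex.re_ofNat, Complex.im_ofNat] at o
      have p := phi_ode t
      linear_combination o - p)
    (fun t ht _ => by
      have p := phi_decay ht.le
      have hst := Real.sq_sqrt ht.le
      rw [abs_mul, abs_of_nonneg (by positivity : (0:ℝ) ≤ t ^ 2 / (k:ℝ) ^ 2), div_mul_eq_mul_div]
      refine div_le_div_of_nonneg_right ?_ (by positivity)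
      have hs : 0 < Real.sqrt t := Real.sqrt_pos.2 ht
      refine abs_le_of_sq_le_sq' ?_ (by positivity) |>.2
      rw [mul_pow, mul_pow, sq_abs, hst]
      nlinarith)
    (by simp [g0, phi_zero]) (by simp [g10, phi1_zero]) τ h0 h1
  have b2 := ode_energy k hkp (fun t => (gk k t).im) (fun t => (G1 t).im) (fun t => (G2 t).im)
    (fun t => 0) (fun t => (him _ _ t (hG t))) (fun t => (him _ _ t (hG1 t)))
    (fun t ht _ => by
      have o := congrArg Complex.im (ode t ht)
      simp only [Complex.add_im, Complex.mul_im, Complex.ofReal_re, Complex.ofReal_im, zero_mul, Complex.zero_im, Complex.mul_re,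
        mul_zero, add_zero, Complex.re_ofNat, Complex.im_ofNat, sub_zero] at o
      linear_combination o)
    (fun t ht _ => by simp; positivity)
    (by simp [g0]) (by simp [g10]) τ h0 h1
  refine (Complex.norm_le_abs_re_add_abs_im _).trans ?_
  simp only [Complex.sub_re, Complex.sub_im, Complex.ofReal_re, Complex.ofReal_im, sub_zero]
  refine (add_le_add b1 b2).trans (le_of_eq (by ring))

end gk

-- Part PC5
section vens

variable {k : ℕ}

noncomputable def br (φ : ℝ → ℂ) (i j : ℕ) : ℂ := ∫ x, φ x * (hc i x * hc j x) ∂g1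

noncomputable def hdet (x : Fin k → ℝ) : ℂ := Matrix.det (Matrix.of fun i j : Fin k => hc i (x j))

noncomputable def VE (Φ : (Fin k → ℝ) → ℂ) : ℂ := ((k.factorial : ℂ))⁻¹ * ∫ x, Φ x * (hdet x * hdet x) ∂(gp (Fin k))

lemma EB.at {f : ℝ → ℂ} (hf : EB f) {ι : Type*} [Fintype ι] (i : ι) : EB (fun x : ι → ℝ => f (x i)) :=
  hf.comp_lip (continuous_apply i) 1 0 zero_le_one fun x => by simpa using norm_le_pi_norm x i

lemma hdet_EB : EB (hdet (k := k)) := by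
  unfold hdet
  simp_rw [Matrix.det_apply']
  exact EB.sum _ fun σ _ => (EB.const _).mul (EB.prod _ fun i _ => (hc_EB _).at i)

lemma VE_prod (φ : Fin k → ℝ → ℂ) (hφ : ∀ a, EB (φ a)) :
    ∫ x, (∏ a, φ a (x a)) * (hdet x * hdet x) ∂(gp (Fin k))
      = ∑ σ : Equiv.Perm (Fin k), Matrix.det (Matrix.of fun a b : Fin k => br (φ a) (σ a) (σ b)) := by
  have e : ∀ x : Fin k → ℝ, (∏ a, φ a (x a)) * (hdet x * hdet x) =
      ∑ σ : Equiv.Perm (Fin k), ∑ τ : Equiv.Perm (Fin k), (((Equiv.Perm.sign σ : ℤ) : ℂ) * ((Equiv.Perm.sign τ : ℤ) : ℂ)) *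
        ∏ a, (φ a (x a) * (hc (σ a) (x a) * hc (τ a) (x a))) := by
    intro x
    unfold hdet
    rw [Matrix.det_apply', Finset.sum_mul_sum, Finset.mul_sum]
    refine Finset.sum_congr rfl fun σ _ => ?_
    rw [Finset.mul_sum]
    refine Finset.sum_congr rfl fun τ _ => ?_
    simp only [Finset.prod_mul_distrib, Matrix.of_apply]
    ring
  simp_rw [e]
  have hE : ∀ σ τ : Equiv.Perm (Fin k), EB (fun x : Fin k → ℝ => (((Equiv.Perm.sign σ : ℤ) : ℂ) * ((Equiv.Perm.sign τ : ℤ) : ℂ)) *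
        ∏ a, (φ a (x a) * (hc (σ a) (x a) * hc (τ a) (x a)))) := fun σ τ =>
    (EB.const _).mul (EB.prod _ fun a _ => ((hφ a).at a).mul (((hc_EB _).at a).mul ((hc_EB _).at a)))
  rw [integral_finsetSum _ fun σ _ => (EB.sum _ fun τ _ => hE σ τ).intp]
  refine Finset.sum_congr rfl fun σ _ => ?_
  rw [integral_finsetSum _ fun τ _ => (hE σ τ).intp, ← Matrix.det_transpose, Matrix.det_apply', ← Equiv.sum_comp (Equiv.mulLeft σ)]
  refine Finset.sum_congr rfl fun π _ => ?_
  rw [integral_const_mul, integral_fintype_prod_eq_prod (f := fun a y => φ a y * (hc (σ a) y * hc ((Equiv.mulLeft σ π) a) y))]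
  have hs : (((Equiv.Perm.sign σ : ℤ) : ℂ) * ((Equiv.Perm.sign ((Equiv.mulLeft σ) π) : ℤ) : ℂ)) = ((Equiv.Perm.sign π : ℤ) : ℂ) := by
    rw [Equiv.coe_mulLeft, Equiv.Perm.sign_mul]
    push_cast
    rw [← mul_assoc]
    have : ((Equiv.Perm.sign σ : ℤ) : ℂ) * ((Equiv.Perm.sign σ : ℤ) : ℂ) = 1 := by
      rcases Int.units_eq_one_or (Equiv.Perm.sign σ) with h | h <;> simp [h]
    rw [this, one_mul]
  rw [hs]
  rfl

lemma br_one (i j : ℕ) : br (fun _ => 1) i j = if i = j then 1 else 0 := by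
  unfold br; simp only [one_mul]; exact hc_orth i j

lemma det_row1 (a : Fin k) (N : Matrix (Fin k) (Fin k) ℂ) (h : ∀ c, c ≠ a → ∀ d, N c d = if c = d then 1 else 0) : N.det = N a a := by
  have : N = Matrix.updateRow 1 a (N a) := by
    ext c d
    by_cases hc : c = a
    · subst hc; simp
    · rw [Matrix.updateRow_ne hc, h c hc d, Matrix.one_apply]
  have e2 : N = 1 + Matrix.replicateCol Unit (Pi.single a (1:ℂ)) * Matrix.replicateRow Unit (N a - Pi.single a 1) := by
    ext c d
    rw [Matrix.add_apply, Matrix.mul_apply]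
    by_cases hc : c = a
    · subst hc; simp [Matrix.one_apply, Pi.single_apply, eq_comm]
    · simp [h c hc d, Matrix.one_apply, Pi.single_apply, hc]
  rw [e2, Matrix.det_one_add_replicateCol_mul_replicateRow]
  rw [← e2]; simp

lemma det_row2 (a b : Fin k) (hab : a ≠ b) (N : Matrix (Fin k) (Fin k) ℂ) (h : ∀ c, c ≠ a → c ≠ b → ∀ d, N c d = if c = d then 1 else 0) :
    N.det = N a a * N b b - N a b * N b a := by
  let P : Matrix (Fin k) (Fin 2) ℂ := Matrix.of fun c s => if s = 0 then (if c = a then 1 else 0) else (if c = b then 1 else 0)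
  let Q : Matrix (Fin 2) (Fin k) ℂ := Matrix.of fun s d => if s = 0 then N a d - (if a = d then 1 else 0) else N b d - (if b = d then 1 else 0)
  have e2 : N = 1 + P * Q := by
    ext c d
    rw [Matrix.add_apply, Matrix.mul_apply, Fin.sum_univ_two]
    by_cases hc : c = a
    · subst hc; simp [P, Q, Matrix.one_apply, hab]
    · by_cases hcb : c = b
      · subst hcb; simp [P, Q, Matrix.one_apply, hc]
      · simp [h c hc hcb d, P, Q, Matrix.one_apply, hc, hcb]
  have e3 : ∀ s t : Fin 2, (1 + Q * P : Matrix (Fin 2) (Fin 2) ℂ) s t = if s = 0 then (if t = 0 then N a a else N a b) else (if t = 0 then N b a else N b b) := by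
    intro s t
    rw [Matrix.add_apply, Matrix.mul_apply]
    fin_cases s <;> fin_cases t <;> simp [P, Q, hab, hab.symm]
  calc N.det = (1 + P * Q).det := by rw [← e2]
    _ = (1 + Q * P).det := Matrix.det_one_add_mul_comm _ _
    _ = _ := by rw [Matrix.det_fin_two, e3, e3, e3, e3]; simp

lemma fact_ne : ((k.factorial : ℂ)) ≠ 0 := by exact_mod_cast k.factorial_ne_zero

lemma perm_sum1 (F : ℕ → ℂ) (σ : Equiv.Perm (Fin k)) : ∑ a, F (σ a) = ∑ i ∈ Finset.range k, F i := by
  rw [Equiv.sum_comp σ (fun i : Fin k => F i), Fin.sum_univ_eq_sum_range]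

lemma VE_one : VE (k := k) (fun _ => 1) = 1 := by
  have h := VE_prod (k := k) (fun _ _ => 1) (fun _ => EB.const _)
  simp only [Finset.prod_const_one] at h
  unfold VE
  rw [h]
  have : ∀ σ : Equiv.Perm (Fin k), Matrix.det (Matrix.of fun a b : Fin k => br (fun _ => (1:ℂ)) (σ a) (σ b)) = 1 := by
    intro σ
    rw [← Matrix.det_one (n := Fin k) (R := ℂ)]
    congr 1; ext a b
    simp [br_one, Matrix.one_apply, Fin.val_inj]
  simp only [this, Finset.sum_const, Finset.card_univ, Fintype.card_perm, Fintype.card_fin, nsmul_eq_mul, mul_one]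
  exact inv_mul_cancel₀ fact_ne

lemma VE_at1 (f : ℝ → ℂ) (hf : EB f) (a : Fin k) :
    ∫ x, f (x a) * (hdet x * hdet x) ∂(gp (Fin k)) = ∑ σ : Equiv.Perm (Fin k), br f (σ a) (σ a) := by
  have h := VE_prod (k := k) (fun c => if c = a then f else fun _ => 1) (fun c => by
    by_cases h : c = a
    · simpa [h] using hf
    · simpa [h] using EB.const (1:ℂ))
  have e : ∀ x : Fin k → ℝ, (∏ c, (if c = a then f else fun _ => (1:ℂ)) (x c)) = f (x a) := by
    intro x
    rw [Finset.prod_eq_single a]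
    · simp
    · intro b _ hb; simp [hb]
    · simp
  simp_rw [e] at h
  rw [h]
  refine Finset.sum_congr rfl fun σ _ => ?_
  rw [det_row1 a]
  · simp
  · intro c hc d
    simp [hc, br_one, Fin.val_inj]

lemma VE_at2 (f g : ℝ → ℂ) (hf : EB f) (hg : EB g) (a b : Fin k) (hab : a ≠ b) :
    ∫ x, f (x a) * g (x b) * (hdet x * hdet x) ∂(gp (Fin k)) =
      ∑ σ : Equiv.Perm (Fin k), (br f (σ a) (σ a) * br g (σ b) (σ b) - br f (σ a) (σ b) * br g (σ b) (σ a)) := by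
  have h := VE_prod (k := k) (fun c => if c = a then f else if c = b then g else fun _ => 1) (fun c => by
    by_cases h : c = a
    · simpa [h] using hf
    · by_cases h' : c = b
      · simpa [h', hab.symm] using hg
      · simpa [h, h'] using EB.const (1:ℂ))
  have e : ∀ x : Fin k → ℝ, (∏ c, (if c = a then f else if c = b then g else fun _ => (1:ℂ)) (x c)) = f (x a) * g (x b) := by
    intro x
    rw [Finset.prod_eq_mul a b hab]
    · simp [hab.symm]
    · intro c _ hc; simp [hc.1, hc.2]
    · simp
    · simp
  simp_rw [e] at h
  rw [h]
  refine Finset.sum_congr rfl fun σ _ => ?_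
  rw [det_row2 a b hab]
  · simp [hab.symm]
  · intro c hc hc' d
    simp [hc, hc', br_one, Fin.val_inj]

lemma VE_sum (f : ℝ → ℂ) (hf : EB f) : VE (k := k) (fun x => ∑ a, f (x a)) = ∑ i ∈ Finset.range k, br f i i := by
  unfold VE
  simp_rw [Finset.sum_mul]
  rw [integral_finsetSum _ fun a _ => ((hf.at a).mul (hdet_EB.mul hdet_EB)).intp]
  simp_rw [VE_at1 f hf]
  rw [Finset.sum_comm]
  simp_rw [perm_sum1 (fun i => br f i i)]
  simp only [Finset.sum_const, Finset.card_univ, Fintype.card_perm, Fintype.card_fin, nsmul_eq_mul]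
  rw [← mul_assoc, inv_mul_cancel₀ fact_ne, one_mul]

lemma VE_sum2 (f g : ℝ → ℂ) (hf : EB f) (hg : EB g) : VE (k := k) (fun x => (∑ a, f (x a)) * (∑ a, g (x a))) =
    ∑ i ∈ Finset.range k, br (fun x => f x * g x) i i +
      ∑ i ∈ Finset.range k, ∑ j ∈ Finset.range k, (br f i i * br g j j - br f i j * br g j i) := by
  unfold VE
  simp_rw [Finset.sum_mul_sum, Finset.sum_mul]
  have hE : ∀ a b : Fin k, EB (fun x : Fin k → ℝ => f (x a) * g (x b) * (hdet x * hdet x)) := fun a b =>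
    ((hf.at a).mul (hg.at b)).mul (hdet_EB.mul hdet_EB)
  rw [integral_finsetSum _ fun a _ => (EB.sum _ fun b _ => hE a b).intp]
  have h1 : ∀ a b : Fin k, ∫ x, f (x a) * g (x b) * (hdet x * hdet x) ∂(gp (Fin k)) =
      ∑ σ : Equiv.Perm (Fin k), ((if a = b then br (fun x => f x * g x) (σ a) (σ a) else 0) +
        (br f (σ a) (σ a) * br g (σ b) (σ b) - br f (σ a) (σ b) * br g (σ b) (σ a))) := by
    intro a b
    by_cases hab : a = b
    · subst hab
      rw [VE_at1 (fun x => f x * g x) (hf.mul hg) a]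
      simp
    · rw [VE_at2 f g hf hg a b hab]; simp [hab]
  simp_rw [integral_finsetSum Finset.univ fun b _ => (hE _ b).intp, h1]
  have h2 : ∀ σ : Equiv.Perm (Fin k), ∑ a, ∑ b, ((if a = b then br (fun x => f x * g x) (σ a) (σ a) else 0) +
        (br f (σ a) (σ a) * br g (σ b) (σ b) - br f (σ a) (σ b) * br g (σ b) (σ a))) =
      ∑ i ∈ Finset.range k, br (fun x => f x * g x) i i +
      ∑ i ∈ Finset.range k, ∑ j ∈ Finset.range k, (br f i i * br g j j - br f i j * br g j i) := by
    intro σ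
    simp_rw [Finset.sum_add_distrib]
    congr 1
    · simp only [Finset.sum_ite_eq, Finset.mem_univ, if_true]
      exact perm_sum1 (fun i => br (fun x => f x * g x) i i) σ
    · rw [← perm_sum1 (fun i => ∑ j ∈ Finset.range k, (br f i i * br g j j - br f i j * br g j i)) σ]
      refine Finset.sum_congr rfl fun a _ => ?_
      rw [← perm_sum1 (fun j => br f (σ a) (σ a) * br g j j - br f (σ a) j * br g j (σ a)) σ]
  have h3 : ∑ a, ∑ b, ∑ σ : Equiv.Perm (Fin k), ((if a = b then br (fun x => f x * g x) (σ a) (σ a) else 0) +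
        (br f (σ a) (σ a) * br g (σ b) (σ b) - br f (σ a) (σ b) * br g (σ b) (σ a))) = 
      ∑ σ : Equiv.Perm (Fin k), ∑ a, ∑ b, ((if a = b then br (fun x => f x * g x) (σ a) (σ a) else 0) +
        (br f (σ a) (σ a) * br g (σ b) (σ b) - br f (σ a) (σ b) * br g (σ b) (σ a))) := by
    rw [Finset.sum_comm]
    rw [Finset.sum_congr rfl fun a _ => Finset.sum_comm]
    rw [Finset.sum_comm]
    refine Finset.sum_congr rfl fun σ _ => ?_
    rw [Finset.sum_comm]
  rw [h3, Finset.sum_congr rfl fun σ _ => h2 σ]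
  simp only [Finset.sum_const, Finset.card_univ, Fintype.card_perm, Fintype.card_fin, nsmul_eq_mul]
  rw [← mul_assoc, inv_mul_cancel₀ fact_ne, one_mul]

/-- the two needed statistics -/
lemma VE_char (t : ℝ) : VE (k := k) (fun x => ∑ a, ex t (x a)) = Sk k t := VE_sum _ (ex_EB t)

lemma VE_char2 (t : ℝ) : VE (k := k) (fun x => (∑ a, ex t (x a)) * (∑ a, ex (-t) (x a))) = ((vk k t + ‖Sk k t‖ ^ 2 : ℝ) : ℂ) := by
  rw [VE_sum2 _ _ (ex_EB t) (ex_EB (-t))]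
  have h1 : ∀ i, br (fun x => ex t x * ex (-t) x) i i = 1 := by
    intro i; simp_rw [ex_mul_neg]; rw [br_one]; simp
  have h2 : ∀ i j, br (ex (-t)) i j = star (br (ex t) i j) := fun i j => (fij_star i j t).symm
  simp_rw [h1, h2, Finset.sum_sub_distrib, ← Finset.mul_sum, ← Finset.sum_mul, ← star_sum]
  have h3 : ∀ i j, br (ex t) i j * star (br (ex t) j i) = ((‖fij i j t‖ ^ 2 : ℝ) : ℂ) := by
    intro i j
    have : br (ex t) j i = br (ex t) i j := fij_comm j i t
    rw [this, Complex.star_def, Complex.mul_conj, Complex.normSq_eq_norm_sq]; rfl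
  simp_rw [h3]
  have h4 : (∑ i ∈ Finset.range k, br (ex t) i i) = Sk k t := rfl
  rw [h4, Complex.star_def, Complex.mul_conj, Complex.normSq_eq_norm_sq]
  unfold vk
  simp; ring

end vens

-- Part PD1
section lists

def terms (m : ℕ) : List ℕ → List (ℕ × List ℕ)
  | [] => []
  | c :: l => (c, (m + c - 1) :: l) :: (terms m l).map (fun t => (t.1, c :: t.2))

lemma terms_sum (m : ℕ) (l : List ℕ) : ∀ t ∈ terms m l, t.2.sum ≤ m + l.sum := by
  induction l with
  | nil => simp [terms]
  | cons c l ih =>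
    intro t ht
    simp only [terms, List.mem_cons, List.mem_map] at ht
    rcases ht with rfl | ⟨s, hs, rfl⟩
    · simp; omega
    · have := ih s hs; simp; omega

/-- value of the contracted derivative -/
noncomputable def LTq (q : ℕ → ℂ) (m : ℕ) : List ℕ → ℂ
  | [] => 0
  | c :: l => c * q (m + c - 1) * (l.map q).prod + q c * LTq q m l

lemma LTq_eq (q : ℕ → ℂ) (m : ℕ) (l : List ℕ) : LTq q m l = ((terms m l).map fun t => (t.1 : ℂ) * (t.2.map q).prod).sum := by
  induction l with
  | nil => simp [LTq, terms]
  | cons c l ih =>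
    simp only [LTq, terms, ih, List.map_cons, List.sum_cons, List.prod_cons, List.map_map, Function.comp_def]
    congr 1
    · ring
    · rw [← List.sum_map_mul_left]; congr 1; apply List.map_congr_left; intro t _; ring

structure LoopEq (k : ℕ) (E : List ℕ → ℂ) : Prop where
  nil : E [] = 1
  zero : ∀ l, E (0 :: l) = k * E l
  succ : ∀ m l, E ((m + 1) :: l) = ∑ a ∈ Finset.range m, E (a :: (m - 1 - a) :: l) + ((terms m l).map fun t => (t.1 : ℂ) * E t.2).sum

lemma LoopEq.unique {k : ℕ} {E F : List ℕ → ℂ} (hE : LoopEq k E) (hF : LoopEq k F) (l : List ℕ) : E l = F l := by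
  have key : ∀ N, ∀ L, ∀ l : List ℕ, l.sum = N → l.length = L → E l = F l := by
    intro N
    induction N using Nat.strong_induction_on with
    | _ N ihN =>
      intro L
      induction L with
      | zero => intro l _ hl; rw [List.length_eq_zero_iff] at hl; subst hl; rw [hE.nil, hF.nil]
      | succ L ihL =>
        intro l hs hl
        rcases l with _ | ⟨c, l⟩
        · simp at hl
        · rcases c with _ | m
          · rw [hE.zero, hF.zero, ihL l (by simpa using hs) (by simpa using hl)]
          · simp only [List.sum_cons] at hs
            rw [hE.succ, hF.succ]
            congr 1
            · refine Finset.sum_congr rfl fun a ha => ?_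
              rw [Finset.mem_range] at ha
              refine ihN _ ?_ _ _ rfl rfl
              simp; omega
            · congr 1
              apply List.map_congr_left
              intro t ht
              have := terms_sum m l t ht
              rw [ihN t.2.sum (by omega) _ t.2 rfl rfl]
  exact key _ _ l rfl rfl

end lists

section vloop
variable {k : ℕ}

def prs (k : ℕ) : Finset (Fin k × Fin k) := Finset.univ.filter fun p => p.1 < p.2

noncomputable def VV (x : Fin k → ℝ) : ℂ := ∏ p ∈ prs k, ((x p.2 : ℂ) - x p.1)
noncomputable def hcst (k : ℕ) : ℂ := ((∏ i : Fin k, (Real.sqrt ((i : ℕ).factorial))⁻¹ : ℝ) : ℂ)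

lemma hdet_eq (x : Fin k → ℝ) : hdet x = hcst k * VV x := by
  have h1 : hdet x = ((Matrix.det (Matrix.of fun i j : Fin k => hr i (x j)) : ℝ) : ℂ) := by
    have := RingHom.map_det Complex.ofRealHom (Matrix.of fun i j : Fin k => hr i (x j))
    rw [Complex.ofRealHom_eq_coe] at this
    rw [this]; rfl
  have h2 : Matrix.det (Matrix.of fun i j : Fin k => hr i (x j)) = (∏ i : Fin k, (Real.sqrt ((i : ℕ).factorial))⁻¹) * ∏ p ∈ prs k, (x p.2 - x p.1) := by
    have e : (Matrix.of fun i j : Fin k => hr i (x j)) = Matrix.of fun i j : Fin k => (Real.sqrt ((i : ℕ).factorial))⁻¹ * (Matrix.of fun i j : Fin k => (heP j).eval (x i))ᵀ i j := by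
      ext i j; simp [hr]; ring
    rw [e, Matrix.det_mul_column (fun i : Fin k => (Real.sqrt ((i : ℕ).factorial))⁻¹), Matrix.det_transpose,
      ← Matrix.det_eval_matrixOfPolynomials_eq_det_vandermonde x (fun j : Fin k => heP j) (fun i => heP_natDegree i) (fun i => heP_monic i),
      Matrix.det_vandermonde]
    congr 1
    unfold prs
    rw [Finset.prod_filter, ← Finset.univ_product_univ, Finset.prod_product]
    refine Finset.prod_congr rfl fun i _ => ?_
    rw [← Finset.prod_filter]
    refine Finset.prod_congr ?_ fun _ _ => rfl
    ext j; simp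
  rw [h1, h2]; unfold hcst VV; push_cast; rfl

lemma VV_EB : EB (VV (k := k)) := EB.prod _ fun p _ => (EB.coord p.2).ofReal.sub (EB.coord p.1).ofReal

noncomputable def dVV (j : Fin k) (x : Fin k → ℝ) : ℂ :=
  ∑ p ∈ prs k, (∏ p' ∈ (prs k).erase p, ((x p'.2 : ℂ) - x p'.1)) * ((if p.2 = j then 1 else 0) - (if p.1 = j then 1 else 0))

lemma dVV_EB (j : Fin k) : EB (dVV j) :=
  EB.sum _ fun p _ => (EB.prod _ fun p' _ => (EB.coord p'.2).ofReal.sub (EB.coord p'.1).ofReal).mul (EB.const _)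

lemma coord_deriv (i j : Fin k) (x : Fin k → ℝ) :
    HasDerivAt (fun y : ℝ => ((Function.update x j y i : ℝ) : ℂ)) (if i = j then 1 else 0) (x j) := by
  by_cases h : i = j
  · subst h; simpa using (hasDerivAt_id (x i)).ofReal_comp
  · simp only [Function.update_of_ne h, if_neg h]; exact hasDerivAt_const _ _

lemma VV_deriv (j : Fin k) (x : Fin k → ℝ) : HasDerivAt (fun y => VV (Function.update x j y)) (dVV j x) (x j) := by
  have := HasDerivAt.fun_finsetProd (u := prs k) (f := fun p y => ((Function.update x j y p.2 : ℝ) : ℂ) - (Function.update x j y p.1 : ℝ))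
    (x := x j) fun p _ => (coord_deriv p.2 j x).sub (coord_deriv p.1 j x)
  refine this.congr_deriv ?_
  simp [dVV]

noncomputable def qs (x : Fin k → ℝ) (n : ℕ) : ℂ := ∑ a, (x a : ℂ) ^ n

lemma sym_sum (h : Fin k → Fin k → ℂ) (hs : ∀ i l, h i l = h l i) :
    2 * ∑ p ∈ prs k, h p.1 p.2 = ∑ i, ∑ l, h i l - ∑ i, h i i := by
  have e1 : ∑ p ∈ prs k, h p.1 p.2 = ∑ i, ∑ l, if i < l then h i l else 0 := by
    unfold prs
    rw [Finset.sum_filter, ← Finset.univ_product_univ, Finset.sum_product]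
  have e2 : ∑ i, ∑ l, (if i < l then h i l else 0) = ∑ i, ∑ l, if l < i then h i l else 0 := by
    rw [Finset.sum_comm]
    refine Finset.sum_congr rfl fun i _ => Finset.sum_congr rfl fun l _ => ?_
    rw [hs]
  have e3 : ∑ i, ∑ l, h i l = ∑ i, ∑ l, (if i < l then h i l else 0) + (∑ i, ∑ l, if l < i then h i l else 0) + ∑ i, h i i := by
    rw [← Finset.sum_add_distrib, ← Finset.sum_add_distrib]
    refine Finset.sum_congr rfl fun i _ => ?_
    have : h i i = ∑ l, if i = l then h i l else 0 := by simp
    rw [this, ← Finset.sum_add_distrib, ← Finset.sum_add_distrib]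
    refine Finset.sum_congr rfl fun l _ => ?_
    rcases lt_trichotomy i l with hh | hh | hh
    · simp [hh, hh.ne, hh.not_gt]
    · simp [hh]
    · simp [hh, hh.ne', hh.not_gt]
  rw [e3, ← e2, e1]; ring

lemma VV_euler (m : ℕ) (x : Fin k → ℝ) : ∑ j, (x j : ℂ) ^ m * (2 * dVV j x) = VV x * (∑ a ∈ Finset.range m, qs x a * qs x (m - 1 - a) - m * qs x (m - 1)) := by
  have e1 : ∑ j, (x j : ℂ) ^ m * dVV j x = VV x * ∑ p ∈ prs k, ∑ a ∈ Finset.range m, (x p.2 : ℂ) ^ a * (x p.1 : ℂ) ^ (m - 1 - a) := by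
    unfold dVV
    simp_rw [Finset.mul_sum (prs k)]
    rw [Finset.sum_comm]
    refine Finset.sum_congr rfl fun p hp => ?_
    have : ∀ j, (x j : ℂ) ^ m * ((∏ p' ∈ (prs k).erase p, ((x p'.2 : ℂ) - x p'.1)) * ((if p.2 = j then 1 else 0) - (if p.1 = j then 1 else 0)))
      = (∏ p' ∈ (prs k).erase p, ((x p'.2 : ℂ) - x p'.1)) * ((if p.2 = j then (x j : ℂ) ^ m else 0) - (if p.1 = j then (x j : ℂ) ^ m else 0)) := by
      intro j; split_ifs <;> ring
    simp_rw [this]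
    rw [← Finset.mul_sum, Finset.sum_sub_distrib]
    simp only [Finset.sum_ite_eq, Finset.mem_univ, if_true]
    rw [← geom_sum₂_mul]
    unfold VV
    rw [← Finset.mul_prod_erase _ _ hp]; ring
  have e2 : ∑ j, (x j : ℂ) ^ m * (2 * dVV j x) = 2 * ∑ j, (x j : ℂ) ^ m * dVV j x := by
    rw [Finset.mul_sum]; refine Finset.sum_congr rfl fun j _ => by ring
  rw [e2, e1, ← mul_assoc, mul_comm (2:ℂ), mul_assoc]
  congr 1
  rw [sym_sum (fun i l => ∑ a ∈ Finset.range m, (x l : ℂ) ^ a * (x i : ℂ) ^ (m - 1 - a))]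
  · congr 1
    · unfold qs
      simp_rw [Finset.sum_mul_sum]
      rw [Finset.sum_comm (s := (Finset.univ : Finset (Fin k))) (t := (Finset.univ : Finset (Fin k)))]
      have : ∀ l, ∑ i, ∑ a ∈ Finset.range m, (x l : ℂ) ^ a * (x i : ℂ) ^ (m - 1 - a) = ∑ a ∈ Finset.range m, ∑ i, (x l : ℂ) ^ a * (x i : ℂ) ^ (m - 1 - a) := fun l => Finset.sum_comm
      simp_rw [this]
      rw [Finset.sum_comm]
    · unfold qs
      rw [Finset.mul_sum]
      refine Finset.sum_congr rfl fun i _ => ?_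
      rw [Finset.sum_congr rfl (g := fun _ => (x i : ℂ) ^ (m - 1))]
      · simp
      · intro a ha
        rw [Finset.mem_range] at ha
        rw [← pow_add]; congr 1; omega
  · intro i l
    rw [← Finset.sum_range_reflect]
    refine Finset.sum_congr rfl fun a ha => ?_
    rw [Finset.mem_range] at ha
    rw [mul_comm]; congr 2; omega

noncomputable def dq (j : Fin k) (x : Fin k → ℝ) (c : ℕ) : ℂ := c * (x j : ℂ) ^ (c - 1)

lemma qs_EB (n : ℕ) : EB (fun x : Fin k → ℝ => qs x n) := EB.sum _ fun a _ => (EB.coord a).ofReal.pow n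

lemma qs_deriv (j : Fin k) (x : Fin k → ℝ) (n : ℕ) : HasDerivAt (fun y => qs (Function.update x j y) n) (dq j x n) (x j) := by
  have := HasDerivAt.fun_sum (u := Finset.univ) fun a (_ : a ∈ Finset.univ) => (coord_deriv a j x).pow n
  refine this.congr_deriv ?_
  simp [dq]

/-- derivative of a product over a list -/
noncomputable def dPr (q d : ℕ → ℂ) : List ℕ → ℂ
  | [] => 0
  | c :: l => d c * (l.map q).prod + q c * dPr q d l

lemma dPr_deriv (q : ℝ → ℕ → ℂ) (d : ℕ → ℂ) (t : ℝ) (h : ∀ n, HasDerivAt (fun y => q y n) (d n) t) (l : List ℕ) :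
    HasDerivAt (fun y => (l.map (q y)).prod) (dPr (q t) d l) t := by
  induction l with
  | nil => simpa [dPr] using hasDerivAt_const t (1:ℂ)
  | cons c l ih =>
    simp only [List.map_cons, List.prod_cons, dPr]
    exact (h c).mul ih

lemma EB.listProd {X : Type*} [NormedAddCommGroup X] (q : X → ℕ → ℂ) (h : ∀ n, EB (fun x => q x n)) (l : List ℕ) : EB (fun x => (l.map (q x)).prod) := by
  induction l with
  | nil => simpa using EB.const (1:ℂ)
  | cons c l ih => simp only [List.map_cons, List.prod_cons]; exact (h c).mul ih

lemma EB.dPr {X : Type*} [NormedAddCommGroup X] (q d : X → ℕ → ℂ) (h : ∀ n, EB (fun x => q x n)) (h' : ∀ n, EB (fun x => d x n)) (l : List ℕ) : EB (fun x => dPr (q x) (d x) l) := by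
  induction l with
  | nil => simpa [_root_.dPr] using EB.const (0:ℂ)
  | cons c l ih => simp only [_root_.dPr]; exact ((h' c).mul (EB.listProd q h l)).add ((h c).mul ih)

lemma EB.LTq {X : Type*} [NormedAddCommGroup X] (q : X → ℕ → ℂ) (h : ∀ n, EB (fun x => q x n)) (m : ℕ) (l : List ℕ) : EB (fun x => LTq (q x) m l) := by
  induction l with
  | nil => simpa [_root_.LTq] using EB.const (0:ℂ)
  | cons c l ih => simp only [_root_.LTq]; exact (((EB.const _).mul (h _)).mul (EB.listProd q h l)).add ((h c).mul ih)

/-- contraction of dPr against weights -/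
lemma dPr_contract {ι : Type*} (s : Finset ι) (q : ℕ → ℂ) (d : ι → ℕ → ℂ) (w : ι → ℂ) (m : ℕ)
    (h : ∀ c : ℕ, ∑ i ∈ s, w i * d i c = c * q (m + c - 1)) (l : List ℕ) : ∑ i ∈ s, w i * dPr q (d i) l = LTq q m l := by
  induction l with
  | nil => simp [dPr, LTq]
  | cons c l ih =>
    simp only [dPr, LTq, mul_add, Finset.sum_add_distrib]
    congr 1
    · rw [← h c, Finset.sum_mul]; refine Finset.sum_congr rfl fun i _ => by ring
    · rw [← ih, Finset.mul_sum]; refine Finset.sum_congr rfl fun i _ => by ring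

noncomputable def VM (k : ℕ) (l : List ℕ) : ℂ := VE (k := k) fun x => (l.map (qs x)).prod

lemma qs_zero (x : Fin k → ℝ) : qs x 0 = k := by simp [qs]

lemma integral_LTq {X : Type*} [MeasurableSpace X] (μ : Measure X) (q : X → ℕ → ℂ) (w : X → ℂ) (h : ∀ l : List ℕ, Integrable (fun x => (l.map (q x)).prod * w x) μ) (m : ℕ) (l : List ℕ) :
    ∫ x, LTq (q x) m l * w x ∂μ = ((terms m l).map fun t => (t.1 : ℂ) * ∫ x, (t.2.map (q x)).prod * w x ∂μ).sum := by
  simp_rw [LTq_eq]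
  generalize terms m l = L
  have hi : ∀ L : List (ℕ × List ℕ), Integrable (fun x => (L.map fun t => (t.1 : ℂ) * (t.2.map (q x)).prod).sum * w x) μ := by
    intro L
    induction L with
    | nil => simp
    | cons t L ih =>
      simp only [List.map_cons, List.sum_cons, add_mul, mul_assoc]
      exact ((h t.2).const_mul _).add ih
  induction L with
  | nil => simp
  | cons t L ih =>
    simp only [List.map_cons, List.sum_cons, add_mul, mul_assoc]
    rw [integral_add ((h t.2).const_mul _) (hi L), integral_const_mul, ih]

lemma VM_loop (k : ℕ) : LoopEq k (VM k) := by
  constructor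
  · simpa [VM] using VE_one
  · intro l
    unfold VM VE
    simp only [List.map_cons, List.prod_cons, qs_zero, mul_assoc]
    rw [integral_const_mul]; ring
  · intro m l
    have hw : ∀ x : Fin k → ℝ, hdet x * hdet x = hcst k * hcst k * (VV x * VV x) := fun x => by rw [hdet_eq]; ring
    have hIntg : ∀ l : List ℕ, Integrable (fun x : Fin k → ℝ => (l.map (qs x)).prod * (hdet x * hdet x)) (gp (Fin k)) := fun l =>
      ((EB.listProd _ qs_EB l).mul (hdet_EB.mul hdet_EB)).intp
    have key : ∫ x : Fin k → ℝ, (((m + 1) :: l).map (qs x)).prod * (hdet x * hdet x) ∂(gp (Fin k)) =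
        ∑ a ∈ Finset.range m, ∫ x : Fin k → ℝ, ((a :: (m - 1 - a) :: l).map (qs x)).prod * (hdet x * hdet x) ∂(gp (Fin k))
        + ∫ x : Fin k → ℝ, LTq (qs x) m l * (hdet x * hdet x) ∂(gp (Fin k)) := by
      have hdqE : ∀ (j : Fin k) n, EB (fun x : Fin k → ℝ => dq j x n) := fun j n => (EB.const _).mul ((EB.coord j).ofReal.pow _)
      let f : Fin k → (Fin k → ℝ) → ℂ := fun j x => (x j : ℂ) ^ m * (l.map (qs x)).prod * (VV x * VV x)
      let f' : Fin k → (Fin k → ℝ) → ℂ := fun j x => (m * (x j : ℂ) ^ (m - 1) * (l.map (qs x)).prod + (x j : ℂ) ^ m * dPr (qs x) (dq j x) l) * (VV x * VV x)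
        + (x j : ℂ) ^ m * (l.map (qs x)).prod * (dVV j x * VV x + VV x * dVV j x)
      have hf : ∀ j, EB (f j) := fun j => (((EB.coord j).ofReal.pow m).mul (EB.listProd _ qs_EB l)).mul (VV_EB.mul VV_EB)
      have hf' : ∀ j, EB (f' j) := fun j => ((((((EB.const _).mul ((EB.coord j).ofReal.pow _)).mul (EB.listProd _ qs_EB l))).add
          (((EB.coord j).ofReal.pow m).mul (EB.dPr _ _ qs_EB (hdqE j) l))).mul (VV_EB.mul VV_EB)).add
          ((((EB.coord j).ofReal.pow m).mul (EB.listProd _ qs_EB l)).mul (((dVV_EB j).mul VV_EB).add (VV_EB.mul (dVV_EB j))))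
      have ibp : ∀ j, ∫ x, (x j : ℂ) * f j x ∂(gp (Fin k)) = ∫ x, f' j x ∂(gp (Fin k)) := by
        intro j
        refine gauss_ibp j (f j) (f' j) (hf j) (hf' j) fun x => ?_
        have h1 := (coord_deriv j j x).pow m
        have h2 := dPr_deriv (fun y => qs (Function.update x j y)) (dq j x) (x j) (fun n => qs_deriv j x n) l
        have h3 := (h1.mul h2).mul ((VV_deriv j x).mul (VV_deriv j x))
        refine h3.congr_deriv ?_
        simp [f']
      have hs : ∫ x, ∑ j, (x j : ℂ) * f j x ∂(gp (Fin k)) = ∫ x, ∑ j, f' j x ∂(gp (Fin k)) := by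
        rw [integral_finsetSum _ fun j _ => ((EB.coord j).ofReal.mul (hf j)).intp, integral_finsetSum _ fun j _ => (hf' j).intp]
        exact Finset.sum_congr rfl fun j _ => ibp j
      have hL : ∀ x : Fin k → ℝ, (((m + 1) :: l).map (qs x)).prod * (hdet x * hdet x) = hcst k * hcst k * ∑ j, (x j : ℂ) * f j x := by
        intro x
        rw [hw, List.map_cons, List.prod_cons, qs, Finset.sum_mul, Finset.sum_mul, Finset.mul_sum]
        refine Finset.sum_congr rfl fun j _ => ?_
        simp only [f, pow_succ]; ring
      have hR : ∀ x : Fin k → ℝ, hcst k * hcst k * ∑ j, f' j x = ∑ a ∈ Finset.range m, ((a :: (m - 1 - a) :: l).map (qs x)).prod * (hdet x * hdet x)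
          + LTq (qs x) m l * (hdet x * hdet x) := by
        intro x
        have c1 := dPr_contract Finset.univ (qs x) (fun j => dq j x) (fun j => (x j : ℂ) ^ m) m (fun c => by
          rcases c with _ | c
          · simp [dq]
          · unfold dq qs
            rw [Finset.mul_sum]
            refine Finset.sum_congr rfl fun j _ => ?_
            rw [show m + (c + 1) - 1 = m + c by omega, add_tsub_cancel_right, pow_add]; ring) l
        have c2 := VV_euler m x
        have e : ∑ j, f' j x = (m * qs x (m - 1) * (l.map (qs x)).prod + ∑ j, (x j : ℂ) ^ m * dPr (qs x) (dq j x) l) * (VV x * VV x)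
          + (l.map (qs x)).prod * VV x * ∑ j, (x j : ℂ) ^ m * (2 * dVV j x) := by
          simp only [f', qs]
          simp only [Finset.sum_add_distrib, Finset.mul_sum, Finset.sum_mul, add_mul]
          congr 1
          refine Finset.sum_congr rfl fun j _ => by ring
        rw [e, c1, c2, hw]
        have e3 : ∑ a ∈ Finset.range m, ((a :: (m - 1 - a) :: l).map (qs x)).prod * (hcst k * hcst k * (VV x * VV x))
          = (∑ a ∈ Finset.range m, qs x a * qs x (m - 1 - a)) * ((l.map (qs x)).prod * (hcst k * hcst k * (VV x * VV x))) := by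
          rw [Finset.sum_mul]; refine Finset.sum_congr rfl fun a _ => ?_
          simp only [List.map_cons, List.prod_cons]; ring
        rw [e3]; ring
      simp_rw [hL]
      rw [integral_const_mul, hs, ← integral_const_mul]
      simp_rw [hR]
      rw [integral_add, integral_finsetSum _ fun a _ => hIntg _]
      · exact (integrable_finsetSum _ fun a _ => hIntg _)
      · exact ((EB.LTq _ qs_EB m l).mul (hdet_EB.mul hdet_EB)).intp
    unfold VM VE
    rw [key, integral_LTq (gp (Fin k)) qs (fun x => hdet x * hdet x) hIntg, mul_add, Finset.mul_sum]
    congr 1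
    rw [← List.sum_map_mul_left]
    congr 1; apply List.map_congr_left; intro t _; ring

end vloop

-- Part PD2
section gue
variable {k : ℕ}

/-- index set of the real coordinates of a complex matrix -/
abbrev IX (k : ℕ) := Fin k × Fin k × Bool

noncomputable def TT (x : IX k → ℝ) : Matrix (Fin k) (Fin k) ℂ :=
  Matrix.of fun i j => (1/2 : ℂ) * (((x (i, j, false) : ℂ) + Complex.I * x (i, j, true)) + ((x (j, i, false) : ℂ) - Complex.I * x (j, i, true)))

lemma TT_apply (x : IX k → ℝ) (i j : Fin k) : TT x i j = (1/2 : ℂ) * (((x (i, j, false) : ℂ) + Complex.I * x (i, j, true)) + ((x (j, i, false) : ℂ) - Complex.I * x (j, i, true))) := rfl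

lemma TT_add (x y : IX k → ℝ) : TT (x + y) = TT x + TT y := by
  ext i j; simp only [TT_apply, Matrix.add_apply, Pi.add_apply]; push_cast; ring

lemma TT_smul (c : ℝ) (x : IX k → ℝ) : TT (c • x) = c • TT x := by
  ext i j; simp only [TT_apply, Matrix.smul_apply, Pi.smul_apply, smul_eq_mul, Complex.real_smul]; push_cast; ring

lemma TT_herm (x : IX k → ℝ) : (TT x).IsHermitian := by
  ext i j
  simp only [TT_apply, Matrix.conjTranspose_apply, Complex.star_def, map_mul, map_add, map_sub, Complex.conj_ofReal, Complex.conj_I, map_div₀, map_one, map_ofNat]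
  ring

lemma TT_EB (i j : Fin k) : EB (fun x : IX k → ℝ => TT x i j) := by
  simp only [TT_apply]
  exact (EB.const _).mul (((EB.coord _).ofReal.add ((EB.const _).mul (EB.coord _).ofReal)).add ((EB.coord _).ofReal.sub ((EB.const _).mul (EB.coord _).ofReal)))

lemma TT_single_false (p q : Fin k) : TT (Pi.single (p, q, false) 1) = (1/2 : ℂ) • (Matrix.single p q (1:ℂ) + Matrix.single q p 1) := by
  ext i j
  simp only [TT_apply, Matrix.smul_apply, Matrix.add_apply, Matrix.single_apply, Pi.single_apply, Prod.mk.injEq, smul_eq_mul]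
  by_cases h1 : i = p <;> by_cases h2 : j = q <;> by_cases h3 : j = p <;> by_cases h4 : i = q <;> simp [h1, h2, h3, h4, eq_comm] <;> simp_all [eq_comm]

lemma TT_single_true (p q : Fin k) : TT (Pi.single (p, q, true) 1) = (1/2 : ℂ) • (Complex.I • Matrix.single p q (1:ℂ) - Complex.I • Matrix.single q p 1) := by
  ext i j
  simp only [TT_apply, Matrix.smul_apply, Matrix.sub_apply, Matrix.single_apply, Pi.single_apply, Prod.mk.injEq, smul_eq_mul]
  by_cases h1 : i = p <;> by_cases h2 : j = q <;> by_cases h3 : j = p <;> by_cases h4 : i = q <;> simp [h1, h2, h3, h4, eq_comm] <;> simp_all [eq_comm]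

lemma gue_ibp (G : Matrix (Fin k) (Fin k) ℂ → ℂ) (DG : Matrix (Fin k) (Fin k) ℂ → Matrix (Fin k) (Fin k) ℂ → ℂ)
    (hadd : ∀ X A B, DG X (A + B) = DG X A + DG X B) (hsm : ∀ X (c : ℂ) A, DG X (c • A) = c * DG X A)
    (hd : ∀ X B, HasDerivAt (fun s : ℝ => G (X + s • B)) (DG X B) 0)
    (hG : EB (fun x : IX k → ℝ => G (TT x))) (hDG : ∀ B, EB (fun x : IX k → ℝ => DG (TT x) B)) (i j : Fin k) :
    ∫ x, TT x i j * G (TT x) ∂(gp (IX k)) = ∫ x, DG (TT x) (Matrix.single j i 1) ∂(gp (IX k)) := by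
  have h1 : ∀ p : IX k, ∫ x, (x p : ℂ) * G (TT x) ∂(gp (IX k)) = ∫ x, DG (TT x) (TT (Pi.single p 1)) ∂(gp (IX k)) := by
    intro p
    refine gauss_ibp p (fun x => G (TT x)) (fun x => DG (TT x) (TT (Pi.single p 1))) hG (hDG _) fun x => ?_
    have e : ∀ y : ℝ, TT (Function.update x p y) = TT x + (y - x p) • TT (Pi.single p 1) := by
      intro y
      rw [← TT_smul, ← TT_add]
      congr 1
      ext q
      by_cases h : q = p
      · subst h; simp
      · simp [h]
    simp_rw [e]
    have h0 := hd (TT x) (TT (Pi.single p 1))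
    have h2 : HasDerivAt (fun y : ℝ => y - x p) 1 (x p) := (hasDerivAt_id _).sub_const _
    have h3 := HasDerivAt.scomp (x p) (g₁ := fun s : ℝ => G (TT x + s • TT (Pi.single p 1))) (by simpa using h0) h2
    simpa [Function.comp_def] using h3
  have hi : ∀ p : IX k, Integrable (fun x : IX k → ℝ => (x p : ℂ) * G (TT x)) (gp (IX k)) := fun p => ((EB.coord p).ofReal.mul hG).intp
  have hL : ∀ x : IX k → ℝ, TT x i j * G (TT x) = (1/2 : ℂ) * (((x (i, j, false) : ℂ) * G (TT x) + Complex.I * (x (i, j, true) * G (TT x))) + ((x (j, i, false) : ℂ) * G (TT x) - Complex.I * (x (j, i, true) * G (TT x)))) := by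
    intro x; rw [TT_apply]; ring
  simp_rw [hL]
  have hI : ∀ p : IX k, Integrable (fun x : IX k → ℝ => Complex.I * ((x p : ℂ) * G (TT x))) (gp (IX k)) := fun p => (hi p).const_mul _
  have a1 : Integrable (fun x : IX k → ℝ => (x (i, j, false) : ℂ) * G (TT x) + Complex.I * (x (i, j, true) * G (TT x))) (gp (IX k)) := (hi _).add (hI _)
  have a2 : Integrable (fun x : IX k → ℝ => (x (j, i, false) : ℂ) * G (TT x) - Complex.I * (x (j, i, true) * G (TT x))) (gp (IX k)) := (hi _).sub (hI _)
  rw [integral_const_mul, integral_add a1 a2, integral_add (hi _) (hI _), integral_sub (hi _) (hI _), integral_const_mul, integral_const_mul, h1, h1, h1, h1]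
  have hneg : ∀ X A B, DG X (A - B) = DG X A - DG X B := by
    intro X A B
    rw [sub_eq_add_neg, hadd, ← neg_one_smul ℂ, hsm]; ring
  simp only [TT_single_false, TT_single_true, hsm, hadd, hneg]
  have i1 : ∀ B, Integrable (fun x : IX k → ℝ => DG (TT x) B) (gp (IX k)) := fun B => (hDG B).intp
  set A := Matrix.single i j (1:ℂ)
  set B := Matrix.single j i (1:ℂ)
  have i2 : ∀ B, Integrable (fun x : IX k → ℝ => Complex.I * DG (TT x) B) (gp (IX k)) := fun B => (i1 B).const_mul _
  simp only [integral_const_mul]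
  rw [integral_add (i1 _) (i1 _), integral_add (i1 _) (i1 _), integral_sub (i2 _) (i2 _), integral_sub (i2 _) (i2 _)]
  simp only [integral_const_mul]
  linear_combination (1/2 * (∫ x, DG (TT x) A ∂(gp (IX k))) - 1/2 * (∫ x, DG (TT x) B ∂(gp (IX k)))) * Complex.I_sq

/-- derivative of a matrix power -/
noncomputable def dpow (X B : Matrix (Fin k) (Fin k) ℂ) : ℕ → Matrix (Fin k) (Fin k) ℂ
  | 0 => 0
  | m + 1 => dpow X B m * X + X ^ m * B

lemma dpow_eq (X B : Matrix (Fin k) (Fin k) ℂ) (m : ℕ) : dpow X B m = ∑ a ∈ Finset.range m, X ^ a * B * X ^ (m - 1 - a) := by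
  induction m with
  | zero => simp [dpow]
  | succ m ih =>
    rw [dpow, ih, Finset.sum_range_succ, Finset.sum_mul]
    congr 1
    · refine Finset.sum_congr rfl fun a ha => ?_
      rw [Finset.mem_range] at ha
      rw [mul_assoc _ _ X, ← pow_succ]; congr 2; omega
    · simp

lemma dpow_trace (X B : Matrix (Fin k) (Fin k) ℂ) (m : ℕ) : (dpow X B m).trace = m * (X ^ (m - 1) * B).trace := by
  rw [dpow_eq, Matrix.trace_sum, Finset.sum_congr rfl (g := fun _ => (X ^ (m - 1) * B).trace)]
  · simp
  · intro a ha
    rw [Finset.mem_range] at ha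
    rw [Matrix.trace_mul_comm, ← mul_assoc, ← pow_add]; congr 3; omega

lemma dpow_deriv (X B : Matrix (Fin k) (Fin k) ℂ) (m : ℕ) (i j : Fin k) : HasDerivAt (fun s : ℝ => ((X + s • B) ^ m) i j) (dpow X B m i j) 0 := by
  induction m generalizing i j with
  | zero => simpa [dpow] using hasDerivAt_const (0:ℝ) ((1 : Matrix (Fin k) (Fin k) ℂ) i j)
  | succ m ih =>
    simp only [pow_succ, Matrix.mul_apply]
    have h0 : ∀ a b, HasDerivAt (fun s : ℝ => (X + s • B) a b) (B a b) 0 := by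
      intro a b
      simp only [Matrix.add_apply, Matrix.smul_apply]
      have := ((hasDerivAt_id (0:ℝ)).smul_const (B a b)).const_add (X a b)
      simpa using this
    have := HasDerivAt.fun_sum (u := Finset.univ) fun a (_ : a ∈ Finset.univ) => (ih i a).mul (h0 a j)
    refine this.congr_deriv ?_
    simp [dpow, Matrix.add_apply, Matrix.mul_apply, Finset.sum_add_distrib]

lemma dpow_add (X A B : Matrix (Fin k) (Fin k) ℂ) (m : ℕ) : dpow X (A + B) m = dpow X A m + dpow X B m := by
  simp [dpow_eq, mul_add, add_mul, Finset.sum_add_distrib]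

lemma dpow_smul (X A : Matrix (Fin k) (Fin k) ℂ) (c : ℂ) (m : ℕ) : dpow X (c • A) m = c • dpow X A m := by
  simp [dpow_eq, Finset.smul_sum]

lemma TTpow_EB (m : ℕ) (i j : Fin k) : EB (fun x : IX k → ℝ => (TT x ^ m) i j) := by
  induction m generalizing i j with
  | zero => simpa using EB.const ((1 : Matrix (Fin k) (Fin k) ℂ) i j)
  | succ m ih => simp only [pow_succ, Matrix.mul_apply]; exact EB.sum _ fun a _ => (ih i a).mul (TT_EB a j)

lemma EBm_mul {A B : (IX k → ℝ) → Matrix (Fin k) (Fin k) ℂ} (hA : ∀ i j, EB (fun x => A x i j)) (hB : ∀ i j, EB (fun x => B x i j)) (i j : Fin k) :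
    EB (fun x => (A x * B x) i j) := by
  simp only [Matrix.mul_apply]; exact EB.sum _ fun a _ => (hA i a).mul (hB a j)

lemma dpow_EB (B : Matrix (Fin k) (Fin k) ℂ) (m : ℕ) (i j : Fin k) : EB (fun x : IX k → ℝ => dpow (TT x) B m i j) := by
  induction m generalizing i j with
  | zero => simpa [dpow] using EB.const (0:ℂ)
  | succ m ih =>
    simp only [dpow, Matrix.add_apply]
    exact (EBm_mul ih TT_EB i j).add (EBm_mul (TTpow_EB m) (B := fun _ => B) (fun _ _ => EB.const _) i j)

noncomputable def qm (X : Matrix (Fin k) (Fin k) ℂ) (c : ℕ) : ℂ := (X ^ c).trace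

lemma qm_EB (c : ℕ) : EB (fun x : IX k → ℝ => qm (TT x) c) := by
  simp only [qm, Matrix.trace, Matrix.diag_apply]; exact EB.sum _ fun a _ => TTpow_EB c a a

lemma qm_deriv (X B : Matrix (Fin k) (Fin k) ℂ) (c : ℕ) : HasDerivAt (fun s : ℝ => qm (X + s • B) c) (dpow X B c).trace 0 := by
  simp only [qm, Matrix.trace, Matrix.diag_apply]
  exact HasDerivAt.fun_sum (u := Finset.univ) fun a _ => dpow_deriv X B c a a

lemma dPr_add (q d e : ℕ → ℂ) (l : List ℕ) : dPr q (fun c => d c + e c) l = dPr q d l + dPr q e l := by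
  induction l with
  | nil => simp [dPr]
  | cons c l ih => simp only [dPr, ih]; ring

lemma dPr_smul (q d : ℕ → ℂ) (a : ℂ) (l : List ℕ) : dPr q (fun c => a * d c) l = a * dPr q d l := by
  induction l with
  | nil => simp [dPr]
  | cons c l ih => simp only [dPr, ih]; ring

noncomputable def GM (k : ℕ) (l : List ℕ) : ℂ := ∫ x : IX k → ℝ, (l.map (qm (TT x))).prod ∂(gp (IX k))

lemma GM_loop (k : ℕ) : LoopEq k (GM k) := by
  constructor
  · simp [GM]
  · intro l
    unfold GM
    simp only [List.map_cons, List.prod_cons, qm, pow_zero, Matrix.trace_one, Fintype.card_fin]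
    rw [integral_const_mul]
  · intro m l
    have hIntg : ∀ l : List ℕ, Integrable (fun x : IX k → ℝ => (l.map (qm (TT x))).prod * 1) (gp (IX k)) := fun l => by
      simpa using (EB.listProd _ qm_EB l).intp
    let DG : Fin k → Fin k → Matrix (Fin k) (Fin k) ℂ → Matrix (Fin k) (Fin k) ℂ → ℂ := fun i j X B =>
      dpow X B m j i * (l.map (qm X)).prod + (X ^ m) j i * dPr (qm X) (fun c => (dpow X B c).trace) l
    have hDG : ∀ i j B, EB (fun x : IX k → ℝ => DG i j (TT x) B) := fun i j B =>
      ((dpow_EB B m j i).mul (EB.listProd _ qm_EB l)).add ((TTpow_EB m j i).mul (EB.dPr _ _ qm_EB (fun c => by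
        simp only [Matrix.trace, Matrix.diag_apply]; exact EB.sum _ fun a _ => dpow_EB B c a a) l))
    have hG : ∀ i j, EB (fun x : IX k → ℝ => (TT x ^ m) j i * (l.map (qm (TT x))).prod) := fun i j => (TTpow_EB m j i).mul (EB.listProd _ qm_EB l)
    have ibp : ∀ i j, ∫ x, TT x i j * ((TT x ^ m) j i * (l.map (qm (TT x))).prod) ∂(gp (IX k)) = ∫ x, DG i j (TT x) (Matrix.single j i 1) ∂(gp (IX k)) := by
      intro i j
      refine gue_ibp (fun X => (X ^ m) j i * (l.map (qm X)).prod) (DG i j) ?_ ?_ ?_ (hG i j) (hDG i j) i j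
      · intro X A B
        simp only [DG, dpow_add, Matrix.trace_add, dPr_add, Matrix.add_apply]; ring
      · intro X c A
        simp only [DG, dpow_smul, Matrix.trace_smul, smul_eq_mul, dPr_smul, Matrix.smul_apply]; ring
      · intro X B
        have := (dpow_deriv X B m j i).mul (dPr_deriv (fun s : ℝ => qm (X + s • B)) (fun c => (dpow X B c).trace) 0 (fun c => qm_deriv X B c) l)
        refine this.congr_deriv ?_
        simp [DG]
    have hL : ∀ x : IX k → ℝ, (((m + 1) :: l).map (qm (TT x))).prod = ∑ i, ∑ j, TT x i j * ((TT x ^ m) j i * (l.map (qm (TT x))).prod) := by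
      intro x
      rw [List.map_cons, List.prod_cons, qm, pow_succ', Matrix.trace, Finset.sum_mul]
      refine Finset.sum_congr rfl fun i _ => ?_
      rw [Matrix.diag_apply, Matrix.mul_apply, Finset.sum_mul]
      refine Finset.sum_congr rfl fun j _ => by ring
    have hR : ∀ X : Matrix (Fin k) (Fin k) ℂ, ∑ i, ∑ j, DG i j X (Matrix.single j i 1) = ∑ a ∈ Finset.range m, ((a :: (m - 1 - a) :: l).map (qm X)).prod * 1
        + LTq (qm X) m l * 1 := by
      intro X
      simp only [DG, Finset.sum_add_distrib]
      congr 1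
      · simp only [dpow_eq, Matrix.sum_apply, Finset.sum_mul]
        have : ∀ a (i j : Fin k), (X ^ a * Matrix.single j i (1:ℂ) * X ^ (m - 1 - a)) j i = (X ^ a) j j * (X ^ (m - 1 - a)) i i := by
          intro a i j
          simp [Matrix.mul_apply, Matrix.single_apply, ite_and, Finset.sum_ite_eq]
        simp only [this]
        have e : ∀ i : Fin k, ∑ j, ∑ a ∈ Finset.range m, (X ^ a) j j * (X ^ (m - 1 - a)) i i * (l.map (qm X)).prod = ∑ a ∈ Finset.range m, ∑ j, (X ^ a) j j * (X ^ (m - 1 - a)) i i * (l.map (qm X)).prod := fun i => Finset.sum_comm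
        simp_rw [e]
        rw [Finset.sum_comm]
        refine Finset.sum_congr rfl fun a _ => ?_
        simp only [List.map_cons, List.prod_cons, qm, Matrix.trace, Matrix.diag_apply, mul_one]
        rw [← mul_assoc, Finset.sum_mul_sum, Finset.sum_comm]
        simp only [Finset.sum_mul]
      · rw [mul_one]
        rw [← dPr_contract (Finset.univ : Finset (Fin k × Fin k)) (qm X) (fun p c => (dpow X (Matrix.single p.2 p.1 1) c).trace) (fun p => (X ^ m) p.2 p.1) m ?_ l]
        · rw [← Finset.univ_product_univ, Finset.sum_product]
        · intro c
          simp only [dpow_trace]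
          rcases c with _ | c
          · simp
          · rw [← Finset.univ_product_univ, Finset.sum_product, Finset.sum_comm]
            rw [show m + (c + 1) - 1 = m + c by omega, add_tsub_cancel_right, qm, pow_add, Matrix.trace, Finset.mul_sum]
            refine Finset.sum_congr rfl fun j _ => ?_
            rw [Matrix.diag_apply, Matrix.mul_apply, Finset.mul_sum]
            refine Finset.sum_congr rfl fun i _ => ?_
            have : (X ^ c * Matrix.single j i (1:ℂ)).trace = (X ^ c) i j := by
              simp [Matrix.trace, Matrix.mul_apply, Matrix.single_apply, ite_and, Finset.sum_ite_eq]
            rw [this]; ring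
    unfold GM
    simp_rw [hL]
    have iL : ∀ i j, Integrable (fun x : IX k → ℝ => TT x i j * ((TT x ^ m) j i * (l.map (qm (TT x))).prod)) (gp (IX k)) := fun i j => ((TT_EB i j).mul (hG i j)).intp
    have iR : ∀ i j, Integrable (fun x : IX k → ℝ => DG i j (TT x) (Matrix.single j i 1)) (gp (IX k)) := fun i j => (hDG i j _).intp
    have key : ∫ x, ∑ i, ∑ j, TT x i j * ((TT x ^ m) j i * (l.map (qm (TT x))).prod) ∂(gp (IX k)) = ∫ x, ∑ i, ∑ j, DG i j (TT x) (Matrix.single j i 1) ∂(gp (IX k)) := by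
      rw [integral_finsetSum _ fun i _ => integrable_finsetSum _ fun j _ => iL i j, integral_finsetSum _ fun i _ => integrable_finsetSum _ fun j _ => iR i j]
      refine Finset.sum_congr rfl fun i _ => ?_
      rw [integral_finsetSum _ fun j _ => iL i j, integral_finsetSum _ fun j _ => iR i j]
      exact Finset.sum_congr rfl fun j _ => ibp i j
    rw [key]
    simp_rw [hR]
    have j1 : Integrable (fun x : IX k → ℝ => ∑ a ∈ Finset.range m, ((a :: (m - 1 - a) :: l).map (qm (TT x))).prod * 1) (gp (IX k)) := integrable_finsetSum _ fun a _ => hIntg _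
    have j2 : Integrable (fun x : IX k → ℝ => LTq (qm (TT x)) m l * 1) (gp (IX k)) := by simpa using (EB.LTq _ qm_EB m l).intp
    rw [integral_add j1 j2, integral_finsetSum _ fun a _ => hIntg _, integral_LTq (gp (IX k)) (fun x => qm (TT x)) (fun _ => 1) hIntg]
    simp only [mul_one]

lemma GM_eq_VM (k : ℕ) (l : List ℕ) : GM k l = VM k l := (GM_loop k).unique (VM_loop k) l

end gue

-- Part PD3
section chars
variable {k : ℕ}

noncomputable def pw (v : Fin k → ℝ) (n : ℕ) : ℂ := ∑ a, (v a : ℂ) ^ n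

lemma pw_series (v : Fin k → ℝ) (t : ℝ) : HasSum (fun n : ℕ => (Complex.I * t) ^ n / (n.factorial : ℂ) * pw v n) (∑ a, ex t (v a)) := by
  have h : ∀ a ∈ (Finset.univ : Finset (Fin k)), HasSum (fun n : ℕ => (Complex.I * t) ^ n / (n.factorial : ℂ) * (v a : ℂ) ^ n) (ex t (v a)) := by
    intro a _
    have := NormedSpace.expSeries_div_hasSum_exp (𝔸 := ℂ) (Complex.I * (t * v a : ℝ))
    rw [← Complex.exp_eq_exp_ℂ] at this
    refine this.congr_fun ?_
    intro n; push_cast; rw [← mul_assoc, mul_pow]; ring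
  have := hasSum_sum h
  refine this.congr_fun ?_
  intro n; rw [pw, Finset.mul_sum]

lemma pw_norm (v : Fin k → ℝ) (B : ℝ) (h : ∀ a, |v a| ≤ B) (n : ℕ) : ‖pw v n‖ ≤ k * B ^ n := by
  unfold pw
  refine (norm_sum_le _ _).trans ?_
  refine (Finset.sum_le_card_nsmul _ _ (B ^ n) fun a _ => ?_).trans (by simp)
  rw [norm_pow, Complex.norm_real, Real.norm_eq_abs]
  exact pow_le_pow_left₀ (abs_nonneg _) (h a) n

lemma expB_series (c B : ℝ) : HasSum (fun n : ℕ => c ^ n / (n.factorial : ℝ) * (k * B ^ n)) (k * Real.exp (c * B)) := by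
  have := (NormedSpace.expSeries_div_hasSum_exp (𝔸 := ℝ) (c * B)).mul_left (k:ℝ)
  rw [← Real.exp_eq_exp_ℝ] at this
  refine this.congr_fun ?_
  intro n; rw [mul_pow]; ring

lemma hs_mul (f g : ℕ → ℂ) (s t : ℂ) (hf : HasSum f s) (hg : HasSum g t) (hfg : Summable fun x : ℕ × ℕ => f x.1 * g x.2) :
    HasSum (fun x : ℕ × ℕ => f x.1 * g x.2) (s * t) := HasSum.mul hf hg hfg

/-- characters are determined by moments -/
lemma char_series {α : Type*} [MeasurableSpace α] (μ : Measure α) (w : α → ℂ) (lam : α → Fin k → ℝ) (B : α → ℝ)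
    (hB : ∀ x a, |lam x a| ≤ B x) (hB0 : ∀ x, 0 ≤ B x) (hw : AEStronglyMeasurable w μ)
    (hp : ∀ n, AEStronglyMeasurable (fun x => pw (lam x) n) μ) (hIntg : ∀ c : ℝ, Integrable (fun x => Real.exp (c * B x) * ‖w x‖) μ) (t u : ℝ) :
    HasSum (fun q : ℕ × ℕ => (Complex.I * t) ^ q.1 / (q.1.factorial : ℂ) * ((Complex.I * u) ^ q.2 / (q.2.factorial : ℂ)) * ∫ x, pw (lam x) q.1 * pw (lam x) q.2 * w x ∂μ)
      (∫ x, (∑ a, ex t (lam x a)) * (∑ a, ex u (lam x a)) * w x ∂μ) := by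
  have hsb : ∀ x, HasSum (fun q : ℕ × ℕ => (|t| ^ q.1 / (q.1.factorial : ℝ) * (k * B x ^ q.1)) * (|u| ^ q.2 / (q.2.factorial : ℝ) * (k * B x ^ q.2)))
      ((k * Real.exp (|t| * B x)) * (k * Real.exp (|u| * B x))) := fun x =>
    (expB_series |t| (B x)).mul (expB_series |u| (B x)) ((expB_series |t| (B x)).summable.mul_of_nonneg (expB_series |u| (B x)).summable
      (fun n => by have := hB0 x; simp only [Pi.zero_apply]; positivity) (fun n => by have := hB0 x; simp only [Pi.zero_apply]; positivity))
  have hn : ∀ (t : ℝ) x n, ‖(Complex.I * t) ^ n / (n.factorial : ℂ) * pw (lam x) n‖ ≤ |t| ^ n / (n.factorial : ℝ) * (k * B x ^ n) := by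
    intro t x n
    rw [norm_mul, norm_div, norm_pow, norm_mul, Complex.norm_I, one_mul, Complex.norm_real, Real.norm_eq_abs, Complex.norm_natCast]
    gcongr
    exact pw_norm _ _ (hB x) n
  have hsm : ∀ x, Summable (fun q : ℕ × ℕ => ((Complex.I * t) ^ q.1 / (q.1.factorial : ℂ) * pw (lam x) q.1) * ((Complex.I * u) ^ q.2 / (q.2.factorial : ℂ) * pw (lam x) q.2)) := by
    intro x
    refine Summable.of_norm_bounded (hsb x).summable fun q => ?_
    rw [norm_mul]
    have := hB0 x
    gcongr
    · exact hn t x q.1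
    · exact hn u x q.2
  have hpq : ∀ x, HasSum (fun q : ℕ × ℕ => ((Complex.I * t) ^ q.1 / (q.1.factorial : ℂ) * pw (lam x) q.1) * ((Complex.I * u) ^ q.2 / (q.2.factorial : ℂ) * pw (lam x) q.2)) ((∑ a, ex t (lam x a)) * (∑ a, ex u (lam x a))) := by
    intro x
    exact hs_mul (fun n : ℕ => (Complex.I * t) ^ n / (n.factorial : ℂ) * pw (lam x) n) (fun n : ℕ => (Complex.I * u) ^ n / (n.factorial : ℂ) * pw (lam x) n) _ _ (pw_series (lam x) t) (pw_series (lam x) u) (hsm x)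
  have key := hasSum_integral_of_dominated_convergence (μ := μ)
    (F := fun (q : ℕ × ℕ) x => (((Complex.I * t) ^ q.1 / (q.1.factorial : ℂ) * pw (lam x) q.1) * ((Complex.I * u) ^ q.2 / (q.2.factorial : ℂ) * pw (lam x) q.2)) * w x)
    (f := fun x => (∑ a, ex t (lam x a)) * (∑ a, ex u (lam x a)) * w x)
    (fun q x => ((|t| ^ q.1 / (q.1.factorial : ℝ) * (k * B x ^ q.1)) * (|u| ^ q.2 / (q.2.factorial : ℝ) * (k * B x ^ q.2))) * ‖w x‖)
    (fun q => ((((hp q.1).const_mul _)).mul ((hp q.2).const_mul _)).mul hw)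
    (fun q => ae_of_all _ fun x => by
      rw [norm_mul, norm_mul]
      have := hB0 x
      gcongr
      · exact hn t x q.1
      · exact hn u x q.2)
    (ae_of_all _ fun x => ((hsb x).mul_right _).summable)
    (by
      have : (fun x => ∑' q : ℕ × ℕ, ((|t| ^ q.1 / (q.1.factorial : ℝ) * (k * B x ^ q.1)) * (|u| ^ q.2 / (q.2.factorial : ℝ) * (k * B x ^ q.2))) * ‖w x‖)
        = fun x => (k * k : ℝ) * (Real.exp ((|t| + |u|) * B x) * ‖w x‖) := by
        funext x
        rw [((hsb x).mul_right _).tsum_eq, add_mul, Real.exp_add]; ring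
      rw [this]
      exact (hIntg _).const_mul _)
    (ae_of_all _ fun x => by
      exact (hpq x).mul_right (w x))
  refine key.congr_fun ?_
  intro q
  rw [← integral_const_mul]
  congr 1; funext x; ring

lemma tr_pow_eig {A : Matrix (Fin k) (Fin k) ℂ} (hA : A.IsHermitian) (n : ℕ) : (A ^ n).trace = pw hA.eigenvalues n := by
  set U := (hA.eigenvectorUnitary : Matrix (Fin k) (Fin k) ℂ) with hUd
  have hU1 : Uᴴ * U = 1 := Matrix.mem_unitaryGroup_iff'.1 hA.eigenvectorUnitary.2
  set D := diagonal (fun i => (hA.eigenvalues i : ℂ)) with hD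
  have h : ∀ n, (U * D * Uᴴ) ^ n * U = U * D ^ n := by
    intro n
    induction n with
    | zero => simp
    | succ n ih =>
      rw [pow_succ', mul_assoc, ih, pow_succ']
      simp only [mul_assoc]
      rw [← mul_assoc Uᴴ, hU1, one_mul]
  have h2 : A ^ n = U * D ^ n * Uᴴ := by
    have hU2 : U * Uᴴ = 1 := Matrix.mem_unitaryGroup_iff.1 hA.eigenvectorUnitary.2
    rw [← h n, mul_assoc, hU2, mul_one, ← spectral_decomp hA]
  rw [h2, Matrix.trace_mul_comm, ← mul_assoc, hU1, one_mul, hD, Matrix.diagonal_pow, Matrix.trace_diagonal]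
  simp [pw]

lemma eig_le_fro {A : Matrix (Fin k) (Fin k) ℂ} (hA : A.IsHermitian) (a : Fin k) : |hA.eigenvalues a| ≤ fro A := by
  apply abs_le_of_sq_le_sq _ (fro_nonneg A)
  rw [fro_sq_eig hA]
  exact Finset.single_le_sum (f := fun i => hA.eigenvalues i ^ 2) (fun i _ => sq_nonneg _) (Finset.mem_univ a)

lemma fro_le_of_entry {A : Matrix (Fin k) (Fin k) ℂ} (b : ℝ) (hb : 0 ≤ b) (h : ∀ i j, ‖A i j‖ ≤ b) : fro A ≤ k * b := by
  refine (sq_le_sq₀ (fro_nonneg A) (by positivity)).1 ?_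
  rw [fro_sq]
  calc _ ≤ ∑ i : Fin k, ∑ j : Fin k, b ^ 2 := Finset.sum_le_sum fun i _ => Finset.sum_le_sum fun j _ => pow_le_pow_left₀ (norm_nonneg _) (h i j) 2
    _ = _ := by simp; ring

lemma TT_entry_le (x : IX k → ℝ) (i j : Fin k) : ‖TT x i j‖ ≤ 2 * ‖x‖ := by
  have h : ∀ p, ‖(x p : ℂ)‖ ≤ ‖x‖ := fun p => by rw [Complex.norm_real]; exact norm_le_pi_norm x p
  rw [TT_apply, norm_mul]
  have h1 : ‖((x (i, j, false) : ℂ) + Complex.I * x (i, j, true)) + ((x (j, i, false) : ℂ) - Complex.I * x (j, i, true))‖ ≤ ‖x‖ + ‖x‖ + (‖x‖ + ‖x‖) := by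
    refine (norm_add_le _ _).trans (add_le_add ((norm_add_le _ _).trans (add_le_add (h _) ?_)) ((norm_sub_le _ _).trans (add_le_add (h _) ?_)))
    · rw [norm_mul, Complex.norm_I, one_mul]; exact h _
    · rw [norm_mul, Complex.norm_I, one_mul]; exact h _
  norm_num
  linarith

lemma TT_fro_le (x : IX k → ℝ) : fro (TT x) ≤ 2 * k * ‖x‖ := by
  have := fro_le_of_entry (A := TT x) (2 * ‖x‖) (by positivity) (TT_entry_le x)
  linarith

lemma rTT_herm (r : ℝ) (x : IX k → ℝ) : (r • TT x).IsHermitian := by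
  rw [← TT_smul]; exact TT_herm _

/-- eigenvalues of the scaled GUE -/
noncomputable def ge (r : ℝ) (x : IX k → ℝ) : Fin k → ℝ := (rTT_herm r x).eigenvalues

lemma pw_ge (r : ℝ) (x : IX k → ℝ) (n : ℕ) : pw (ge r x) n = (r : ℂ) ^ n * qm (TT x) n := by
  unfold ge
  rw [← tr_pow_eig]
  have : r • TT x = (r : ℂ) • TT x := by ext i j; simp
  rw [this, smul_pow, Matrix.trace_smul, qm, smul_eq_mul]

lemma pw_sm (r : ℝ) (x : Fin k → ℝ) (n : ℕ) : pw (fun a => r * x a) n = (r : ℂ) ^ n * qs x n := by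
  simp [pw, qs, Finset.mul_sum, mul_pow]

lemma ge_le (r : ℝ) (x : IX k → ℝ) (a : Fin k) : |ge r x a| ≤ |r| * (2 * k * ‖x‖) := by
  refine (eig_le_fro _ a).trans ?_
  rw [fro_rsmul]
  exact mul_le_mul_of_nonneg_left (TT_fro_le x) (abs_nonneg _)

lemma EB.expn {X : Type*} [NormedAddCommGroup X] (c : ℝ) (hc : 0 ≤ c) : EB (fun x : X => Real.exp (c * ‖x‖)) :=
  ⟨by fun_prop, 1, c, by norm_num, hc, fun x => by simp [abs_of_pos (Real.exp_pos _)]⟩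

lemma gue_meas (r : ℝ) (n : ℕ) : AEStronglyMeasurable (fun x : IX k → ℝ => pw (ge r x) n) (gp (IX k)) := by
  simp_rw [pw_ge]
  exact ((EB.const _).mul (qm_EB n)).cont.aestronglyMeasurable

lemma gue_char_meas (r t : ℝ) : AEStronglyMeasurable (fun x : IX k → ℝ => ∑ a, ex t (ge r x a)) (gp (IX k)) := by
  have h := fun x : IX k → ℝ => (pw_series (ge r x) t).tendsto_sum_nat
  refine aestronglyMeasurable_of_tendsto_ae atTop (f := fun N (x : IX k → ℝ) => ∑ n ∈ Finset.range N, (Complex.I * t) ^ n / (n.factorial : ℂ) * pw (ge r x) n) ?_ (ae_of_all _ h)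
  intro N
  exact Finset.aestronglyMeasurable_fun_sum _ fun n _ => (gue_meas r n).const_mul _

lemma gue_char2 (r t u : ℝ) : ∫ x : IX k → ℝ, (∑ a, ex t (ge r x a)) * (∑ a, ex u (ge r x a)) ∂(gp (IX k))
    = VE (k := k) fun x => (∑ a, ex (t * r) (x a)) * (∑ a, ex (u * r) (x a)) := by
  have h1 := char_series (gp (IX k)) (fun _ => 1) (ge r) (fun x => |r| * (2 * k * ‖x‖)) (ge_le r) (fun x => by positivity) aestronglyMeasurable_const
    (gue_meas r) (fun c => by
      have : EB (fun x : IX k → ℝ => Real.exp ((|c| * |r| * (2 * k)) * ‖x‖)) := EB.expn _ (by positivity)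
      refine (EB.of_le (by fun_prop) this fun x => ?_).intp
      simp only [norm_one, mul_one, Real.norm_eq_abs, Real.abs_exp]
      apply Real.exp_le_exp.2
      have : c * (|r| * (2 * k * ‖x‖)) ≤ |c| * (|r| * (2 * k * ‖x‖)) := by gcongr; exact le_abs_self c
      linarith) t u
  have hE : EB (fun x : Fin k → ℝ => ((k.factorial : ℂ))⁻¹ * (hdet x * hdet x)) := (EB.const _).mul (hdet_EB.mul hdet_EB)
  have h2 := char_series (gp (Fin k)) (fun x => ((k.factorial : ℂ))⁻¹ * (hdet x * hdet x)) (fun x a => r * x a) (fun x => |r| * ‖x‖)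
    (fun x a => by rw [abs_mul]; gcongr; exact norm_le_pi_norm x a) (fun x => by positivity) hE.cont.aestronglyMeasurable
    (fun n => by simp_rw [pw_sm]; exact ((EB.const _).mul (qs_EB n)).cont.aestronglyMeasurable)
    (fun c => by
      have : EB (fun x : Fin k → ℝ => Real.exp ((|c| * |r|) * ‖x‖)) := EB.expn _ (by positivity)
      refine ((EB.of_le (by fun_prop) this fun x => ?_).mul hE.norm').intp
      simp only [Real.norm_eq_abs, Real.abs_exp]
      apply Real.exp_le_exp.2
      have : c * (|r| * ‖x‖) ≤ |c| * (|r| * ‖x‖) := by gcongr; exact le_abs_self c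
      linarith) t u
  have e : ∀ n m : ℕ, ∫ x, pw (ge r x) n * pw (ge r x) m * 1 ∂(gp (IX k)) = ∫ x : Fin k → ℝ, pw (fun a => r * x a) n * pw (fun a => r * x a) m * (((k.factorial : ℂ))⁻¹ * (hdet x * hdet x)) ∂(gp (Fin k)) := by
    intro n m
    have := GM_eq_VM k [n, m]
    simp only [GM, VM, VE, List.map_cons, List.map_nil, List.prod_cons, List.prod_nil, mul_one] at this
    rw [← integral_const_mul] at this
    simp only [pw_ge, pw_sm]
    have l1 : ∀ x : IX k → ℝ, (r:ℂ) ^ n * qm (TT x) n * ((r:ℂ) ^ m * qm (TT x) m) * 1 = ((r:ℂ) ^ n * (r:ℂ) ^ m) * (qm (TT x) n * qm (TT x) m) := fun x => by ring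
    have l2 : ∀ x : Fin k → ℝ, (r:ℂ) ^ n * qs x n * ((r:ℂ) ^ m * qs x m) * (((k.factorial : ℂ))⁻¹ * (hdet x * hdet x)) = ((r:ℂ) ^ n * (r:ℂ) ^ m) * ((k.factorial : ℂ)⁻¹ * (qs x n * qs x m * (hdet x * hdet x))) := fun x => by ring
    simp_rw [l1, l2]
    rw [integral_const_mul, this, ← integral_const_mul]
  simp only [e] at h1
  have := h1.unique h2
  simp only [mul_one] at this
  rw [this, VE, ← integral_const_mul]
  congr 1; funext x
  have : ∀ (t : ℝ) (a : Fin k), ex t (r * x a) = ex (t * r) (x a) := fun t a => by unfold ex; rw [mul_assoc]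
  simp only [this]; ring

lemma gue_char1 (hk : k ≠ 0) (r t : ℝ) : ∫ x : IX k → ℝ, (∑ a, ex t (ge r x a)) ∂(gp (IX k)) = Sk k (t * r) := by
  have h := gue_char2 (k := k) r t 0
  have e0 : ∀ y, ex 0 y = 1 := fun y => by simp [ex]
  simp only [zero_mul, e0, Finset.sum_const, Finset.card_univ, Fintype.card_fin, nsmul_eq_mul, mul_one] at h
  rw [integral_mul_const] at h
  have h2 : VE (k := k) (fun x => (∑ a, ex (t * r) (x a)) * (k:ℂ)) = (Sk k (t * r)) * k := by
    rw [← VE_char, VE, VE, mul_assoc, ← integral_mul_const]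
    congr 2; funext x; ring
  rw [h2] at h
  exact mul_right_cancel₀ (by exact_mod_cast hk) h

lemma gue_charsq (r t : ℝ) : ∫ x : IX k → ℝ, ‖∑ a, ex t (ge r x a)‖ ^ 2 ∂(gp (IX k)) = vk k (t * r) + ‖Sk k (t * r)‖ ^ 2 := by
  have h := gue_char2 (k := k) r t (-t)
  rw [neg_mul, VE_char2] at h
  apply Complex.ofReal_injective
  rw [← h, ← integral_complex_ofReal]
  congr 1; funext x
  have : ∑ a, ex (-t) (ge r x a) = star (∑ a, ex t (ge r x a)) := by simp [ex_star]
  rw [this, Complex.star_def, Complex.mul_conj, Complex.normSq_eq_norm_sq]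

end chars

-- Part PD4
section guebound
variable {k : ℕ}

lemma Dm_neg (μ : Measure ℝ) (m : ℤ) : ‖Dm μ (-m)‖ = ‖Dm μ m‖ := by
  have h : ∀ ν : Measure ℝ, ∫ x : ℝ, Complex.exp (Complex.I * (om (-m) * x : ℝ)) ∂ν = (starRingEnd ℂ) (∫ x : ℝ, Complex.exp (Complex.I * (om m * x : ℝ)) ∂ν) := by
    intro ν
    rw [← integral_conj]
    congr 1; funext x
    rw [← Complex.exp_conj, map_mul, Complex.conj_I, Complex.conj_ofReal]
    congr 1
    have : om (-m) = - om m := by unfold om; push_cast; ring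
    rw [this]; push_cast; ring
  unfold Dm
  rw [h, h, ← map_sub, Complex.norm_conj]

lemma tail_sum (f : ℕ → ℝ) (hf : ∀ n, 0 ≤ f n) (hk : 0 < k) (A : ℝ) (hA : 0 ≤ A)
    (h1 : ∀ n : ℕ, n + 1 ≤ 2 * k → f n ≤ A / (k:ℝ) ^ 2 * ((n:ℝ) + 1)⁻¹)
    (h2 : ∀ n : ℕ, 2 * k < n + 1 → f n ≤ A / (k:ℝ) * (((n:ℝ) + 1) ^ 2)⁻¹) (N : ℕ) :
    ∑ n ∈ Finset.range N, f n ≤ A / (k:ℝ) ^ 2 * (2 + Real.log ((2 * k : ℕ) : ℝ)) := by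
  have hkp : (0:ℝ) < k := by exact_mod_cast hk
  have a1 : ∑ n ∈ Finset.range (2 * k), f n ≤ A / (k:ℝ) ^ 2 * (1 + Real.log ((2 * k : ℕ) : ℝ)) := by
    calc _ ≤ ∑ n ∈ Finset.range (2 * k), A / (k:ℝ) ^ 2 * ((n:ℝ) + 1)⁻¹ := Finset.sum_le_sum fun n hn => h1 n (by rw [Finset.mem_range] at hn; omega)
      _ = A / (k:ℝ) ^ 2 * (harmonic (2 * k) : ℝ) := by rw [← Finset.mul_sum]; simp [harmonic]
      _ ≤ _ := by gcongr; exact harmonic_le_one_add_log _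
  have a2 : ∀ M : ℕ, ∑ n ∈ Finset.range (2 * k + M), f n ≤ A / (k:ℝ) ^ 2 * (1 + Real.log ((2 * k : ℕ) : ℝ)) + A / k * ((2 * k : ℝ)⁻¹ - (2 * k + M : ℝ)⁻¹) := by
    intro M
    induction M with
    | zero => simpa using a1
    | succ M ih =>
      rw [← add_assoc, Finset.sum_range_succ]
      have h3 := h2 (2 * k + M) (by omega)
      have h4 : ((((2 * k + M : ℕ) : ℝ) + 1) ^ 2)⁻¹ ≤ (2 * k + M : ℝ)⁻¹ - (2 * k + (M + 1 : ℕ) : ℝ)⁻¹ := by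
        push_cast
        have hp : (0:ℝ) < 2 * k + M := by positivity
        rw [inv_sub_inv hp.ne' (by positivity), inv_eq_one_div, div_le_div_iff₀ (by positivity) (by positivity)]
        nlinarith
      have h5 : A / (k:ℝ) * ((((2 * k + M : ℕ) : ℝ) + 1) ^ 2)⁻¹ ≤ A / (k:ℝ) * ((2 * k + M : ℝ)⁻¹ - (2 * k + (M + 1 : ℕ) : ℝ)⁻¹) := by gcongr
      rw [mul_sub] at *
      linarith
  have a3 := a2 N
  have a4 : ∑ n ∈ Finset.range N, f n ≤ ∑ n ∈ Finset.range (2 * k + N), f n :=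
    Finset.sum_le_sum_of_subset_of_nonneg (Finset.range_mono (by omega)) fun n _ _ => hf n
  have a5 : A / k * ((2 * k : ℝ)⁻¹ - (2 * k + N : ℝ)⁻¹) ≤ A / (k:ℝ) ^ 2 := by
    have : (0:ℝ) ≤ (2 * k + N : ℝ)⁻¹ := by positivity
    calc _ ≤ A / k * (k:ℝ)⁻¹ := by
          gcongr
          have : (2 * k : ℝ)⁻¹ ≤ (k:ℝ)⁻¹ := by gcongr; linarith
          linarith
      _ = _ := by field_simp
  linarith

/-- empirical Fourier error of the scaled GUE -/
noncomputable def gD (k : ℕ) (x : IX k → ℝ) (m : ℤ) : ℂ := Dm (esd ((Real.sqrt k)⁻¹ • TT x)) m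

lemma gD_eq (x : IX k → ℝ) (m : ℤ) : gD k x m = (k:ℂ)⁻¹ * (∑ a, ex (om m) (ge (Real.sqrt k)⁻¹ x a)) - phi (om m) := by
  unfold gD Dm
  rw [sc_char, esd_integral (rTT_herm _ x)]
  simp [ge, ex]

lemma gD_meas (m : ℤ) : AEStronglyMeasurable (fun x : IX k → ℝ => gD k x m) (gp (IX k)) := by
  simp_rw [gD_eq]
  exact ((gue_char_meas _ _).const_mul _).sub aestronglyMeasurable_const

lemma gD_sq (hk : k ≠ 0) (m : ℤ) : ∫ x, ‖gD k x m‖ ^ 2 ∂(gp (IX k)) = vk k (om m * (Real.sqrt k)⁻¹) / (k:ℝ) ^ 2 + ‖gk k (om m) - phi (om m)‖ ^ 2 := by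
  set r := (Real.sqrt k)⁻¹
  set a : (IX k → ℝ) → ℂ := fun x => (k:ℂ)⁻¹ * (∑ a, ex (om m) (ge r x a)) with ha
  have hkc : (k:ℂ) ≠ 0 := by exact_mod_cast hk
  have hkr : (k:ℝ) ≠ 0 := by exact_mod_cast hk
  have e1 : ∀ x, ‖gD k x m‖ ^ 2 = ‖a x‖ ^ 2 - 2 * phi (om m) * (a x).re + phi (om m) ^ 2 := by
    intro x
    rw [gD_eq]
    change ‖a x - phi (om m)‖ ^ 2 = _
    rw [← Complex.normSq_eq_norm_sq, ← Complex.normSq_eq_norm_sq, Complex.normSq_apply, Complex.normSq_apply]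
    simp; ring
  have hb : ∀ x, ‖a x‖ ≤ 1 := by
    intro x
    simp only [ha, norm_mul, norm_inv, Complex.norm_natCast]
    have : ‖∑ a, ex (om m) (ge r x a)‖ ≤ k := by
      refine (norm_sum_le _ _).trans ?_
      simp [ex_norm]
    calc _ ≤ (k:ℝ)⁻¹ * k := by gcongr
      _ = 1 := by field_simp
  have hm : AEStronglyMeasurable a (gp (IX k)) := (gue_char_meas _ _).const_mul _
  have i0 : Integrable a (gp (IX k)) := Integrable.of_bound hm 1 (ae_of_all _ hb)
  have i1 : Integrable (fun x => ‖a x‖ ^ 2) (gp (IX k)) := Integrable.of_bound (hm.norm.pow 2) 1 (ae_of_all _ fun x => by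
    have := hb x
    rw [Real.norm_eq_abs, abs_of_nonneg (by positivity)]; nlinarith [norm_nonneg (a x)])
  have i2 : Integrable (fun x => 2 * phi (om m) * (a x).re) (gp (IX k)) := i0.re.const_mul _
  simp_rw [e1]
  have i3 : Integrable (fun x => ‖a x‖ ^ 2 - 2 * phi (om m) * (a x).re) (gp (IX k)) := i1.sub i2
  rw [integral_add i3 (integrable_const _), integral_sub i1 i2, integral_const_mul]
  have s1 : ∫ x, (a x).re ∂(gp (IX k)) = (gk k (om m)).re := by
    have := integral_re i0
    simp only [RCLike.re_to_complex] at this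
    rw [this]
    congr 1
    simp only [ha]
    rw [integral_const_mul, gue_char1 hk, gk, mul_comm (om m)]
  have s2 : ∫ x, ‖a x‖ ^ 2 ∂(gp (IX k)) = vk k (om m * r) / (k:ℝ) ^ 2 + ‖gk k (om m)‖ ^ 2 := by
    simp only [ha, norm_mul, mul_pow]
    rw [integral_const_mul, gue_charsq, gk, mul_comm _ (om m), norm_mul]
    simp only [norm_inv, Complex.norm_natCast]
    change _ * (_ + ‖Sk k (om m * r)‖ ^ 2) = _ + (_ * ‖Sk k (om m * r)‖) ^ 2
    generalize Sk k (om m * r) = S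
    field_simp
  rw [s1, s2]
  rw [← Complex.normSq_eq_norm_sq, ← Complex.normSq_eq_norm_sq, Complex.normSq_apply, Complex.normSq_apply]
  simp; ring

lemma om_pos_bd (n : ℕ) : ((n:ℝ) + 1) * (3/4) ≤ om ((n:ℤ) + 1) ∧ om ((n:ℤ) + 1) ≤ (n:ℝ) + 1 := by
  have h3 := Real.pi_gt_three
  have h4 := Real.pi_lt_four
  unfold om; push_cast
  constructor <;> nlinarith [show (0:ℝ) ≤ (n:ℝ) by positivity]

lemma gD_term (hk : 0 < k) (n : ℕ) :
    (n + 1 ≤ 2 * k → (∫ x, ‖gD k x ((n:ℤ) + 1)‖ ^ 2 ∂(gp (IX k))) / om ((n:ℤ) + 1) ^ 2 ≤ 1700 / (k:ℝ) ^ 2 * ((n:ℝ) + 1)⁻¹) ∧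
    (2 * k < n + 1 → (∫ x, ‖gD k x ((n:ℤ) + 1)‖ ^ 2 ∂(gp (IX k))) / om ((n:ℤ) + 1) ^ 2 ≤ 1700 / (k:ℝ) * (((n:ℝ) + 1) ^ 2)⁻¹) := by
  rw [gD_sq hk.ne']
  obtain ⟨b1, b2⟩ := om_pos_bd n
  set w := om ((n:ℤ) + 1)
  set N : ℝ := (n:ℝ) + 1 with hN
  have hN0 : 1 ≤ N := by rw [hN]; linarith [show (0:ℝ) ≤ (n:ℝ) by positivity]
  have hw : 0 < w := by linarith
  have hkp : (1:ℝ) ≤ k := by exact_mod_cast hk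
  have big : (k:ℝ) < w → (vk k (w * (Real.sqrt k)⁻¹) / (k:ℝ) ^ 2 + ‖gk k w - phi w‖ ^ 2) ≤ 803 / k := by
    intro hkw
    have v1 : vk k (w * (Real.sqrt k)⁻¹) / (k:ℝ) ^ 2 ≤ 1 / k := by
      rw [div_le_div_iff₀ (by positivity) (by positivity)]
      nlinarith [vk_le_k k (w * (Real.sqrt k)⁻¹)]
    have v2 : ‖gk k w‖ ^ 2 ≤ 1 / k := by
      have := gk_norm_le k hk w
      rw [abs_of_pos hw] at this
      have h0 := norm_nonneg (gk k w)
      rw [le_div_iff₀ (by linarith)]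
      have : (k:ℝ) * ‖gk k w‖ ≤ 1 := by nlinarith
      have h2 : ‖gk k w‖ ≤ 1 := by nlinarith
      nlinarith
    have v3 : phi w ^ 2 ≤ 400 / k := by
      have := phi_decay hw.le
      rw [le_div_iff₀ (by linarith)]
      have h3 : (k:ℝ) ≤ w ^ 3 := by nlinarith [sq_nonneg w, sq_nonneg (w-1), mul_pos hw hw]
      nlinarith [sq_nonneg (phi w)]
    have v4 : ‖gk k w - phi w‖ ^ 2 ≤ 2 * (‖gk k w‖ ^ 2 + phi w ^ 2) := by
      have h := norm_sub_le (gk k w) (phi w)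
      rw [Complex.norm_real, Real.norm_eq_abs] at h
      have h5 : ‖gk k w - phi w‖ ^ 2 ≤ (‖gk k w‖ + |phi w|) ^ 2 := by gcongr
      rw [← sq_abs (phi w)]
      nlinarith [sq_nonneg (‖gk k w‖ - |phi w|)]
    have : (803:ℝ) / k = 1 / k + 2 * (1 / k + 400 / k) := by field_simp; norm_num
    linarith
  constructor
  · intro hn
    have hn' : N ≤ 2 * k := by rw [hN]; exact_mod_cast hn
    rw [div_le_iff₀ (by positivity)]
    rcases le_or_gt w k with hwk | hwk
    · have v1 : vk k (w * (Real.sqrt k)⁻¹) ≤ 2 * w := by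
        obtain ⟨j, rfl⟩ : ∃ j, k = j + 1 := ⟨k - 1, by omega⟩
        refine (vk_le j _).trans (le_of_eq ?_)
        have : Real.sqrt ((j + 1 : ℕ) : ℝ) ≠ 0 := by positivity
        rw [abs_of_pos (by positivity)]; field_simp
      have v2 : ‖gk k w - phi w‖ ^ 2 ≤ 784 * w ^ 3 / (k:ℝ) ^ 4 := by
        have h := gk_phi k hk w hw.le hwk
        calc _ ≤ (28 * (w * Real.sqrt w) / (k : ℝ) ^ 2) ^ 2 := by gcongr
          _ = _ := by rw [div_pow, mul_pow, mul_pow, Real.sq_sqrt hw.le]; ring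
      calc _ ≤ 2 * w / (k:ℝ) ^ 2 + 784 * w ^ 3 / (k:ℝ) ^ 4 := by gcongr
        _ ≤ 1700 / (k:ℝ) ^ 2 * N⁻¹ * w ^ 2 := by
          have q1 : 2 * w / (k:ℝ) ^ 2 ≤ 100 / (k:ℝ) ^ 2 * N⁻¹ * w ^ 2 := by
            rw [div_mul_eq_mul_div, div_mul_eq_mul_div]
            refine div_le_div_of_nonneg_right ?_ (by positivity)
            rw [mul_assoc, inv_mul_eq_div, ← mul_div_assoc, le_div_iff₀ (by linarith)]
            nlinarith
          have q2 : 784 * w ^ 3 / (k:ℝ) ^ 4 ≤ 1600 / (k:ℝ) ^ 2 * N⁻¹ * w ^ 2 := by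
            rw [div_mul_eq_mul_div, div_mul_eq_mul_div, ← div_eq_mul_inv, div_mul_eq_mul_div, div_div,  div_le_div_iff₀ (by positivity) (by positivity)]
            have : w * N ≤ 2 * (k:ℝ) ^ 2 := by nlinarith
            have h2 : 784 * (w * N) ≤ 1600 * (k:ℝ) ^ 2 := by nlinarith
            calc 784 * w ^ 3 * (N * (k:ℝ) ^ 2) = (784 * (w * N)) * (w ^ 2 * (k:ℝ) ^ 2) := by ring
              _ ≤ (1600 * (k:ℝ) ^ 2) * (w ^ 2 * (k:ℝ) ^ 2) := by gcongr
              _ = _ := by ring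
          calc _ ≤ _ := add_le_add q1 q2
            _ = _ := by ring
    · refine (big hwk).trans ?_
      rw [div_mul_eq_mul_div, div_mul_eq_mul_div, ← div_eq_mul_inv, div_mul_eq_mul_div, div_div, div_le_div_iff₀ (by positivity) (by positivity)]
      have h2 : (k:ℝ) * N * (3/4) ≤ w ^ 2 := by nlinarith
      have h1 : 803 * (N * k) ≤ 1700 * w ^ 2 := by nlinarith [mul_pos (by linarith : 0 < N) (by linarith : (0:ℝ) < k)]
      calc 803 * (N * (k:ℝ) ^ 2) = (803 * (N * k)) * k := by ring
        _ ≤ _ := by gcongr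
  · intro hn
    have hn' : 2 * k ≤ N := by rw [hN]; exact_mod_cast hn.le
    rw [div_le_iff₀ (by positivity)]
    refine (big (by linarith)).trans ?_
    rw [div_mul_eq_mul_div, div_mul_eq_mul_div]
    gcongr
    rw [← div_eq_mul_inv, div_mul_eq_mul_div, le_div_iff₀ (by positivity)]
    nlinarith

lemma gD_le (hk : k ≠ 0) (x : IX k → ℝ) (m : ℤ) : ‖gD k x m‖ ≤ 2 := by
  have := esd_prob hk (rTT_herm (Real.sqrt k)⁻¹ x)
  exact Dm_le _ m

lemma gD_hasSum (hk : k ≠ 0) : HasSum (fun m : ℤ => (∫ x, ‖gD k x m‖ ^ 2 ∂(gp (IX k))) / om m ^ 2) (∫ x, ∑' m : ℤ, ‖gD k x m‖ ^ 2 / om m ^ 2 ∂(gp (IX k))) := by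
  have key := hasSum_integral_of_dominated_convergence (μ := gp (IX k)) (F := fun (m : ℤ) x => ‖gD k x m‖ ^ 2 / om m ^ 2)
    (f := fun x => ∑' m : ℤ, ‖gD k x m‖ ^ 2 / om m ^ 2) (fun m _ => 4 * (1 / om m ^ 2))
    (fun m => ((gD_meas m).norm.pow 2).mul_const _)
    (fun m => ae_of_all _ fun x => by
      rw [Real.norm_eq_abs, abs_of_nonneg (by positivity), mul_one_div]
      have := gD_le hk x m
      gcongr; nlinarith [norm_nonneg (gD k x m)])
    (ae_of_all _ fun x => om_sq_summable.mul_left 4) (integrable_const _)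
    (ae_of_all _ fun x => by
      have := esd_prob hk (rTT_herm (Real.sqrt k)⁻¹ x)
      exact (Dm_summable (esd ((Real.sqrt k)⁻¹ • TT x))).hasSum)
  refine key.congr_fun ?_
  intro m
  rw [integral_div]

lemma gR_bound (hk : 2 ≤ k) : ∫ x, ∑' m : ℤ, ‖gD k x m‖ ^ 2 / om m ^ 2 ∂(gp (IX k)) ≤ 17000 * Real.log k / (k:ℝ) ^ 2 := by
  have hk0 : k ≠ 0 := by omega
  have hkp : (0:ℝ) < k := by positivity
  have hs := gD_hasSum (k := k) hk0
  set f : ℤ → ℝ := fun m : ℤ => (∫ x, ‖gD k x m‖ ^ 2 ∂(gp (IX k))) / om m ^ 2 with hf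
  have hf0 : ∀ m, 0 ≤ f m := fun m => div_nonneg (integral_nonneg fun x => by positivity) (by positivity)
  have hneg : ∀ n : ℕ, f (-((n:ℤ) + 1)) = f ((n:ℤ) + 1) := by
    intro n
    simp only [hf]
    have : ∀ m, om (-m) = - om m := fun m => by unfold om; push_cast; ring
    rw [this, neg_sq]
    simp only [gD, Dm_neg]
  have hz : f 0 = 0 := by simp [hf, om]
  rw [← hs.tsum_eq]
  have hS := hs.summable
  have hinj : Summable fun n : ℕ => f n := hS.comp_injective Nat.cast_injective
  have hp1 : Summable fun n : ℕ => f ((n:ℤ) + 1) := by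
    have := (summable_nat_add_iff 1).2 hinj
    simpa using this
  have hp2 : Summable fun n : ℕ => f (-((n:ℤ) + 1)) := by simpa only [hneg] using hp1
  rw [tsum_of_nat_of_neg_add_one hinj hp2, hinj.tsum_eq_zero_add]
  simp only [hneg]
  have hb : ∑' n : ℕ, f ((n:ℤ) + 1) ≤ 1700 / (k:ℝ) ^ 2 * (2 + Real.log ((2 * k : ℕ) : ℝ)) := by
    refine hp1.tsum_le_of_sum_range_le fun N => ?_
    exact tail_sum (fun n : ℕ => f ((n:ℤ) + 1)) (fun n => hf0 _) (by omega) 1700 (by norm_num) (fun n => (gD_term (by omega) n).1) (fun n => (gD_term (by omega) n).2) N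
  have hlog : Real.log 2 ≤ Real.log k := Real.log_le_log (by norm_num) (by exact_mod_cast hk)
  have hl2 := Real.log_two_gt_d9
  have hl3 : Real.log ((2 * k : ℕ) : ℝ) = Real.log 2 + Real.log k := by
    push_cast; rw [Real.log_mul (by norm_num) hkp.ne']
  have h6 : 1700 / (k:ℝ) ^ 2 * (2 + Real.log ((2 * k : ℕ) : ℝ)) ≤ 1700 / (k:ℝ) ^ 2 * (5 * Real.log k) := by
    gcongr; rw [hl3]; linarith
  have h7 : 17000 * Real.log k / (k:ℝ) ^ 2 = 2 * (1700 / (k:ℝ) ^ 2 * (5 * Real.log k)) := by ring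
  push_cast
  rw [hz, h7]
  linarith

lemma fro_qm (x : IX k → ℝ) : ((fro (TT x) ^ 2 : ℝ) : ℂ) = qm (TT x) 2 := by
  rw [fro_sq_trace, (TT_herm x).eq, qm, sq]

lemma gue_fro : ∫ x : IX k → ℝ, fro (TT x) ^ 2 ∂(gp (IX k)) = (k:ℝ) ^ 2 := by
  apply Complex.ofReal_injective
  rw [← integral_complex_ofReal]
  simp_rw [fro_qm]
  have h := (GM_loop k).succ 1 []
  simp only [Finset.range_one, Finset.sum_singleton, terms, (GM_loop k).zero, (GM_loop k).nil] at h
  simp [GM] at h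
  rw [h]; push_cast; ring

lemma fro_sq_int : Integrable (fun x : IX k → ℝ => fro (TT x) ^ 2) (gp (IX k)) := by
  simp_rw [fro_sq]
  exact (EB.sum _ fun i _ => EB.sum _ fun j _ => (TT_EB i j).norm'.pow 2).intp

lemma Wsc_lip (hk : k ≠ 0) (x y : IX k → ℝ) : |Wsc ((Real.sqrt k)⁻¹ • TT x) - Wsc ((Real.sqrt k)⁻¹ • TT y)| ≤ (k:ℝ)⁻¹ * fro (TT (x - y)) := by
  refine (Wsc_abs_perturb hk (rTT_herm _ x) (rTT_herm _ y)).trans (le_of_eq ?_)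
  have : (Real.sqrt k)⁻¹ • TT x - (Real.sqrt k)⁻¹ • TT y = (Real.sqrt k)⁻¹ • TT (x - y) := by
    rw [sub_eq_add_neg x y, TT_add, ← neg_one_smul ℝ y, TT_smul]; simp [smul_add, sub_eq_add_neg]
  rw [this, fro_rsmul, abs_of_nonneg (by positivity), ← mul_assoc, ← sq, Kr]

lemma Wsc_cont (hk : k ≠ 0) : Continuous fun x : IX k → ℝ => Wsc ((Real.sqrt k)⁻¹ • TT x) := by
  have : LipschitzWith 2 fun x : IX k → ℝ => Wsc ((Real.sqrt k)⁻¹ • TT x) := by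
    refine LipschitzWith.of_dist_le_mul fun x y => ?_
    rw [Real.dist_eq, dist_eq_norm]
    refine (Wsc_lip hk x y).trans ?_
    have hk' : (k:ℝ) ≠ 0 := by exact_mod_cast hk
    calc _ ≤ (k:ℝ)⁻¹ * (2 * k * ‖x - y‖) := by gcongr; exact TT_fro_le _
      _ = _ := by push_cast; field_simp
  exact this.continuous

lemma Wsc_EB (hk : k ≠ 0) : EB fun x : IX k → ℝ => Wsc ((Real.sqrt k)⁻¹ • TT x) := by
  refine EB.lin (Wsc_cont hk) 2 (Wsc ((Real.sqrt k)⁻¹ • TT (0 : IX k → ℝ))) (by norm_num) fun x => ?_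
  have h := Wsc_lip hk x 0
  have hk' : (k:ℝ) ≠ 0 := by exact_mod_cast hk
  have h2 : (k:ℝ)⁻¹ * fro (TT (x - 0)) ≤ 2 * ‖x‖ := by
    calc _ ≤ (k:ℝ)⁻¹ * (2 * k * ‖x - 0‖) := by gcongr; exact TT_fro_le _
      _ = _ := by rw [sub_zero]; field_simp
  rw [Real.norm_eq_abs, abs_of_nonneg (Wsc_nonneg _)]
  have := le_abs_self (Wsc ((Real.sqrt k)⁻¹ • TT x) - Wsc ((Real.sqrt k)⁻¹ • TT (0 : IX k → ℝ)))
  linarith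

/-- the GUE rate -/
theorem gue_rate (hk : 2 ≤ k) : ∫ x : IX k → ℝ, Wsc ((Real.sqrt k)⁻¹ • TT x) ∂(gp (IX k)) ≤ 26000 * (Real.sqrt (Real.log k) / k) := by
  have hk0 : k ≠ 0 := by omega
  have hkp : (0:ℝ) < k := by positivity
  have hlog : 0 < Real.log k := Real.log_pos (by exact_mod_cast (by omega : 1 < k))
  set s := Real.sqrt (Real.log k) / k with hs
  have hs0 : 0 < s := by positivity
  have hsm : Integrable (fun x : IX k → ℝ => ∑' m : ℤ, ‖gD k x m‖ ^ 2 / om m ^ 2) (gp (IX k)) := by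
    refine Integrable.of_bound (C := ∑' m : ℤ, 4 * (1 / om m ^ 2)) ?_ (ae_of_all _ fun x => ?_)
    · have h : ∀ x, HasSum (fun m : ℤ => ‖gD k x m‖ ^ 2 / om m ^ 2) (∑' m : ℤ, ‖gD k x m‖ ^ 2 / om m ^ 2) := fun x => by
        have := esd_prob hk0 (rTT_herm (Real.sqrt k)⁻¹ x)
        exact (Dm_summable (esd ((Real.sqrt k)⁻¹ • TT x))).hasSum
      refine aestronglyMeasurable_of_tendsto_ae (atTop : Filter (Finset ℤ)) (f := fun S x => ∑ m ∈ S, ‖gD k x m‖ ^ 2 / om m ^ 2) (fun S => ?_) (ae_of_all _ h)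
      exact Finset.aestronglyMeasurable_fun_sum _ fun m _ => ((gD_meas m).norm.pow 2).mul_const _
    · have := esd_prob hk0 (rTT_herm (Real.sqrt k)⁻¹ x)
      rw [Real.norm_eq_abs, abs_of_nonneg (tsum_nonneg fun m => by positivity)]
      refine Summable.tsum_le_tsum (fun m => ?_) (Dm_summable (esd ((Real.sqrt k)⁻¹ • TT x))) (om_sq_summable.mul_left 4)
      rw [mul_one_div]
      have := gD_le hk0 x m
      gcongr; nlinarith [norm_nonneg (gD k x m)]
  have hpt : ∀ x : IX k → ℝ, Wsc ((Real.sqrt k)⁻¹ • TT x) ≤ 3 / 2 * (s + (∑' m : ℤ, ‖gD k x m‖ ^ 2 / om m ^ 2) / s) + 1 / 2 * (((k:ℝ) ^ 2)⁻¹ * fro (TT x) ^ 2 - 1) := by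
    intro x
    refine (Wsc_fourier hk0 (rTT_herm _ x) s hs0).trans (le_of_eq ?_)
    rw [fro_rsmul, mul_pow, sq_abs, Kr]
    have : (k:ℝ)⁻¹ * ((k:ℝ)⁻¹ * fro (TT x) ^ 2) = ((k:ℝ) ^ 2)⁻¹ * fro (TT x) ^ 2 := by field_simp
    rw [this]; rfl
  have j1 : Integrable (fun x : IX k → ℝ => 3 / 2 * (s + (∑' m : ℤ, ‖gD k x m‖ ^ 2 / om m ^ 2) / s)) (gp (IX k)) := ((integrable_const _).add (hsm.div_const _)).const_mul _
  have j1' : Integrable (fun x : IX k → ℝ => (∑' m : ℤ, ‖gD k x m‖ ^ 2 / om m ^ 2) / s) (gp (IX k)) := hsm.div_const _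
  have j2' : Integrable (fun x : IX k → ℝ => ((k:ℝ) ^ 2)⁻¹ * fro (TT x) ^ 2) (gp (IX k)) := fro_sq_int.const_mul _
  have j2 : Integrable (fun x : IX k → ℝ => 1 / 2 * (((k:ℝ) ^ 2)⁻¹ * fro (TT x) ^ 2 - 1)) (gp (IX k)) := (j2'.sub (integrable_const _)).const_mul _
  have j3 : Integrable (fun x : IX k → ℝ => 3 / 2 * (s + (∑' m : ℤ, ‖gD k x m‖ ^ 2 / om m ^ 2) / s) + 1 / 2 * (((k:ℝ) ^ 2)⁻¹ * fro (TT x) ^ 2 - 1)) (gp (IX k)) := j1.add j2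
  refine (integral_mono (Wsc_EB hk0).intp j3 hpt).trans ?_
  rw [integral_add j1 j2, integral_const_mul, integral_const_mul, integral_add (integrable_const _) j1', integral_sub j2' (integrable_const _), integral_const_mul, gue_fro]
  have hdiv : ∫ x, (∑' m : ℤ, ‖gD k x m‖ ^ 2 / om m ^ 2) / s ∂(gp (IX k)) = (∫ x, ∑' m : ℤ, ‖gD k x m‖ ^ 2 / om m ^ 2 ∂(gp (IX k))) / s := integral_div _ _
  rw [hdiv]
  have hR := gR_bound hk
  have h1 : (∫ x, ∑' m : ℤ, ‖gD k x m‖ ^ 2 / om m ^ 2 ∂(gp (IX k))) / s ≤ 17000 * s := by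
    rw [div_le_iff₀ hs0]
    refine hR.trans (le_of_eq ?_)
    rw [mul_assoc, ← sq, hs, div_pow, Real.sq_sqrt hlog.le]; ring
  have h2 : ((k:ℝ) ^ 2)⁻¹ * (k:ℝ) ^ 2 = 1 := by field_simp
  rw [h2]
  simp only [integral_const, probReal_univ, smul_eq_mul, one_mul]
  linarith

end guebound

-- Part PE1
section haar
instance mBorel {n : ℕ} : BorelSpace (Matrix (Fin n) (Fin n) ℂ) := inferInstanceAs (BorelSpace (Fin n → Fin n → ℂ))
instance mSecond {n : ℕ} : SecondCountableTopology (Matrix (Fin n) (Fin n) ℂ) := inferInstanceAs (SecondCountableTopology (Fin n → Fin n → ℂ))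

section
open scoped Matrix.Norms.Frobenius
variable {n : ℕ}
lemma exp_entry (X : Matrix (Fin n) (Fin n) ℂ) (i j : Fin n) : HasDerivAt (fun t : ℝ => NormedSpace.exp (t • X) i j) (X i j) 0 := by
  have h := hasDerivAt_exp_smul_const' (𝕂 := ℝ) X 0
  simp only [zero_smul, NormedSpace.exp_zero, mul_one] at h
  exact (LinearMap.toContinuousLinearMap (Matrix.entryLinearMap ℝ ℂ i j)).hasFDerivAt.comp_hasDerivAt (0:ℝ) h
lemma exp_unit (X : Matrix (Fin n) (Fin n) ℂ) (h : Xᴴ = -X) (t : ℝ) : NormedSpace.exp (t • X) ∈ Matrix.unitaryGroup (Fin n) ℂ := by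
  refine NormedSpace.exp_mem_unitary_of_mem_skewAdjoint ?_
  rw [skewAdjoint.mem_iff, star_eq_conjTranspose, conjTranspose_smul, h]; simp
lemma exp_add' (X : Matrix (Fin n) (Fin n) ℂ) (s t : ℝ) : NormedSpace.exp ((s + t) • X) = NormedSpace.exp (s • X) * NormedSpace.exp (t • X) := by
  rw [add_smul]
  exact NormedSpace.exp_add_of_commute ((Commute.refl X).smul_left s |>.smul_right t)
lemma exp_cont (X : Matrix (Fin n) (Fin n) ℂ) : Continuous fun t : ℝ => NormedSpace.exp (t • X) := by
  have h : ∀ t : ℝ, ContinuousAt (fun t : ℝ => NormedSpace.exp (t • X)) t := fun t => (hasDerivAt_exp_smul_const' (𝕂 := ℝ) X t).continuousAt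
  exact continuous_iff_continuousAt.2 h
end

variable {n : ℕ}

/-- the conjugation curve -/
noncomputable def cj (X A : Matrix (Fin n) (Fin n) ℂ) (t : ℝ) : Matrix (Fin n) (Fin n) ℂ :=
  NormedSpace.exp (t • X) * A * (NormedSpace.exp (t • X))ᴴ

lemma cj_zero (X A : Matrix (Fin n) (Fin n) ℂ) : cj X A 0 = A := by simp [cj]

lemma cj_add (X A : Matrix (Fin n) (Fin n) ℂ) (s t : ℝ) : cj X A (s + t) = cj X (cj X A t) s := by
  simp [cj, exp_add', Matrix.mul_assoc]

lemma cj_deriv (X A : Matrix (Fin n) (Fin n) ℂ) (h : Xᴴ = -X) (i j : Fin n) : HasDerivAt (fun t : ℝ => cj X A t i j) ((X * A - A * X) i j) 0 := by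
  simp only [cj, Matrix.mul_apply, Matrix.conjTranspose_apply]
  have h1 : ∀ i j, HasDerivAt (fun t : ℝ => star (NormedSpace.exp (t • X) i j)) (star (X i j)) 0 := fun i j => (exp_entry X i j).star
  have h2 := HasDerivAt.fun_sum (u := Finset.univ) fun l (_ : l ∈ Finset.univ) => (HasDerivAt.fun_sum (u := Finset.univ) fun m (_ : m ∈ Finset.univ) => (exp_entry X i m).mul_const (A m l)).mul (h1 j l)
  refine h2.congr_deriv ?_
  have h3 : ∀ i j, star (X j i) = - X i j := fun i j => by have := congrFun (congrFun h i) j; simpa using this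
  simp only [h3]
  simp [Matrix.one_apply, Finset.sum_add_distrib, Matrix.mul_apply, sub_eq_add_neg]

/-- law of a conjugation invariant traceless Hermitian matrix of fixed Frobenius norm -/
structure HL (ν : Measure (Matrix (Fin n) (Fin n) ℂ)) (R : ℝ) : Prop where
  prob : IsProbabilityMeasure ν
  inv : ∀ V ∈ Matrix.unitaryGroup (Fin n) ℂ, Measure.map (fun A => V * A * Vᴴ) ν = ν
  herm : ∀ᵐ A ∂ν, A.IsHermitian
  norm : ∀ᵐ A ∂ν, fro A = R
  tr : ∀ᵐ A ∂ν, A.trace = 0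

lemma entry_le_fro {m : Type*} [Fintype m] (A : Matrix m m ℂ) (i j : m) : ‖A i j‖ ≤ fro A := by
  refine (sq_le_sq₀ (norm_nonneg _) (fro_nonneg _)).1 ?_
  rw [fro_sq]
  refine (Finset.single_le_sum (f := fun j => ‖A i j‖ ^ 2) (fun j _ => by positivity) (Finset.mem_univ j)).trans ?_
  exact (Finset.single_le_sum (f := fun i => ∑ j, ‖A i j‖ ^ 2) (fun i _ => by positivity) (Finset.mem_univ i))

lemma fro_compact (R : ℝ) (g : Matrix (Fin n) (Fin n) ℂ → ℝ) (hg : Continuous g) : ∃ C, ∀ A, fro A ≤ R → ‖g A‖ ≤ C := by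
  have hK : IsCompact (Set.pi Set.univ fun _ : Fin n => Set.pi Set.univ fun _ : Fin n => Metric.closedBall (0:ℂ) R) :=
    isCompact_univ_pi fun _ => isCompact_univ_pi fun _ => isCompact_closedBall _ _
  obtain ⟨C, hC⟩ := hK.exists_bound_of_continuousOn (f := fun A : Fin n → Fin n → ℂ => g A) hg.continuousOn
  refine ⟨C, fun A hA => hC A ?_⟩
  intro i _ j _
  rw [mem_closedBall_zero_iff]
  exact (entry_le_fro A i j).trans hA

lemma HL.integrable {ν : Measure (Matrix (Fin n) (Fin n) ℂ)} {R : ℝ} (h : HL ν R) (g : Matrix (Fin n) (Fin n) ℂ → ℝ) (hg : Continuous g) : Integrable g ν := by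
  have := h.prob
  obtain ⟨C, hC⟩ := fro_compact R g hg
  refine Integrable.of_bound hg.aestronglyMeasurable C ?_
  filter_upwards [h.norm] with A hA using hC A hA.le

lemma HL.haar {ν : Measure (Matrix (Fin n) (Fin n) ℂ)} {R : ℝ} (h : HL ν R) (X : Matrix (Fin n) (Fin n) ℂ) (hX : Xᴴ = -X)
    (g g' : Matrix (Fin n) (Fin n) ℂ → ℝ) (hg : Continuous g) (hg' : Continuous g')
    (hd : ∀ A, HasDerivAt (fun t => g (cj X A t)) (g' A) 0) : ∫ A, g' A ∂ν = 0 := by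
  have := h.prob
  obtain ⟨C, hC⟩ := fro_compact R g' hg'
  have hcc : ∀ t, Continuous fun A => cj X A t := fun t => by unfold cj; fun_prop
  have hfro : ∀ A t, fro (cj X A t) = fro A := by
    intro A t
    have hu := exp_unit X hX t
    unfold cj
    rw [fro_mul_unitary, fro_unitary_mul]
    · exact Matrix.mem_unitaryGroup_iff'.1 hu
    · rw [conjTranspose_conjTranspose]; exact Matrix.mem_unitaryGroup_iff'.1 hu
  have hd' : ∀ A t, HasDerivAt (fun t => g (cj X A t)) (g' (cj X A t)) t := by
    intro A t
    have h1 := hd (cj X A t)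
    have h2 : HasDerivAt (fun s : ℝ => s - t) 1 t := (hasDerivAt_id t).sub_const t
    have h3 := HasDerivAt.scomp t (g₁ := fun s => g (cj X (cj X A t) s)) (by simpa using h1) h2
    simp only [one_smul] at h3
    refine h3.congr_of_eventuallyEq (Eventually.of_forall fun s => ?_)
    simp [← cj_add]
  have key := hasDerivAt_integral_of_dominated_loc_of_deriv_le (μ := ν) (F := fun t A => g (cj X A t)) (F' := fun t A => g' (cj X A t)) (x₀ := (0:ℝ)) (s := Set.univ) (bound := fun _ => C) univ_mem
    (Eventually.of_forall fun t => (hg.comp (hcc t)).aestronglyMeasurable) (by simpa [cj_zero] using h.integrable g hg)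
    ((hg'.comp (hcc 0)).aestronglyMeasurable) (by
      filter_upwards [h.norm] with A hA t _
      exact hC _ (by rw [hfro, hA])) (integrable_const _) (ae_of_all _ fun A t _ => hd' A t)
  have hconst : (fun t : ℝ => ∫ A, g (cj X A t) ∂ν) = fun _ => ∫ A, g A ∂ν := by
    funext t
    conv_rhs => rw [← h.inv _ (exp_unit X hX t)]
    exact (integral_map (hcc t).measurable.aemeasurable hg.aestronglyMeasurable).symm
  have k2 := key.2
  rw [hconst] at k2
  have := k2.unique (hasDerivAt_const (0:ℝ) _)
  simpa [cj_zero] using this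

end haar

-- Part PE2
section stein
variable {n : ℕ}

/-- real pairing -/
noncomputable def rp {k : ℕ} (Z B : Matrix (Fin k) (Fin k) ℂ) : ℝ := (Z * B).trace.re

lemma rp_add {k : ℕ} (Z B C : Matrix (Fin k) (Fin k) ℂ) : rp Z (B + C) = rp Z B + rp Z C := by simp [rp, Matrix.mul_add]
lemma rp_smul {k : ℕ} (c : ℝ) (Z B : Matrix (Fin k) (Fin k) ℂ) : rp Z (c • B) = c * rp Z B := by simp [rp]
lemma rp_sum {k : ℕ} {ι : Type*} (s : Finset ι) (Z : Matrix (Fin k) (Fin k) ℂ) (B : ι → Matrix (Fin k) (Fin k) ℂ) : rp Z (∑ i ∈ s, B i) = ∑ i ∈ s, rp Z (B i) := by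
  simp [rp, Finset.mul_sum]
lemma rp_cast {k : ℕ} {Z B : Matrix (Fin k) (Fin k) ℂ} (hZ : Z.IsHermitian) (hB : B.IsHermitian) : ((rp Z B : ℝ) : ℂ) = (Z * B).trace := by
  have : star (Z * B).trace = (Z * B).trace := by
    rw [← Matrix.trace_conjTranspose, Matrix.conjTranspose_mul, hZ.eq, hB.eq, Matrix.trace_mul_comm]
  exact Complex.conj_eq_iff_re.1 this
lemma rp_cont {k : ℕ} (Z : Matrix (Fin k) (Fin k) ℂ) : Continuous (rp Z) := by
  unfold rp; exact Complex.continuous_re.comp (by fun_prop)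

/-- basis of skew-Hermitian matrices -/
noncomputable def XX (s : IX n) : Matrix (Fin n) (Fin n) ℂ :=
  if s.2.2 then Complex.I • (Matrix.single s.1 s.2.1 1 + Matrix.single s.2.1 s.1 1) else Matrix.single s.1 s.2.1 1 - Matrix.single s.2.1 s.1 1

lemma XX_skew (s : IX n) : (XX s)ᴴ = - XX s := by
  obtain ⟨p, q, b⟩ := s
  cases b
  · simp [XX]
  · simp only [XX, if_true, conjTranspose_smul, conjTranspose_add, conjTranspose_single, star_one, Complex.star_def, Complex.conj_I, neg_smul]
    rw [add_comm]

lemma XX_sum (i j l m : Fin n) : ∑ s : IX n, XX s i j * XX s l m = if i = m ∧ j = l then -4 else 0 := by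
  have h : ∀ p q : Fin n, ∑ b : Bool, XX (p, q, b) i j * XX (p, q, b) l m = -2 * ((Matrix.single p q (1:ℂ) i j) * (Matrix.single q p (1:ℂ) l m)) - 2 * ((Matrix.single q p (1:ℂ) i j) * (Matrix.single p q (1:ℂ) l m)) := by
    intro p q
    simp only [Fintype.sum_bool, XX, if_true, Matrix.smul_apply, Matrix.add_apply, Matrix.sub_apply, smul_eq_mul, Bool.false_eq_true, if_false]
    linear_combination (Matrix.single p q (1:ℂ) i j + Matrix.single q p (1:ℂ) i j) * (Matrix.single p q (1:ℂ) l m + Matrix.single q p (1:ℂ) l m) * Complex.I_mul_I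
  simp only [IX, Fintype.sum_prod_type, h, Finset.sum_sub_distrib, ← Finset.mul_sum]
  have h1 : ∑ p : Fin n, ∑ q : Fin n, (Matrix.single p q (1:ℂ) i j) * (Matrix.single q p (1:ℂ) l m) = if i = m ∧ j = l then 1 else 0 := by
    rw [Finset.sum_eq_single i, Finset.sum_eq_single j]
    · simp [Matrix.single_apply, and_comm]
    · intro b _ hb; simp [Matrix.single_apply, hb]
    · simp
    · intro b _ hb; simp [Matrix.single_apply, hb]
    · simp
  have h2 : ∑ p : Fin n, ∑ q : Fin n, (Matrix.single q p (1:ℂ) i j) * (Matrix.single p q (1:ℂ) l m) = if i = m ∧ j = l then 1 else 0 := by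
    rw [Finset.sum_comm]; exact h1
  rw [h1, h2]
  split_ifs <;> norm_num

lemma XX_sandwich (B : Matrix (Fin n) (Fin n) ℂ) : ∑ s : IX n, XX s * B * XX s = (-4 * B.trace) • (1 : Matrix (Fin n) (Fin n) ℂ) := by
  ext i j
  simp only [Matrix.sum_apply, Matrix.mul_apply, Finset.sum_mul]
  calc _ = ∑ b, ∑ a, B a b * ∑ s : IX n, XX s i a * XX s b j := by
        rw [Finset.sum_comm]; refine Finset.sum_congr rfl fun b _ => ?_
        rw [Finset.sum_comm]; refine Finset.sum_congr rfl fun a _ => ?_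
        rw [Finset.mul_sum]; refine Finset.sum_congr rfl fun s _ => ?_
        ring
    _ = _ := by
        simp only [XX_sum, Matrix.smul_apply, Matrix.one_apply, Matrix.trace, Matrix.diag, smul_eq_mul]
        by_cases hij : i = j
        · simp [hij, Finset.mul_sum, mul_comm]
        · simp [hij]

lemma XX_proj (N : Matrix (Fin n) (Fin n) ℂ) : ∑ s : IX n, (N * XX s).trace • XX s = (-4 : ℂ) • N := by
  ext i j
  simp only [Matrix.sum_apply, Matrix.smul_apply, Matrix.trace, Matrix.diag, Matrix.mul_apply, Finset.sum_mul, smul_eq_mul]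
  calc _ = ∑ a, ∑ b, N a b * ∑ s : IX n, XX s b a * XX s i j := by
        rw [Finset.sum_comm]; refine Finset.sum_congr rfl fun b _ => ?_
        rw [Finset.sum_comm]; refine Finset.sum_congr rfl fun a _ => ?_
        rw [Finset.mul_sum]; refine Finset.sum_congr rfl fun s _ => ?_
        ring
    _ = _ := by
        simp only [XX_sum]
        rw [Finset.sum_eq_single i, Finset.sum_eq_single j]
        · simp [mul_comm]
        · intro b _ hb; simp [hb]
        · simp
        · intro b _ hb; simp [hb]
        · simp

/-- commutator -/
noncomputable def cm (X A : Matrix (Fin n) (Fin n) ℂ) : Matrix (Fin n) (Fin n) ℂ := X * A - A * X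

lemma cm_herm {X A : Matrix (Fin n) (Fin n) ℂ} (hX : Xᴴ = -X) (hA : A.IsHermitian) : (cm X A).IsHermitian := by
  unfold cm Matrix.IsHermitian
  rw [conjTranspose_sub, conjTranspose_mul, conjTranspose_mul, hX, hA.eq]
  simp [add_comm, sub_eq_add_neg]

lemma cm_cont (X : Matrix (Fin n) (Fin n) ℂ) : Continuous (cm X) := by unfold cm; fun_prop

lemma XX_casimir {A : Matrix (Fin n) (Fin n) ℂ} (hA : A.trace = 0) : ∑ s : IX n, cm (XX s) (cm (XX s) A) = (-(8 * n) : ℝ) • A := by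
  have e : ∀ s : IX n, cm (XX s) (cm (XX s) A) = (XX s * 1 * XX s) * A - (2:ℂ) • (XX s * A * XX s) + A * (XX s * 1 * XX s) := by
    intro s; unfold cm; rw [two_smul]; noncomm_ring
  simp only [e, Finset.sum_add_distrib, Finset.sum_sub_distrib, ← Finset.sum_mul, ← Finset.mul_sum, ← Finset.smul_sum, XX_sandwich, hA]
  ext i j
  simp; ring

lemma XX_second {A Z : Matrix (Fin n) (Fin n) ℂ} (hA : A.IsHermitian) (hZ : Z.IsHermitian) :
    ∑ s : IX n, rp Z (cm (XX s) A) • cm (XX s) A = (4:ℝ) • (Z * A * A + A * A * Z - (2:ℝ) • (A * Z * A)) := by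
  have e : ∀ s : IX n, rp Z (cm (XX s) A) • cm (XX s) A = ((((A * Z - Z * A) * XX s).trace • XX s) * A - A * (((A * Z - Z * A) * XX s).trace • XX s)) := by
    intro s
    have h1 : ((rp Z (cm (XX s) A) : ℝ) : ℂ) = ((A * Z - Z * A) * XX s).trace := by
      rw [rp_cast hZ (cm_herm (XX_skew s) hA), cm, Matrix.mul_sub, Matrix.sub_mul, Matrix.trace_sub, Matrix.trace_sub, ← Matrix.mul_assoc, ← Matrix.mul_assoc, Matrix.trace_mul_comm (Z * XX s), Matrix.mul_assoc A]
    rw [← h1, ← Complex.coe_smul, Matrix.smul_mul, Matrix.mul_smul, ← smul_sub]; rfl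
  simp only [e, Finset.sum_sub_distrib, ← Finset.sum_mul, ← Finset.mul_sum, XX_proj]
  have f1 : (-4:ℂ) • (A * Z - Z * A) * A - A * (-4:ℂ) • (A * Z - Z * A) = (4:ℂ) • (Z * A * A + A * A * Z - (2:ℂ) • (A * Z * A)) := by
    rw [two_smul, Matrix.smul_mul, Matrix.mul_smul, ← smul_sub, neg_smul, ← smul_neg]
    congr 1; noncomm_ring
  rw [f1]
  ext i j; simp

/-- continuously differentiable functions of a matrix -/
structure MC1 (g : Matrix (Fin n) (Fin n) ℂ → ℝ) (Dg : Matrix (Fin n) (Fin n) ℂ → Matrix (Fin n) (Fin n) ℂ →ₗ[ℝ] ℝ) : Prop where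
  cont : Continuous g
  dcont : Continuous fun p : Matrix (Fin n) (Fin n) ℂ × Matrix (Fin n) (Fin n) ℂ => Dg p.1 p.2
  deriv : ∀ (γ : ℝ → Matrix (Fin n) (Fin n) ℂ) (H : Matrix (Fin n) (Fin n) ℂ), (∀ i j, HasDerivAt (fun t => γ t i j) (H i j) 0) → HasDerivAt (fun t => g (γ t)) (Dg (γ 0) H) 0

lemma rp_deriv {k : ℕ} (Z : Matrix (Fin k) (Fin k) ℂ) (γ : ℝ → Matrix (Fin k) (Fin k) ℂ) (H : Matrix (Fin k) (Fin k) ℂ) (h : ∀ i j, HasDerivAt (fun t => γ t i j) (H i j) 0) :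
    HasDerivAt (fun t => rp Z (γ t)) (rp Z H) 0 := by
  have h1 : HasDerivAt (fun t => (Z * γ t).trace) ((Z * H).trace) 0 := by
    simp only [Matrix.trace, Matrix.diag, Matrix.mul_apply]
    exact HasDerivAt.fun_sum fun i _ => HasDerivAt.fun_sum fun j _ => (h j i).const_mul (Z i j)
  exact (Complex.reCLM.hasFDerivAt.comp_hasDerivAt (0:ℝ) h1)

lemma HL.stein {ν : Measure (Matrix (Fin n) (Fin n) ℂ)} {R : ℝ} (h : HL ν R) {Z : Matrix (Fin n) (Fin n) ℂ} (hZ : Z.IsHermitian)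
    (g : Matrix (Fin n) (Fin n) ℂ → ℝ) (Dg : Matrix (Fin n) (Fin n) ℂ → Matrix (Fin n) (Fin n) ℂ →ₗ[ℝ] ℝ) (hg : MC1 g Dg) :
    2 * n * ∫ A, rp Z A * g A ∂ν = ∫ A, Dg A (Z * A * A + A * A * Z - (2:ℝ) • (A * Z * A)) ∂ν := by
  have c1 : ∀ X : Matrix (Fin n) (Fin n) ℂ, Continuous fun A => rp Z (cm X A) * g A := fun X => ((rp_cont Z).comp (cm_cont X)).mul hg.cont
  have c2 : ∀ X : Matrix (Fin n) (Fin n) ℂ, Continuous fun A => rp Z (cm X (cm X A)) * g A := fun X => ((rp_cont Z).comp ((cm_cont X).comp (cm_cont X))).mul hg.cont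
  have c3 : ∀ X : Matrix (Fin n) (Fin n) ℂ, Continuous fun A => rp Z (cm X A) * Dg A (cm X A) := fun X =>
    ((rp_cont Z).comp (cm_cont X)).mul (hg.dcont.comp (continuous_id.prodMk (cm_cont X)))
  have c5 : Continuous fun A : Matrix (Fin n) (Fin n) ℂ => Z * A * A + A * A * Z - (2:ℝ) • (A * Z * A) := by
    have e1 : Continuous fun A : Matrix (Fin n) (Fin n) ℂ => A := continuous_id
    have e2 : Continuous fun _ : Matrix (Fin n) (Fin n) ℂ => Z := continuous_const
    exact (((e2.matrix_mul e1).matrix_mul e1).add ((e1.matrix_mul e1).matrix_mul e2)).sub (((e1.matrix_mul e2).matrix_mul e1).const_smul (2:ℝ))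
  have c4 : ∀ X : Matrix (Fin n) (Fin n) ℂ, Continuous fun A => rp Z (cm X (cm X A)) * g A + rp Z (cm X A) * Dg A (cm X A) := fun X => (c2 X).add (c3 X)
  have key : ∀ s : IX n, ∫ A, (rp Z (cm (XX s) (cm (XX s) A)) * g A + rp Z (cm (XX s) A) * Dg A (cm (XX s) A)) ∂ν = 0 := by
    intro s
    refine h.haar (XX s) (XX_skew s) (fun A => rp Z (cm (XX s) A) * g A) (fun A => rp Z (cm (XX s) (cm (XX s) A)) * g A + rp Z (cm (XX s) A) * Dg A (cm (XX s) A)) (c1 (XX s)) (c4 (XX s)) fun A => ?_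
    have d0 := cj_deriv (XX s) A (XX_skew s)
    have d1 := hg.deriv (cj (XX s) A) _ d0
    have d2 : HasDerivAt (fun t => rp Z (cm (XX s) (cj (XX s) A t))) (rp Z (cm (XX s) (XX s * A - A * XX s))) 0 := by
      refine rp_deriv Z (fun t => cm (XX s) (cj (XX s) A t)) _ fun i j => ?_
      simp only [cm, Matrix.sub_apply, Matrix.mul_apply]
      refine HasDerivAt.fun_sub (HasDerivAt.fun_sum fun l _ => ?_) (HasDerivAt.fun_sum fun l _ => ?_)
      · have := (d0 l j).const_mul (XX s i l)
        simpa only [Matrix.sub_apply, Matrix.mul_apply] using this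
      · have := (d0 i l).mul_const (XX s l j)
        simpa only [Matrix.sub_apply, Matrix.mul_apply] using this
    refine (d2.mul d1).congr_deriv ?_
    rw [cj_zero]; rfl
  have hsum : ∫ A, ∑ s : IX n, (rp Z (cm (XX s) (cm (XX s) A)) * g A + rp Z (cm (XX s) A) * Dg A (cm (XX s) A)) ∂ν = 0 := by
    rw [integral_finsetSum _ fun s _ => h.integrable _ (c4 (XX s))]
    simp [key]
  have hae : ∀ᵐ A ∂ν, ∑ s : IX n, (rp Z (cm (XX s) (cm (XX s) A)) * g A + rp Z (cm (XX s) A) * Dg A (cm (XX s) A))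
      = (-(8 * n)) * (rp Z A * g A) + 4 * Dg A (Z * A * A + A * A * Z - (2:ℝ) • (A * Z * A)) := by
    filter_upwards [h.herm, h.tr] with A hA ht
    rw [Finset.sum_add_distrib, ← Finset.sum_mul, ← rp_sum, XX_casimir ht, rp_smul]
    have : ∑ s : IX n, rp Z (cm (XX s) A) * Dg A (cm (XX s) A) = Dg A (∑ s : IX n, rp Z (cm (XX s) A) • cm (XX s) A) := by
      rw [map_sum]; simp only [map_smul, smul_eq_mul]
    rw [this, XX_second hA hZ, map_smul, smul_eq_mul]; ring
  rw [integral_congr_ae hae] at hsum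
  have i1 : Integrable (fun A => rp Z A * g A) ν := h.integrable _ ((rp_cont Z).mul hg.cont)
  have i2 : Integrable (fun A => Dg A (Z * A * A + A * A * Z - (2:ℝ) • (A * Z * A))) ν :=
    h.integrable _ (hg.dcont.comp (continuous_id.prodMk c5))
  rw [integral_add (i1.const_mul _) (i2.const_mul _), integral_const_mul, integral_const_mul] at hsum
  linarith

end stein

-- Part PE3
section moments
variable {n : ℕ}

lemma HL.mean {ν : Measure (Matrix (Fin n) (Fin n) ℂ)} {R : ℝ} (hn : n ≠ 0) (h : HL ν R) {Z : Matrix (Fin n) (Fin n) ℂ} (hZ : Z.IsHermitian) : ∫ A, rp Z A ∂ν = 0 := by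
  have := h.stein hZ (fun _ => 1) (fun _ => 0) ⟨continuous_const, by simpa using continuous_const, fun γ H _ => by simpa using hasDerivAt_const (0:ℝ) (1:ℝ)⟩
  simp only [mul_one, LinearMap.zero_apply, integral_zero] at this
  have hn' : (n:ℝ) ≠ 0 := by exact_mod_cast hn
  simpa [hn'] using this

/-- pairing as linear map -/
noncomputable def rpL {k : ℕ} (Z : Matrix (Fin k) (Fin k) ℂ) : Matrix (Fin k) (Fin k) ℂ →ₗ[ℝ] ℝ where
  toFun := rp Z
  map_add' := rp_add Z
  map_smul' c B := by simpa using rp_smul c Z B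

lemma rp_sq_ge (B : Matrix (Fin n) (Fin n) ℂ) : -(fro B ^ 2) ≤ (B * B).trace.re := by
  rw [fro_sq]
  simp only [Matrix.trace, Matrix.diag, Matrix.mul_apply, Complex.re_sum]
  have h1 : ∑ i, ∑ j, ‖B i j‖ ^ 2 = ∑ i, ∑ j, (‖B i j‖ ^ 2 + ‖B j i‖ ^ 2) / 2 := by
    simp only [add_div, Finset.sum_add_distrib]
    rw [Finset.sum_comm (f := fun i j => ‖B j i‖ ^ 2 / 2)]
    simp only [← Finset.sum_div]; ring
  rw [h1, ← Finset.sum_neg_distrib]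
  refine Finset.sum_le_sum fun i _ => ?_
  rw [← Finset.sum_neg_distrib]
  refine Finset.sum_le_sum fun j _ => ?_
  have h2 := Complex.abs_re_le_norm (B i j * B j i)
  rw [norm_mul] at h2
  have h3 := neg_abs_le (B i j * B j i).re
  nlinarith [sq_nonneg (‖B i j‖ - ‖B j i‖)]

lemma fro_ZA {Z A : Matrix (Fin n) (Fin n) ℂ} (hZ : Z.IsHermitian) (hA : A.IsHermitian) : fro (Z * A) ^ 2 = rp (Z * Z) (A * A) := by
  apply Complex.ofReal_injective
  rw [rp_cast _ _, fro_sq_trace, conjTranspose_mul, hZ.eq, hA.eq]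
  · rw [← Matrix.mul_assoc, Matrix.trace_mul_comm]; simp only [Matrix.mul_assoc]
  · unfold Matrix.IsHermitian; rw [conjTranspose_mul, hZ.eq]
  · unfold Matrix.IsHermitian; rw [conjTranspose_mul, hA.eq]

lemma HL.second {ν : Measure (Matrix (Fin n) (Fin n) ℂ)} {R : ℝ} (h : HL ν R) {Z : Matrix (Fin n) (Fin n) ℂ} (hZ : Z.IsHermitian) :
    n * ∫ A, rp Z A ^ 2 ∂ν ≤ 2 * ∫ A, rp (Z * Z) (A * A) ∂ν := by
  have h1 := h.stein hZ (rp Z) (fun _ => rpL Z) ⟨rp_cont Z, (rp_cont Z).comp continuous_snd, fun γ H hγ => rp_deriv Z γ H hγ⟩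
  have c5 : Continuous fun A : Matrix (Fin n) (Fin n) ℂ => Z * A * A + A * A * Z - (2:ℝ) • (A * Z * A) := by
    have e1 : Continuous fun A : Matrix (Fin n) (Fin n) ℂ => A := continuous_id
    have e2 : Continuous fun _ : Matrix (Fin n) (Fin n) ℂ => Z := continuous_const
    exact (((e2.matrix_mul e1).matrix_mul e1).add ((e1.matrix_mul e1).matrix_mul e2)).sub (((e1.matrix_mul e2).matrix_mul e1).const_smul (2:ℝ))
  have c6 : Continuous fun A : Matrix (Fin n) (Fin n) ℂ => rp (Z * Z) (A * A) := (rp_cont _).comp (continuous_id.matrix_mul continuous_id)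
  have h2 : ∫ A, rpL Z (Z * A * A + A * A * Z - (2:ℝ) • (A * Z * A)) ∂ν ≤ ∫ A, 4 * rp (Z * Z) (A * A) ∂ν := by
    refine integral_mono_ae (h.integrable _ ((rp_cont Z).comp c5)) ((h.integrable _ c6).const_mul 4) ?_
    filter_upwards [h.herm] with A hA
    have e1 : rp Z (Z * A * A) = rp (Z * Z) (A * A) := by simp only [rp, Matrix.mul_assoc]
    have e2 : rp Z (A * A * Z) = rp (Z * Z) (A * A) := by
      simp only [rp]; rw [← Matrix.mul_assoc, Matrix.trace_mul_comm]; simp only [Matrix.mul_assoc]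
    have e3 : rp Z (A * Z * A) = ((Z * A) * (Z * A)).trace.re := by simp only [rp, Matrix.mul_assoc]
    have e4 := rp_sq_ge (Z * A)
    rw [fro_ZA hZ hA] at e4
    simp only [map_sub, map_add, map_smul, smul_eq_mul]
    change rp Z (Z * A * A) + rp Z (A * A * Z) - 2 * rp Z (A * Z * A) ≤ _
    rw [e1, e2, e3]; linarith
  rw [← h1, integral_const_mul] at h2
  have e : ∀ A, rp Z A * rp Z A = rp Z A ^ 2 := fun A => by ring
  simp only [e] at h2
  linarith

/-- Haar unitary -/
structure HU {Ω : Type*} [MeasurableSpace Ω] (P : Measure Ω) (U : Ω → Matrix (Fin n) (Fin n) ℂ) : Prop where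
  prob : IsProbabilityMeasure P
  meas : Measurable U
  mem : ∀ ω, U ω ∈ Matrix.unitaryGroup (Fin n) ℂ
  inv : ∀ V ∈ Matrix.unitaryGroup (Fin n) ℂ, Measure.map (fun ω => V * U ω) P = Measure.map U P

variable {Ω : Type*} [MeasurableSpace Ω] {P : Measure Ω} {U : Ω → Matrix (Fin n) (Fin n) ℂ}

lemma conj_cont (D : Matrix (Fin n) (Fin n) ℂ) : Continuous fun V : Matrix (Fin n) (Fin n) ℂ => V * D * Vᴴ := by fun_prop

lemma HU.cmeas (h : HU P U) (D : Matrix (Fin n) (Fin n) ℂ) : Measurable fun ω => U ω * D * (U ω)ᴴ := (conj_cont D).measurable.comp h.meas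

lemma HU.law (h : HU P U) {D : Matrix (Fin n) (Fin n) ℂ} (hD : D.IsHermitian) (ht : D.trace = 0) :
    HL (Measure.map (fun ω => U ω * D * (U ω)ᴴ) P) (fro D) := by
  have := h.prob
  have hm := h.cmeas D
  have u1 : ∀ ω, U ω * (U ω)ᴴ = 1 := fun ω => Matrix.mem_unitaryGroup_iff.1 (h.mem ω)
  have u2 : ∀ ω, (U ω)ᴴ * U ω = 1 := fun ω => Matrix.mem_unitaryGroup_iff'.1 (h.mem ω)
  refine ⟨Measure.isProbabilityMeasure_map hm.aemeasurable, fun V hV => ?_, ?_, ?_, ?_⟩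
  · have c1 : Continuous fun A : Matrix (Fin n) (Fin n) ℂ => V * A * Vᴴ := by fun_prop
    have c2 : Continuous fun A : Matrix (Fin n) (Fin n) ℂ => V * A := by fun_prop
    rw [Measure.map_map c1.measurable hm]
    have e1 : ((fun A : Matrix (Fin n) (Fin n) ℂ => V * A * Vᴴ) ∘ fun ω => U ω * D * (U ω)ᴴ) = (fun W => W * D * Wᴴ) ∘ fun ω => V * U ω := by
      funext ω; simp [Matrix.mul_assoc]
    have hVU : Measurable fun ω => V * U ω := c2.measurable.comp h.meas
    rw [e1, ← Measure.map_map (conj_cont D).measurable hVU, h.inv V hV, Measure.map_map (conj_cont D).measurable h.meas]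
    rfl
  · refine (ae_map_iff hm.aemeasurable ?_).2 (ae_of_all _ fun ω => ?_)
    · exact measurableSet_eq_fun (by fun_prop : Continuous fun A : Matrix (Fin n) (Fin n) ℂ => Aᴴ).measurable measurable_id
    · unfold Matrix.IsHermitian; simp [Matrix.mul_assoc, hD.eq]
  · refine (ae_map_iff hm.aemeasurable ?_).2 (ae_of_all _ fun ω => ?_)
    · refine measurableSet_eq_fun ?_ measurable_const
      have : Continuous fun A : Matrix (Fin n) (Fin n) ℂ => fro A := by simp only [fro_eq]; fun_prop
      exact this.measurable
    · rw [fro_mul_unitary, fro_unitary_mul _ _ (u2 ω)]; rw [conjTranspose_conjTranspose]; exact u2 ω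
  · refine (ae_map_iff hm.aemeasurable ?_).2 (ae_of_all _ fun ω => ?_)
    · exact measurableSet_eq_fun (by fun_prop : Continuous fun A : Matrix (Fin n) (Fin n) ℂ => A.trace).measurable measurable_const
    · rw [Matrix.trace_mul_comm, ← Matrix.mul_assoc, u2, Matrix.one_mul, ht]

lemma HU.mean (h : HU P U) (hn : n ≠ 0) {D Z : Matrix (Fin n) (Fin n) ℂ} (hD : D.IsHermitian) (hZ : Z.IsHermitian) :
    ∫ ω, rp Z (U ω * D * (U ω)ᴴ) ∂P = D.trace.re * Z.trace.re / n := by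
  have := h.prob
  have u1 : ∀ ω, U ω * (U ω)ᴴ = 1 := fun ω => Matrix.mem_unitaryGroup_iff.1 (h.mem ω)
  have hn' : (n:ℝ) ≠ 0 := by exact_mod_cast hn
  have hnc : (n:ℂ) ≠ 0 := by exact_mod_cast hn
  have hre : ((D.trace.re : ℝ) : ℂ) = D.trace := by
    refine Complex.conj_eq_iff_re.1 ?_
    rw [starRingEnd_apply, ← Matrix.trace_conjTranspose, hD.eq]
  set c : ℝ := D.trace.re / n with hc
  set D0 := D - c • (1 : Matrix (Fin n) (Fin n) ℂ) with hD0
  have h0 : D0.IsHermitian := by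
    unfold Matrix.IsHermitian; rw [hD0, conjTranspose_sub, hD.eq, conjTranspose_smul]; simp
  have ht : D0.trace = 0 := by
    rw [hD0, Matrix.trace_sub, Matrix.trace_smul, Matrix.trace_one, hc, ← hre]
    simp only [Fintype.card_fin, Complex.real_smul, Complex.ofReal_re]
    push_cast; field_simp; simp
  have hl := h.law h0 ht
  have hm := hl.mean hn hZ
  rw [integral_map (h.cmeas _).aemeasurable (rp_cont Z).aestronglyMeasurable] at hm
  have hi : Integrable (fun ω => rp Z (U ω * D0 * (U ω)ᴴ)) P := by
    have := hl.integrable _ (rp_cont Z)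
    exact this.comp_measurable (h.cmeas _)
  have e : ∀ ω, rp Z (U ω * D * (U ω)ᴴ) = rp Z (U ω * D0 * (U ω)ᴴ) + c * Z.trace.re := by
    intro ω
    have : U ω * D * (U ω)ᴴ = U ω * D0 * (U ω)ᴴ + c • (1 : Matrix (Fin n) (Fin n) ℂ) := by
      rw [hD0, Matrix.mul_sub, Matrix.sub_mul, Matrix.mul_smul, Matrix.mul_one, Matrix.smul_mul, u1]; simp
    rw [this, rp_add, rp_smul]; simp [rp]
  simp only [e]
  rw [integral_add hi (integrable_const _), hm]
  simp [hc]; ring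

lemma HU.second (h : HU P U) (hn : n ≠ 0) {D Z : Matrix (Fin n) (Fin n) ℂ} (hD : D.IsHermitian) (ht : D.trace = 0) (hZ : Z.IsHermitian) :
    ∫ ω, rp Z (U ω * D * (U ω)ᴴ) ^ 2 ∂P ≤ 2 * (fro D ^ 2 * fro Z ^ 2) / (n:ℝ) ^ 2 := by
  have u2 : ∀ ω, (U ω)ᴴ * U ω = 1 := fun ω => Matrix.mem_unitaryGroup_iff'.1 (h.mem ω)
  have hl := (h.law hD ht).second hZ
  have c6 : Continuous fun A : Matrix (Fin n) (Fin n) ℂ => rp (Z * Z) (A * A) := (rp_cont _).comp (continuous_id.matrix_mul continuous_id)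
  have c7 : Continuous fun A : Matrix (Fin n) (Fin n) ℂ => rp Z A ^ 2 := (rp_cont Z).pow 2
  rw [integral_map (h.cmeas _).aemeasurable c7.aestronglyMeasurable, integral_map (h.cmeas _).aemeasurable c6.aestronglyMeasurable] at hl
  have e : ∀ ω, U ω * D * (U ω)ᴴ * (U ω * D * (U ω)ᴴ) = U ω * (D * D) * (U ω)ᴴ := by
    intro ω
    calc _ = U ω * D * ((U ω)ᴴ * U ω) * D * (U ω)ᴴ := by simp only [Matrix.mul_assoc]
      _ = _ := by rw [u2]; simp only [Matrix.mul_assoc, Matrix.one_mul]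
  simp only [e] at hl
  have hh : ∀ {B : Matrix (Fin n) (Fin n) ℂ}, B.IsHermitian → (B * B).IsHermitian := by
    intro B hB; unfold Matrix.IsHermitian; rw [conjTranspose_mul, hB.eq]
  have hf : ∀ {B : Matrix (Fin n) (Fin n) ℂ}, B.IsHermitian → (B * B).trace.re = fro B ^ 2 := by
    intro B hB
    have := fro_sq_trace B
    rw [hB.eq] at this
    rw [← this, Complex.ofReal_re]
  rw [h.mean hn (hh hD) (hh hZ), hf hD, hf hZ] at hl
  have hn' : (0:ℝ) < n := by positivity
  rw [le_div_iff₀ (by positivity)]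
  calc _ = (n * ∫ ω, rp Z (U ω * D * (U ω)ᴴ) ^ 2 ∂P) * n := by ring
    _ ≤ (2 * (fro D ^ 2 * fro Z ^ 2 / n)) * n := by gcongr
    _ = _ := by field_simp

/-- coordinates -/
def tau {k : ℕ} (N : Matrix (Fin k) (Fin k) ℂ) : IX k → ℝ := fun s => if s.2.2 then (N s.1 s.2.1).im else (N s.1 s.2.1).re

lemma TT_tau {k : ℕ} {N : Matrix (Fin k) (Fin k) ℂ} (hN : N.IsHermitian) : TT (tau N) = N := by
  ext i j
  rw [TT_apply]
  simp only [tau, Bool.false_eq_true, if_false, if_true]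
  have h : N j i = star (N i j) := by have := congrFun (congrFun hN j) i; simpa using this.symm
  rw [h]
  apply Complex.ext <;> simp <;> ring

lemma rp_TT {k : ℕ} {N : Matrix (Fin k) (Fin k) ℂ} (hN : N.IsHermitian) (x : IX k → ℝ) : rp (TT x) N = ∑ s, x s * tau N s := by
  have h : ∀ i j, N j i = star (N i j) := fun i j => by have := congrFun (congrFun hN j) i; simpa using this.symm
  simp only [rp, Matrix.trace, Matrix.diag, Matrix.mul_apply, Complex.re_sum, IX, Fintype.sum_prod_type, Fintype.sum_bool]
  have e1 : ∀ i j : Fin k, (TT x i j * N j i).re = (x (i, j, true) * tau N (i, j, true) + x (i, j, false) * tau N (i, j, false)) / 2 + (x (j, i, true) * tau N (j, i, true) + x (j, i, false) * tau N (j, i, false)) / 2 := by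
    intro i j
    rw [TT_apply]
    simp only [tau, Bool.false_eq_true, if_false, if_true]
    rw [h i j]
    simp; ring
  simp only [e1, Finset.sum_add_distrib]
  rw [Finset.sum_comm (f := fun i j => (x (j, i, true) * tau N (j, i, true) + x (j, i, false) * tau N (j, i, false)) / 2)]
  simp only [add_div, Finset.sum_add_distrib, ← Finset.sum_div]; ring

lemma fro_single {k : ℕ} (p q : Fin k) : fro (Matrix.single p q (1:ℂ)) = 1 := by
  rw [fro_eq, Real.sqrt_eq_one]
  rw [Finset.sum_eq_single p, Finset.sum_eq_single q]
  · simp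
  · intro b _ hb; simp [Matrix.single_apply, hb.symm]
  · simp
  · intro b _ hb; simp [Matrix.single_apply, hb.symm]
  · simp

lemma fro_TT_single {k : ℕ} (s : IX k) : fro (TT (Pi.single s 1)) ≤ 1 := by
  obtain ⟨p, q, b⟩ := s
  cases b
  · rw [TT_single_false, fro_smul]
    have := fro_add_le (Matrix.single p q (1:ℂ)) (Matrix.single q p 1)
    rw [fro_single, fro_single] at this
    norm_num; linarith
  · rw [TT_single_true, fro_smul]
    have := fro_add_le (Complex.I • Matrix.single p q (1:ℂ)) (-(Complex.I • Matrix.single q p 1))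
    rw [fro_neg, fro_smul, fro_smul, fro_single, fro_single, ← sub_eq_add_neg, Complex.norm_I] at this
    norm_num at this ⊢; linarith

lemma HU.entry (h : HU P U) (hn : n ≠ 0) {D : Matrix (Fin n) (Fin n) ℂ} (hD : D.IsHermitian) (ht : D.trace = 0) (i j : Fin n) :
    ∫ ω, ‖(U ω * D * (U ω)ᴴ) i j‖ ^ 2 ∂P ≤ 4 * fro D ^ 2 / (n:ℝ) ^ 2 := by
  have hH : ∀ ω, (U ω * D * (U ω)ᴴ).IsHermitian := fun ω => by unfold Matrix.IsHermitian; simp [Matrix.mul_assoc, hD.eq]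
  have e1 : ∀ (s : IX n) ω, rp (TT (Pi.single s 1)) (U ω * D * (U ω)ᴴ) = tau (U ω * D * (U ω)ᴴ) s := by
    intro s ω; rw [rp_TT (hH ω)]; simp [Pi.single_apply]
  have e2 : ∀ ω, ‖(U ω * D * (U ω)ᴴ) i j‖ ^ 2 = rp (TT (Pi.single (i, j, false) 1)) (U ω * D * (U ω)ᴴ) ^ 2 + rp (TT (Pi.single (i, j, true) 1)) (U ω * D * (U ω)ᴴ) ^ 2 := by
    intro ω
    rw [e1, e1, ← Complex.normSq_eq_norm_sq, Complex.normSq_apply]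
    simp [tau]; ring
  have b : ∀ s : IX n, ∫ ω, rp (TT (Pi.single s 1)) (U ω * D * (U ω)ᴴ) ^ 2 ∂P ≤ 2 * fro D ^ 2 / (n:ℝ) ^ 2 := by
    intro s
    refine (h.second hn hD ht (TT_herm _)).trans ?_
    have := fro_TT_single s
    have h0 := fro_nonneg (TT (Pi.single s 1))
    gcongr
    have h1 : fro (TT (Pi.single s 1)) ^ 2 ≤ 1 := by nlinarith
    nlinarith [sq_nonneg (fro D)]
  have hi : ∀ s : IX n, Integrable (fun ω => rp (TT (Pi.single s 1)) (U ω * D * (U ω)ᴴ) ^ 2) P := by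
    intro s
    have := (h.law hD ht).integrable _ ((rp_cont (TT (Pi.single s 1))).pow 2)
    exact this.comp_measurable (h.cmeas _)
  simp only [e2]
  rw [integral_add (hi _) (hi _)]
  have := add_le_add (b (i, j, false)) (b (i, j, true))
  refine this.trans (le_of_eq ?_); ring

end moments

-- Part PE4
section interp
variable {n k : ℕ}

/-- upper-left corner -/
def cor (hkn : k ≤ n) (A : Matrix (Fin n) (Fin n) ℂ) : Matrix (Fin k) (Fin k) ℂ := A.submatrix (Fin.castLE hkn) (Fin.castLE hkn)

/-- isometric embedding -/
def JJ (hkn : k ≤ n) : Matrix (Fin n) (Fin k) ℂ := (1 : Matrix (Fin n) (Fin n) ℂ).submatrix id (Fin.castLE hkn)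

lemma JJ_iso (hkn : k ≤ n) : (JJ hkn)ᴴ * JJ hkn = 1 := by
  ext i j
  simp [JJ, Matrix.mul_apply, Matrix.one_apply]

lemma cor_eq (hkn : k ≤ n) (A : Matrix (Fin n) (Fin n) ℂ) : cor hkn A = (JJ hkn)ᴴ * A * JJ hkn := by
  ext i j
  simp [JJ, cor, Matrix.mul_apply, Matrix.one_apply]

lemma cor_add (hkn : k ≤ n) (A B : Matrix (Fin n) (Fin n) ℂ) : cor hkn (A + B) = cor hkn A + cor hkn B := rfl
lemma cor_sub (hkn : k ≤ n) (A B : Matrix (Fin n) (Fin n) ℂ) : cor hkn (A - B) = cor hkn A - cor hkn B := rfl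
lemma cor_smul (hkn : k ≤ n) (c : ℝ) (A : Matrix (Fin n) (Fin n) ℂ) : cor hkn (c • A) = c • cor hkn A := rfl
lemma cor_herm (hkn : k ≤ n) {A : Matrix (Fin n) (Fin n) ℂ} (hA : A.IsHermitian) : (cor hkn A).IsHermitian := hA.submatrix _
lemma cor_cont (hkn : k ≤ n) : Continuous (cor hkn) := by unfold cor; fun_prop

/-- embedding of small matrices -/
def emb (hkn : k ≤ n) (Z : Matrix (Fin k) (Fin k) ℂ) : Matrix (Fin n) (Fin n) ℂ := JJ hkn * Z * (JJ hkn)ᴴ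

lemma emb_herm (hkn : k ≤ n) {Z : Matrix (Fin k) (Fin k) ℂ} (hZ : Z.IsHermitian) : (emb hkn Z).IsHermitian := by
  unfold Matrix.IsHermitian emb; simp [Matrix.mul_assoc, hZ.eq]

lemma rp_emb (hkn : k ≤ n) (Z : Matrix (Fin k) (Fin k) ℂ) (A : Matrix (Fin n) (Fin n) ℂ) : rp (emb hkn Z) A = rp Z (cor hkn A) := by
  unfold rp emb
  rw [cor_eq]
  have : JJ hkn * Z * (JJ hkn)ᴴ * A = JJ hkn * (Z * ((JJ hkn)ᴴ * A)) := by simp only [Matrix.mul_assoc]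
  rw [this, Matrix.trace_mul_comm]; simp only [Matrix.mul_assoc]

lemma cor_stein (hkn : k ≤ n) (Z : Matrix (Fin k) (Fin k) ℂ) (A : Matrix (Fin n) (Fin n) ℂ) :
    cor hkn (emb hkn Z * A * A + A * A * emb hkn Z - (2:ℝ) • (A * emb hkn Z * A)) =
      Z * cor hkn (A * A) + cor hkn (A * A) * Z - (2:ℝ) • (cor hkn A * Z * cor hkn A) := by
  rw [cor_sub, cor_add, cor_smul]
  simp only [cor_eq, emb]
  have j := JJ_iso hkn
  have e1 : (JJ hkn)ᴴ * (JJ hkn * Z * (JJ hkn)ᴴ * A * A) * JJ hkn = Z * ((JJ hkn)ᴴ * (A * A) * JJ hkn) := by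
    calc _ = ((JJ hkn)ᴴ * JJ hkn) * (Z * ((JJ hkn)ᴴ * (A * A) * JJ hkn)) := by simp only [Matrix.mul_assoc]
      _ = _ := by rw [j, Matrix.one_mul]
  have e2 : (JJ hkn)ᴴ * (A * A * (JJ hkn * Z * (JJ hkn)ᴴ)) * JJ hkn = (JJ hkn)ᴴ * (A * A) * JJ hkn * Z := by
    calc _ = (JJ hkn)ᴴ * (A * A) * JJ hkn * Z * ((JJ hkn)ᴴ * JJ hkn) := by simp only [Matrix.mul_assoc]
      _ = _ := by rw [j, Matrix.mul_one]
  rw [e1, e2]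
  simp only [Matrix.mul_assoc]

/-- coordinates of the scaled corner -/
noncomputable def mA (hkn : k ≤ n) (c : ℝ) : Matrix (Fin n) (Fin n) ℂ →ₗ[ℝ] (IX k → ℝ) where
  toFun A := tau (c • cor hkn A)
  map_add' A B := by
    ext s; simp only [tau, cor, Pi.add_apply, Matrix.smul_apply, Matrix.submatrix_apply, Matrix.add_apply, smul_add, Complex.add_re, Complex.add_im]
    split_ifs <;> rfl
  map_smul' a A := by
    ext s; simp only [tau, cor, Pi.smul_apply, Matrix.smul_apply, Matrix.submatrix_apply]
    split_ifs <;> simp <;> ring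

lemma mA_apply (hkn : k ≤ n) (c : ℝ) (A : Matrix (Fin n) (Fin n) ℂ) : mA hkn c A = tau (c • cor hkn A) := rfl

lemma tau_cont : Continuous (tau (k := k)) := by
  refine continuous_pi fun s => ?_
  unfold tau
  split_ifs
  · exact Complex.continuous_im.comp (by fun_prop)
  · exact Complex.continuous_re.comp (by fun_prop)

lemma mA_cont (hkn : k ≤ n) (c : ℝ) : Continuous (mA hkn c : Matrix (Fin n) (Fin n) ℂ → IX k → ℝ) :=
  tau_cont.comp ((cor_cont hkn).const_smul c)

lemma smul_herm {m : ℕ} (c : ℝ) {A : Matrix (Fin m) (Fin m) ℂ} (hA : A.IsHermitian) : (c • A).IsHermitian := by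
  unfold Matrix.IsHermitian; rw [conjTranspose_smul, hA.eq]; simp

lemma TT_mA (hkn : k ≤ n) (c : ℝ) {A : Matrix (Fin n) (Fin n) ℂ} (hA : A.IsHermitian) : TT (mA hkn c A) = c • cor hkn A :=
  TT_tau (smul_herm c (cor_herm hkn hA))

lemma mA_deriv (hkn : k ≤ n) (c : ℝ) (γ : ℝ → Matrix (Fin n) (Fin n) ℂ) (H : Matrix (Fin n) (Fin n) ℂ) (h : ∀ i j, HasDerivAt (fun t => γ t i j) (H i j) 0) :
    HasDerivAt (fun t => mA hkn c (γ t)) (mA hkn c H) 0 := by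
  refine hasDerivAt_pi.2 fun s => ?_
  obtain ⟨p, q, b⟩ := s
  have h1 := (h (Fin.castLE hkn p) (Fin.castLE hkn q)).const_smul c
  cases b
  · exact (Complex.reCLM.hasFDerivAt.comp_hasDerivAt (0:ℝ) h1)
  · exact (Complex.imCLM.hasFDerivAt.comp_hasDerivAt (0:ℝ) h1)

/-- smooth test functions -/
structure SF (f : (IX k → ℝ) → ℝ) (L : ℝ) : Prop where
  smooth : ContDiff ℝ 1 f
  pos : 0 ≤ L
  lip : ∀ x y, |f x - f y| ≤ L * fro (TT (x - y))

variable {f : (IX k → ℝ) → ℝ} {L : ℝ}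

lemma TT_cont : Continuous (TT (k := k)) := continuous_pi fun i => continuous_pi fun j => (TT_EB i j).cont
lemma fro_cont {m : ℕ} : Continuous fun A : Matrix (Fin m) (Fin m) ℂ => fro A := by simp only [fro_eq]; fun_prop

lemma SF.diff (h : SF f L) (x : IX k → ℝ) : HasFDerivAt f (fderiv ℝ f x) x := (h.smooth.differentiable (by norm_num) x).hasFDerivAt
lemma SF.dcont (h : SF f L) : Continuous (fderiv ℝ f) := h.smooth.continuous_fderiv (by norm_num)

lemma SF.dbound (h : SF f L) (x v : IX k → ℝ) : |fderiv ℝ f x v| ≤ L * fro (TT v) := by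
  have h1 : HasDerivAt (fun t : ℝ => x + t • v) v 0 := by
    have := ((hasDerivAt_id (0:ℝ)).smul_const v).const_add x
    exact this.congr_deriv (by simp)
  have h0 : HasFDerivAt f (fderiv ℝ f x) (x + (0:ℝ) • v) := by rw [zero_smul, add_zero]; exact h.diff x
  have h2 : HasDerivAt (fun t : ℝ => f (x + t • v)) (fderiv ℝ f x v) 0 := h0.comp_hasDerivAt (0:ℝ) h1
  have h3 := h2.tendsto_slope_zero
  have h4 := h3.abs
  refine le_of_tendsto h4 ?_
  filter_upwards [self_mem_nhdsWithin] with t ht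
  have ht' : t ≠ 0 := ht
  simp only [zero_add, zero_smul, add_zero, smul_eq_mul, abs_mul, abs_inv]
  have := h.lip (x + t • v) x
  rw [add_sub_cancel_left, TT_smul, fro_rsmul] at this
  rw [inv_mul_le_iff₀ (abs_pos.2 ht')]
  linarith

end interp

-- Part PE5
section interp2
variable {n k : ℕ} {f : (IX k → ℝ) → ℝ} {L : ℝ} {ν : Measure (Matrix (Fin n) (Fin n) ℂ)} {R : ℝ}

/-- interpolation point -/
noncomputable def WW (hkn : k ≤ n) (c θ : ℝ) (A : Matrix (Fin n) (Fin n) ℂ) (x : IX k → ℝ) : IX k → ℝ := Real.cos θ • mA hkn c A + Real.sin θ • x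

lemma WW_cont (hkn : k ≤ n) (c θ : ℝ) : Continuous fun p : Matrix (Fin n) (Fin n) ℂ × (IX k → ℝ) => WW hkn c θ p.1 p.2 := by
  unfold WW
  have h1 : Continuous fun p : Matrix (Fin n) (Fin n) ℂ × (IX k → ℝ) => mA hkn c p.1 := (mA_cont hkn c).comp continuous_fst
  exact (h1.const_smul (Real.cos θ)).add (continuous_snd.const_smul (Real.sin θ))

/-- the Stein matrix -/
noncomputable def SH (hkn : k ≤ n) (A : Matrix (Fin n) (Fin n) ℂ) (x : IX k → ℝ) : Matrix (Fin n) (Fin n) ℂ :=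
  emb hkn (TT x) * A * A + A * A * emb hkn (TT x) - (2:ℝ) • (A * emb hkn (TT x) * A)

lemma SH_cont (hkn : k ≤ n) : Continuous fun p : Matrix (Fin n) (Fin n) ℂ × (IX k → ℝ) => SH hkn p.1 p.2 := by
  have h : Continuous fun p : Matrix (Fin n) (Fin n) ℂ × (IX k → ℝ) => emb hkn (TT p.2) := by
    unfold emb
    exact (continuous_const.matrix_mul (TT_cont.comp continuous_snd)).matrix_mul continuous_const
  have h1 : Continuous fun p : Matrix (Fin n) (Fin n) ℂ × (IX k → ℝ) => p.1 := continuous_fst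
  have h2 : Continuous fun p : Matrix (Fin n) (Fin n) ℂ × (IX k → ℝ) => (2:ℝ) • (p.1 * emb hkn (TT p.2) * p.1) := ((h1.matrix_mul h).matrix_mul h1).const_smul (2:ℝ)
  unfold SH
  exact (((h.matrix_mul h1).matrix_mul h1).add ((h1.matrix_mul h1).matrix_mul h)).sub h2

lemma SH_herm (hkn : k ≤ n) {A : Matrix (Fin n) (Fin n) ℂ} (hA : A.IsHermitian) (x : IX k → ℝ) : (SH hkn A x).IsHermitian := by
  have h := (emb_herm hkn (TT_herm x)).eq
  unfold Matrix.IsHermitian SH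
  rw [conjTranspose_sub, conjTranspose_add, conjTranspose_smul]
  simp only [conjTranspose_mul, hA.eq, h, star_trivial, Matrix.mul_assoc]
  rw [add_comm]

lemma SF.mc1 (hf : SF f L) (hkn : k ≤ n) (c θ : ℝ) (x : IX k → ℝ) :
    MC1 (fun A => f (WW hkn c θ A x)) (fun A => Real.cos θ • ((fderiv ℝ f (WW hkn c θ A x)).toLinearMap ∘ₗ mA hkn c)) := by
  have hW : Continuous fun A : Matrix (Fin n) (Fin n) ℂ => WW hkn c θ A x := (WW_cont hkn c θ).comp (continuous_id.prodMk continuous_const)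
  refine ⟨hf.smooth.continuous.comp hW, ?_, fun γ H h => ?_⟩
  · have h1 : Continuous fun p : Matrix (Fin n) (Fin n) ℂ × Matrix (Fin n) (Fin n) ℂ => fderiv ℝ f (WW hkn c θ p.1 x) (mA hkn c p.2) :=
      (hf.dcont.comp (hW.comp continuous_fst)).clm_apply ((mA_cont hkn c).comp continuous_snd)
    exact continuous_const.mul h1
  · have h1 := ((mA_deriv hkn c γ H h).const_smul (Real.cos θ)).add_const (Real.sin θ • x)
    have h2 : HasDerivAt (fun t => f (WW hkn c θ (γ t) x)) (fderiv ℝ f (WW hkn c θ (γ 0) x) (Real.cos θ • mA hkn c H)) 0 :=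
      HasFDerivAt.comp_hasDerivAt (0:ℝ) (hf.diff (WW hkn c θ (γ 0) x)) h1
    refine h2.congr_deriv ?_
    simp

lemma haar_side (h : HL ν R) (hn : n ≠ 0) (hf : SF f L) (hkn : k ≤ n) (c θ : ℝ) (x : IX k → ℝ) :
    ∫ A, (∑ s, x s * mA hkn c A s) * f (WW hkn c θ A x) ∂ν = Real.cos θ * ∫ A, fderiv ℝ f (WW hkn c θ A x) (mA hkn (c ^ 2 / (2 * n)) (SH hkn A x)) ∂ν := by
  have hn' : (n:ℝ) ≠ 0 := by exact_mod_cast hn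
  have e := h.stein (emb_herm hkn (TT_herm x)) _ _ (hf.mc1 hkn c θ x)
  have e1 : ∫ A, (∑ s, x s * mA hkn c A s) * f (WW hkn c θ A x) ∂ν = c * ∫ A, rp (emb hkn (TT x)) A * f (WW hkn c θ A x) ∂ν := by
    rw [← integral_const_mul]
    refine integral_congr_ae ?_
    filter_upwards [h.herm] with A hA
    rw [rp_emb, mA_apply, ← rp_TT (smul_herm c (cor_herm hkn hA)), rp_smul, mul_assoc]
  have e2 : ∀ A, fderiv ℝ f (WW hkn c θ A x) (mA hkn (c ^ 2 / (2 * n)) (SH hkn A x)) = (c / (2 * n)) * fderiv ℝ f (WW hkn c θ A x) (mA hkn c (SH hkn A x)) := by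
    intro A
    have e0 : (c / (2 * n)) * fderiv ℝ f (WW hkn c θ A x) (mA hkn c (SH hkn A x)) = fderiv ℝ f (WW hkn c θ A x) ((c / (2 * n)) • mA hkn c (SH hkn A x)) := by rw [map_smul, smul_eq_mul]
    rw [e0]
    congr 1
    ext s
    simp only [mA_apply, tau, Pi.smul_apply, Matrix.smul_apply]
    split_ifs <;> simp only [Complex.smul_re, Complex.smul_im, smul_eq_mul] <;> ring
  simp only [e2]
  rw [e1, integral_const_mul]
  have e3 : ∫ A, (Real.cos θ • ((fderiv ℝ f (WW hkn c θ A x)).toLinearMap ∘ₗ mA hkn c)) (SH hkn A x) ∂ν = Real.cos θ * ∫ A, fderiv ℝ f (WW hkn c θ A x) (mA hkn c (SH hkn A x)) ∂ν := by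
    rw [← integral_const_mul]; rfl
  have e4 : 2 * (n:ℝ) * ∫ A, rp (emb hkn (TT x)) A * f (WW hkn c θ A x) ∂ν = _ := e.trans e3
  have e5 : ∫ A, rp (emb hkn (TT x)) A * f (WW hkn c θ A x) ∂ν = (Real.cos θ * ∫ A, fderiv ℝ f (WW hkn c θ A x) (mA hkn c (SH hkn A x)) ∂ν) / (2 * n) := by
    rw [eq_div_iff (by positivity), ← e4]; ring
  rw [e5]; ring

lemma fTT_EB : EB fun x : IX k → ℝ => fro (TT x) :=
  EB.lin (fro_cont.comp TT_cont) (2 * k) 0 (by positivity) fun x => by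
    rw [Real.norm_of_nonneg (fro_nonneg _), add_zero]; exact TT_fro_le x

lemma fTT_add (x y : IX k → ℝ) : fro (TT (x + y)) ≤ fro (TT x) + fro (TT y) := by rw [TT_add]; exact fro_add_le _ _

lemma SF.grow (hf : SF f L) (hkn : k ≤ n) (c θ : ℝ) (A : Matrix (Fin n) (Fin n) ℂ) (x : IX k → ℝ) :
    |f (WW hkn c θ A x)| ≤ (1 + |f 0| + L * fro (TT (mA hkn c A))) * (1 + L * fro (TT x)) := by
  have h1 := hf.lip (WW hkn c θ A x) 0
  rw [sub_zero] at h1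
  have h2 : fro (TT (WW hkn c θ A x)) ≤ fro (TT (mA hkn c A)) + fro (TT x) := by
    unfold WW
    refine (fTT_add _ _).trans ?_
    rw [TT_smul, TT_smul, fro_rsmul, fro_rsmul]
    have a1 := Real.abs_cos_le_one θ
    have a2 := Real.abs_sin_le_one θ
    nlinarith [fro_nonneg (TT (mA hkn c A)), fro_nonneg (TT x)]
  have h3 := abs_sub_abs_le_abs_sub (f (WW hkn c θ A x)) (f 0)
  have h4 := mul_le_mul_of_nonneg_left h2 hf.pos
  have h5 := mul_nonneg hf.pos (fro_nonneg (TT (mA hkn c A)))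
  have h6 := mul_nonneg hf.pos (fro_nonneg (TT x))
  nlinarith [abs_nonneg (f 0)]

lemma gauss_side (hf : SF f L) (hkn : k ≤ n) (c θ : ℝ) (A : Matrix (Fin n) (Fin n) ℂ) :
    ∫ x, (∑ s, x s * mA hkn c A s) * f (WW hkn c θ A x) ∂(gp (IX k)) = Real.sin θ * ∫ x, fderiv ℝ f (WW hkn c θ A x) (mA hkn c A) ∂(gp (IX k)) := by
  have hW : Continuous fun x : IX k → ℝ => WW hkn c θ A x := (WW_cont hkn c θ).comp (continuous_const.prodMk continuous_id)
  have E1 : EB fun x => f (WW hkn c θ A x) := by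
    have hb : EB fun x : IX k → ℝ => (1 + |f 0| + L * fro (TT (mA hkn c A))) * (1 + L * fro (TT x)) :=
      (EB.const _).mul ((EB.const _).add ((EB.const _).mul fTT_EB))
    refine EB.of_le (hf.smooth.continuous.comp hW) hb fun x => ?_
    exact (hf.grow hkn c θ A x).trans (le_abs_self _)
  have E2 : ∀ v : IX k → ℝ, EB fun x => fderiv ℝ f (WW hkn c θ A x) v := fun v =>
    EB.bdd ((hf.dcont.comp hW).clm_apply continuous_const) (L * fro (TT v)) fun x => hf.dbound _ _
  have ibp : ∀ s, ∫ x, x s * f (WW hkn c θ A x) ∂(gp (IX k)) = ∫ x, Real.sin θ * fderiv ℝ f (WW hkn c θ A x) (Pi.single s 1) ∂(gp (IX k)) := by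
    intro s
    apply Complex.ofReal_injective
    rw [← integral_complex_ofReal, ← integral_complex_ofReal]
    have := gauss_ibp s (fun x => ((f (WW hkn c θ A x) : ℝ) : ℂ)) (fun x => ((Real.sin θ * fderiv ℝ f (WW hkn c θ A x) (Pi.single s 1) : ℝ) : ℂ)) E1.ofReal ((EB.const _).mul (E2 _)).ofReal ?_
    · rw [← this]; simp only [Complex.ofReal_mul]
    · intro x
      refine HasDerivAt.ofReal_comp ?_
      have h1 : HasDerivAt (fun y => WW hkn c θ A (Function.update x s y)) (Real.sin θ • (Pi.single s 1 : IX k → ℝ)) (x s) := by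
        unfold WW
        exact ((hasDerivAt_update x s (x s)).const_smul (Real.sin θ)).const_add _
      have h0 : HasFDerivAt f (fderiv ℝ f (WW hkn c θ A x)) (WW hkn c θ A (Function.update x s (x s))) := by
        rw [Function.update_eq_self]; exact hf.diff _
      have h2 := h0.comp_hasDerivAt (x s) h1
      refine h2.congr_deriv ?_
      simp
  have e1 : ∀ x : IX k → ℝ, (∑ s, x s * mA hkn c A s) * f (WW hkn c θ A x) = ∑ s, mA hkn c A s * (x s * f (WW hkn c θ A x)) := by
    intro x; rw [Finset.sum_mul]; refine Finset.sum_congr rfl fun s _ => by ring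
  have e2 : ∀ x : IX k → ℝ, fderiv ℝ f (WW hkn c θ A x) (mA hkn c A) = ∑ s, mA hkn c A s * fderiv ℝ f (WW hkn c θ A x) (Pi.single s 1) := by
    intro x
    conv_lhs => rw [pi_eq_sum_univ' (mA hkn c A)]
    rw [map_sum]
    refine Finset.sum_congr rfl fun s _ => ?_
    rw [map_smul, smul_eq_mul]
  simp only [e1, e2]
  rw [integral_finsetSum _ fun s _ => (((EB.coord s).mul E1).intp).const_mul _, integral_finsetSum _ fun s _ => ((E2 _).intp).const_mul _, Finset.mul_sum]
  refine Finset.sum_congr rfl fun s _ => ?_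
  rw [integral_const_mul, ibp, integral_const_mul, integral_const_mul]; ring

end interp2

-- Part PE6
section interp3
variable {n k : ℕ} {f : (IX k → ℝ) → ℝ} {L : ℝ} {ν : Measure (Matrix (Fin n) (Fin n) ℂ)} {R : ℝ}

lemma HL.prodint (h : HL ν R) (g : Matrix (Fin n) (Fin n) ℂ × (IX k → ℝ) → ℝ) (hg : Continuous g)
    (a : Matrix (Fin n) (Fin n) ℂ → ℝ) (ha : Continuous a) (b : (IX k → ℝ) → ℝ) (hb : EB b)
    (hab : ∀ A x, A.IsHermitian → |g (A, x)| ≤ a A * b x) : Integrable g (ν.prod (gp (IX k))) := by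
  have := h.prob
  refine ((h.integrable a ha).mul_prod hb.intp).mono' hg.aestronglyMeasurable ?_
  have h1 : ∀ᵐ p ∂(ν.prod (gp (IX k))), p.1.IsHermitian := Measure.quasiMeasurePreserving_fst.ae h.herm
  filter_upwards [h1] with p hp
  exact hab p.1 p.2 hp

/-- residual direction -/
noncomputable def vv (hkn : k ≤ n) (c : ℝ) (A : Matrix (Fin n) (Fin n) ℂ) (x : IX k → ℝ) : IX k → ℝ := x - mA hkn (c ^ 2 / (2 * n)) (SH hkn A x)

/-- size of the residual -/
noncomputable def qq (hkn : k ≤ n) (c : ℝ) (A : Matrix (Fin n) (Fin n) ℂ) : ℝ :=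
  fro ((1 : Matrix (Fin k) (Fin k) ℂ) - (c ^ 2 / n) • cor hkn (A * A)) + (c ^ 2 / n) * fro (cor hkn A) ^ 2

lemma qq_cont (hkn : k ≤ n) (c : ℝ) : Continuous (qq hkn c) := by
  unfold qq
  have h1 : Continuous fun A : Matrix (Fin n) (Fin n) ℂ => cor hkn (A * A) := (cor_cont hkn).comp (continuous_id.matrix_mul continuous_id)
  have h2 : Continuous fun A : Matrix (Fin n) (Fin n) ℂ => (1 : Matrix (Fin k) (Fin k) ℂ) - (c ^ 2 / n) • cor hkn (A * A) := continuous_const.sub (h1.const_smul (c ^ 2 / (n:ℝ)))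
  exact (fro_cont.comp h2).add (continuous_const.mul ((fro_cont.comp (cor_cont hkn)).pow 2))

lemma vv_bound (hkn : k ≤ n) (c : ℝ) {A : Matrix (Fin n) (Fin n) ℂ} (hA : A.IsHermitian) (x : IX k → ℝ) :
    fro (TT (vv hkn c A x)) ≤ qq hkn c A * fro (TT x) := by
  have e : TT (vv hkn c A x) = (1/2 : ℝ) • ((1 - (c ^ 2 / n) • cor hkn (A * A)) * TT x) + ((1/2 : ℝ) • (TT x * (1 - (c ^ 2 / n) • cor hkn (A * A))) + (c ^ 2 / (n:ℝ)) • (cor hkn A * TT x * cor hkn A)) := by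
    unfold vv
    rw [sub_eq_add_neg, TT_add, ← neg_one_smul ℝ (mA _ _ _), TT_smul, TT_mA hkn _ (SH_herm hkn hA x), SH, cor_stein]
    simp only [Matrix.sub_mul, Matrix.mul_sub, Matrix.one_mul, Matrix.mul_one, Matrix.smul_mul, Matrix.mul_smul]
    have : (c ^ 2 / (2 * n) : ℝ) = (1/2) * (c ^ 2 / n) := by ring
    rw [this]
    module
  rw [e]
  refine (fro_add_le _ _).trans ((add_le_add_right (fro_add_le _ _) _).trans ?_)
  rw [fro_rsmul, fro_rsmul, fro_rsmul]
  have h1 := fro_mul_le (1 - (c ^ 2 / (n:ℝ)) • cor hkn (A * A)) (TT x)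
  have h2 := fro_mul_le (TT x) (1 - (c ^ 2 / (n:ℝ)) • cor hkn (A * A))
  have h3 := fro_mul_le (cor hkn A * TT x) (cor hkn A)
  have h4 := fro_mul_le (cor hkn A) (TT x)
  have h5 := mul_le_mul_of_nonneg_right h4 (fro_nonneg (cor hkn A))
  have h6 : 0 ≤ c ^ 2 / (n:ℝ) := by positivity
  have h7 := mul_le_mul_of_nonneg_left (h3.trans h5) h6
  rw [abs_of_nonneg h6, abs_of_nonneg (by norm_num : (0:ℝ) ≤ 1/2)]
  unfold qq
  nlinarith

lemma gue_fro1 : ∫ x : IX k → ℝ, fro (TT x) ∂(gp (IX k)) ≤ k := by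
  have h1 : ∀ x : IX k → ℝ, 2 * k * fro (TT x) ≤ fro (TT x) ^ 2 + k ^ 2 := fun x => by nlinarith [sq_nonneg (fro (TT x) - k)]
  have h2 := integral_mono (μ := gp (IX k)) (fTT_EB.intp.const_mul _) (fro_sq_int.add (integrable_const _)) h1
  have h3 : ∫ x : IX k → ℝ, (fro (TT x) ^ 2 + (k:ℝ) ^ 2) ∂(gp (IX k)) = (k:ℝ) ^ 2 + (k:ℝ) ^ 2 := by
    rw [integral_add fro_sq_int (integrable_const _), gue_fro]; simp
  have h4 : 2 * (k:ℝ) * ∫ x : IX k → ℝ, fro (TT x) ∂(gp (IX k)) ≤ (k:ℝ) ^ 2 + (k:ℝ) ^ 2 := by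
    rw [← h3, ← integral_const_mul]; exact h2
  rcases Nat.eq_zero_or_pos k with rfl | hk
  · simp [fro_eq]
  · have hk' : (0:ℝ) < k := by exact_mod_cast hk
    nlinarith

lemma HL.interp (h : HL ν R) (hn : n ≠ 0) (hf : SF f L) (hkn : k ≤ n) (c : ℝ) :
    |∫ A, f (mA hkn c A) ∂ν - ∫ x, f x ∂(gp (IX k))| ≤ 2 * (L * k * ∫ A, qq hkn c A ∂ν) := by
  have hp := h.prob
  set μ := ν.prod (gp (IX k)) with hμ
  have hW := fun θ => WW_cont (k := k) hkn c θ
  have m1 : Continuous fun p : Matrix (Fin n) (Fin n) ℂ × (IX k → ℝ) => mA hkn c p.1 := (mA_cont hkn c).comp continuous_fst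
  have m2 : Continuous fun p : Matrix (Fin n) (Fin n) ℂ × (IX k → ℝ) => mA hkn (c ^ 2 / (2 * n)) (SH hkn p.1 p.2) := (mA_cont hkn _).comp (SH_cont hkn)
  have fm : Continuous fun A : Matrix (Fin n) (Fin n) ℂ => fro (TT (mA hkn c A)) := fro_cont.comp (TT_cont.comp (mA_cont hkn c))
  have cD : ∀ θ (w : Matrix (Fin n) (Fin n) ℂ × (IX k → ℝ) → (IX k → ℝ)), Continuous w → Continuous fun p : Matrix (Fin n) (Fin n) ℂ × (IX k → ℝ) => fderiv ℝ f (WW hkn c θ p.1 p.2) (w p) :=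
    fun θ w hw => (hf.dcont.comp (hW θ)).clm_apply hw
  have Iq : Integrable (qq hkn c) ν := h.integrable _ (qq_cont hkn c)
  -- integrability
  have i0 : ∀ θ, Integrable (fun p => f (WW hkn c θ p.1 p.2)) μ := fun θ =>
    h.prodint _ (hf.smooth.continuous.comp (hW θ)) (fun A => 1 + |f 0| + L * fro (TT (mA hkn c A))) (continuous_const.add (continuous_const.mul fm))
      (fun x => 1 + L * fro (TT x)) ((EB.const _).add ((EB.const _).mul fTT_EB)) fun A x _ => hf.grow hkn c θ A x
  have i1 : ∀ θ, Integrable (fun p => fderiv ℝ f (WW hkn c θ p.1 p.2) p.2) μ := fun θ =>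
    h.prodint _ (cD θ _ continuous_snd) (fun _ => L) continuous_const (fun x => fro (TT x)) fTT_EB fun A x _ => hf.dbound _ _
  have i2 : ∀ θ, Integrable (fun p => fderiv ℝ f (WW hkn c θ p.1 p.2) (mA hkn c p.1)) μ := fun θ =>
    h.prodint _ (cD θ _ m1) (fun A => L * fro (TT (mA hkn c A))) (continuous_const.mul fm) (fun x => 1) (EB.const _) fun A x _ => by
      rw [mul_one]; exact hf.dbound _ _
  have i3 : ∀ θ, Integrable (fun p => fderiv ℝ f (WW hkn c θ p.1 p.2) (vv hkn c p.1 p.2)) μ := fun θ =>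
    h.prodint _ (cD θ _ (continuous_snd.sub m2)) (fun A => L * qq hkn c A) (continuous_const.mul (qq_cont hkn c)) (fun x => fro (TT x)) fTT_EB fun A x hA => by
      refine (hf.dbound _ _).trans ?_
      rw [mul_assoc]
      exact mul_le_mul_of_nonneg_left (vv_bound hkn c hA x) hf.pos
  have i4 : ∀ θ, Integrable (fun p => fderiv ℝ f (WW hkn c θ p.1 p.2) (mA hkn (c ^ 2 / (2 * n)) (SH hkn p.1 p.2))) μ := fun θ => by
    refine ((i1 θ).sub (i3 θ)).congr (ae_of_all _ fun p => ?_)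
    simp only [Pi.sub_apply, vv, map_sub]; ring
  have i5 : ∀ θ, Integrable (fun p => (∑ s, p.2 s * mA hkn c p.1 s) * f (WW hkn c θ p.1 p.2)) μ := fun θ => by
    refine h.prodint _ ?_ (fun A => (∑ s, |mA hkn c A s|) * (1 + |f 0| + L * fro (TT (mA hkn c A)))) ?_
      (fun x => (∑ s, |x s|) * (1 + L * fro (TT x))) ?_ fun A x _ => ?_
    · refine Continuous.mul (continuous_finsetSum _ fun s _ => ?_) (hf.smooth.continuous.comp (hW θ))
      exact ((continuous_apply s).comp continuous_snd).mul ((continuous_apply s).comp m1)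
    · exact (continuous_finsetSum _ fun s _ => ((continuous_apply s).comp (mA_cont hkn c)).abs).mul (continuous_const.add (continuous_const.mul fm))
    · exact (EB.sum _ fun s _ => (EB.coord s).norm').mul ((EB.const _).add ((EB.const _).mul fTT_EB))
    · rw [abs_mul]
      have b1 : |∑ s, x s * mA hkn c A s| ≤ (∑ s, |mA hkn c A s|) * (∑ s, |x s|) := by
        refine (Finset.abs_sum_le_sum_abs _ _).trans ?_
        rw [Finset.mul_sum]
        refine Finset.sum_le_sum fun s _ => ?_
        rw [abs_mul, mul_comm]
        refine mul_le_mul_of_nonneg_right ?_ (abs_nonneg _)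
        exact Finset.single_le_sum (f := fun s => |mA hkn c A s|) (fun s _ => abs_nonneg _) (Finset.mem_univ s)
      have := mul_le_mul b1 (hf.grow hkn c θ A x) (abs_nonneg _) (by positivity)
      refine this.trans (le_of_eq (by ring))
  -- the key identity
  have key : ∀ θ, Real.sin θ * ∫ p, fderiv ℝ f (WW hkn c θ p.1 p.2) (mA hkn c p.1) ∂μ = Real.cos θ * ∫ p, fderiv ℝ f (WW hkn c θ p.1 p.2) (mA hkn (c ^ 2 / (2 * n)) (SH hkn p.1 p.2)) ∂μ := by
    intro θ
    rw [hμ, integral_prod _ (i2 θ), integral_prod_symm _ (i4 θ), ← integral_const_mul, ← integral_const_mul]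
    have e1 : ∀ A, Real.sin θ * ∫ x, fderiv ℝ f (WW hkn c θ A x) (mA hkn c A) ∂(gp (IX k)) = ∫ x, (∑ s, x s * mA hkn c A s) * f (WW hkn c θ A x) ∂(gp (IX k)) := fun A => (gauss_side hf hkn c θ A).symm
    have e2 : ∀ x, Real.cos θ * ∫ A, fderiv ℝ f (WW hkn c θ A x) (mA hkn (c ^ 2 / (2 * n)) (SH hkn A x)) ∂ν = ∫ A, (∑ s, x s * mA hkn c A s) * f (WW hkn c θ A x) ∂ν := fun x => (haar_side h hn hf hkn c θ x).symm
    simp only [e1, e2]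
    exact (integral_prod _ (i5 θ)).symm.trans (integral_prod_symm _ (i5 θ))
  have hder : ∀ θ, HasDerivAt (fun θ => ∫ p, f (WW hkn c θ p.1 p.2) ∂μ) (Real.cos θ * ∫ p, fderiv ℝ f (WW hkn c θ p.1 p.2) (vv hkn c p.1 p.2) ∂μ) θ := by
    intro θ
    have hb : Integrable (fun p : Matrix (Fin n) (Fin n) ℂ × (IX k → ℝ) => L * (fro (TT (mA hkn c p.1)) + fro (TT p.2))) μ := by
      refine Integrable.const_mul (Integrable.add ?_ ?_) _
      · exact (h.integrable _ fm).comp_fst _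
      · exact (fTT_EB.intp).comp_snd _
    have hd := (hasDerivAt_integral_of_dominated_loc_of_deriv_le (μ := μ) (x₀ := θ) (s := Set.univ) (F := fun θ p => f (WW hkn c θ p.1 p.2))
      (F' := fun θ p => fderiv ℝ f (WW hkn c θ p.1 p.2) (-Real.sin θ • mA hkn c p.1 + Real.cos θ • p.2))
      (bound := fun p => L * (fro (TT (mA hkn c p.1)) + fro (TT p.2))) Filter.univ_mem
      (Filter.Eventually.of_forall fun θ => (i0 θ).aestronglyMeasurable) (i0 θ) ?_ ?_ hb ?_).2
    · refine hd.congr_deriv ?_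
      have e1 : ∀ p : Matrix (Fin n) (Fin n) ℂ × (IX k → ℝ), fderiv ℝ f (WW hkn c θ p.1 p.2) (-Real.sin θ • mA hkn c p.1 + Real.cos θ • p.2) = Real.cos θ * fderiv ℝ f (WW hkn c θ p.1 p.2) p.2 - Real.sin θ * fderiv ℝ f (WW hkn c θ p.1 p.2) (mA hkn c p.1) := by
        intro p; rw [map_add, map_smul, map_smul, smul_eq_mul, smul_eq_mul]; ring
      have e2 : ∀ p : Matrix (Fin n) (Fin n) ℂ × (IX k → ℝ), fderiv ℝ f (WW hkn c θ p.1 p.2) (vv hkn c p.1 p.2) = fderiv ℝ f (WW hkn c θ p.1 p.2) p.2 - fderiv ℝ f (WW hkn c θ p.1 p.2) (mA hkn (c ^ 2 / (2 * n)) (SH hkn p.1 p.2)) := by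
        intro p; rw [vv, map_sub]
      simp only [e1, e2]
      rw [integral_sub ((i1 θ).const_mul _) ((i2 θ).const_mul _), integral_sub (i1 θ) (i4 θ), integral_const_mul, integral_const_mul, key θ]
      ring
    · exact (cD θ _ ((m1.const_smul (-Real.sin θ)).add (continuous_snd.const_smul (Real.cos θ)))).aestronglyMeasurable
    · refine ae_of_all _ fun p t _ => ?_
      refine (hf.dbound _ _).trans (mul_le_mul_of_nonneg_left ?_ hf.pos)
      refine (fTT_add _ _).trans ?_
      rw [TT_smul, TT_smul, fro_rsmul, fro_rsmul, abs_neg]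
      have a1 := Real.abs_cos_le_one t
      have a2 := Real.abs_sin_le_one t
      nlinarith [fro_nonneg (TT (mA hkn c p.1)), fro_nonneg (TT p.2)]
    · refine ae_of_all _ fun p t _ => ?_
      have h1 : HasDerivAt (fun θ => WW hkn c θ p.1 p.2) (-Real.sin t • mA hkn c p.1 + Real.cos t • p.2) t := by
        unfold WW
        exact ((Real.hasDerivAt_cos t).smul_const _).add ((Real.hasDerivAt_sin t).smul_const _)
      exact HasFDerivAt.comp_hasDerivAt t (hf.diff _) h1
  have hbd : ∀ θ, ‖Real.cos θ * ∫ p, fderiv ℝ f (WW hkn c θ p.1 p.2) (vv hkn c p.1 p.2) ∂μ‖ ≤ L * k * ∫ A, qq hkn c A ∂ν := by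
    intro θ
    have hq : 0 ≤ ∫ A, qq hkn c A ∂ν := integral_nonneg fun A => by
      have := fro_nonneg ((1 : Matrix (Fin k) (Fin k) ℂ) - (c ^ 2 / n) • cor hkn (A * A))
      have h2 : 0 ≤ c ^ 2 / (n:ℝ) * fro (cor hkn A) ^ 2 := by positivity
      exact add_nonneg this h2
    have b1 : ‖∫ p, fderiv ℝ f (WW hkn c θ p.1 p.2) (vv hkn c p.1 p.2) ∂μ‖ ≤ ∫ p, (L * qq hkn c p.1) * fro (TT p.2) ∂μ := by
      refine norm_integral_le_of_norm_le ((Iq.const_mul L).mul_prod fTT_EB.intp) ?_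
      have h1 : ∀ᵐ p ∂μ, p.1.IsHermitian := Measure.quasiMeasurePreserving_fst.ae h.herm
      filter_upwards [h1] with p hp
      refine (hf.dbound _ _).trans ?_
      rw [mul_assoc]
      exact mul_le_mul_of_nonneg_left (vv_bound hkn c hp p.2) hf.pos
    have b2 : ∫ p, (L * qq hkn c p.1) * fro (TT p.2) ∂μ = (∫ A, L * qq hkn c A ∂ν) * ∫ x, fro (TT x) ∂(gp (IX k)) :=
      integral_prod_mul (fun A => L * qq hkn c A) (fun x : IX k → ℝ => fro (TT x))
    rw [b2, integral_const_mul] at b1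
    rw [norm_mul, Real.norm_eq_abs (Real.cos θ)]
    have b3 := mul_le_mul (Real.abs_cos_le_one θ) b1 (norm_nonneg _) zero_le_one
    refine b3.trans ?_
    rw [one_mul]
    have b4 := mul_le_mul_of_nonneg_left (gue_fro1 (k := k)) (mul_nonneg hf.pos hq)
    linarith
  have mv := Convex.norm_image_sub_le_of_norm_hasDerivWithin_le (s := Set.univ) (fun θ _ => (hder θ).hasDerivWithinAt) (fun θ _ => hbd θ) convex_univ (Set.mem_univ (Real.pi / 2)) (Set.mem_univ (0:ℝ))
  have z0 : ∫ p, f (WW hkn c 0 p.1 p.2) ∂μ = ∫ A, f (mA hkn c A) ∂ν := by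
    rw [hμ, integral_prod _ (i0 0)]
    simp [WW]
  have z1 : ∫ p, f (WW hkn c (Real.pi / 2) p.1 p.2) ∂μ = ∫ x, f x ∂(gp (IX k)) := by
    rw [hμ, integral_prod_symm _ (i0 (Real.pi / 2))]
    simp [WW]
  rw [z0, z1, Real.norm_eq_abs, Real.norm_eq_abs, zero_sub, abs_neg, abs_of_pos (by positivity : (0:ℝ) < Real.pi / 2), mul_comm] at mv
  refine mv.trans (mul_le_mul_of_nonneg_right ?_ ((norm_nonneg _).trans (hbd 0)))
  have := Real.pi_lt_four
  linarith

end interp3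

-- Part PE7
section moll
variable {n k : ℕ} {f : (IX k → ℝ) → ℝ} {L : ℝ} {ν : Measure (Matrix (Fin n) (Fin n) ℂ)} {R : ℝ}

lemma mollify (hL : 0 ≤ L) (hc : Continuous f) (hl : ∀ x y, |f x - f y| ≤ L * fro (TT (x - y))) (ε : ℝ) (hε : 0 < ε) :
    ∃ g, SF g L ∧ ∀ x, |g x - f x| ≤ ε := by
  classical
  set δ := ε / (L * (2 * k) + 1) with hδ
  have hpos : 0 < L * (2 * k) + 1 := by positivity
  have hδ0 : 0 < δ := by positivity
  let φ : ContDiffBump (0 : IX k → ℝ) := ⟨δ / 2, δ, by positivity, by linarith⟩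
  let g : (IX k → ℝ) → ℝ := convolution (φ.normed volume) f (ContinuousLinearMap.lsmul ℝ ℝ) volume
  have hi : ∀ x, Integrable (fun t => φ.normed volume t * f (x - t)) volume := by
    intro x
    have h1 : Continuous fun t => φ.normed volume t * f (x - t) := φ.continuous_normed.mul (hc.comp (by fun_prop))
    exact h1.integrable_of_hasCompactSupport (φ.hasCompactSupport_normed.mul_right)
  have hg : ∀ x, g x = ∫ t, φ.normed volume t * f (x - t) := fun x => rfl
  refine ⟨g, ⟨?_, hL, fun x y => ?_⟩, fun x => ?_⟩
  · exact HasCompactSupport.contDiff_convolution_left (ContinuousLinearMap.lsmul ℝ ℝ) φ.hasCompactSupport_normed φ.contDiff_normed hc.locallyIntegrable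
  · rw [hg, hg, ← integral_sub (hi x) (hi y), ← Real.norm_eq_abs]
    have hb : Integrable (fun t => φ.normed volume t * (L * fro (TT (x - y)))) volume := φ.integrable_normed.mul_const _
    refine (norm_integral_le_of_norm_le hb (ae_of_all _ fun t => ?_)).trans (le_of_eq ?_)
    · rw [← mul_sub, norm_mul, Real.norm_of_nonneg (φ.nonneg_normed t)]
      refine mul_le_mul_of_nonneg_left ?_ (φ.nonneg_normed t)
      have := hl (x - t) (y - t)
      rwa [sub_sub_sub_cancel_right] at this
    · rw [integral_mul_const, φ.integral_normed, one_mul]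
  · have := φ.dist_normed_convolution_le (μ := volume) (x₀ := x) (ε := ε) hc.aestronglyMeasurable (g := f) ?_
    · rwa [Real.dist_eq] at this
    · intro y hy
      rw [Real.dist_eq]
      refine (hl y x).trans ?_
      have h1 := TT_fro_le (y - x)
      have h2 : ‖y - x‖ ≤ δ := by rw [← dist_eq_norm]; exact (Metric.mem_ball.1 hy).le
      calc L * fro (TT (y - x)) ≤ L * (2 * k * δ) := by
            refine mul_le_mul_of_nonneg_left (h1.trans ?_) hL
            gcongr
        _ ≤ (L * (2 * k) + 1) * δ := by nlinarith
        _ = ε := by rw [hδ]; field_simp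

lemma HL.interp' (h : HL ν R) (hn : n ≠ 0) (hkn : k ≤ n) (hL : 0 ≤ L) (hc : EB f) (hl : ∀ x y, |f x - f y| ≤ L * fro (TT (x - y))) (c : ℝ) :
    |∫ A, f (mA hkn c A) ∂ν - ∫ x, f x ∂(gp (IX k))| ≤ 2 * (L * k * ∫ A, qq hkn c A ∂ν) := by
  have hp := h.prob
  refine le_of_forall_pos_le_add fun ε hε => ?_
  obtain ⟨g, hg, hgf⟩ := mollify hL hc.cont hl (ε / 2) (by positivity)
  have key := h.interp hn hg hkn c
  have gc := hg.smooth.continuous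
  have a1 : |∫ A, g (mA hkn c A) ∂ν - ∫ A, f (mA hkn c A) ∂ν| ≤ ε / 2 := by
    have j1 : Integrable (fun A => g (mA hkn c A)) ν := h.integrable _ (gc.comp (mA_cont hkn c))
    have j2 : Integrable (fun A => f (mA hkn c A)) ν := h.integrable _ (hc.cont.comp (mA_cont hkn c))
    rw [← integral_sub j1 j2, ← Real.norm_eq_abs]
    refine (norm_integral_le_of_norm_le_const (ae_of_all _ fun A => hgf (mA hkn c A))).trans ?_
    simp
  have eg : EB g := EB.of_le gc (hc.norm'.add (EB.const (ε / 2))) fun x => by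
    have h1 := hgf x
    have h2 := abs_sub_abs_le_abs_sub (g x) (f x)
    have h3 : (0:ℝ) ≤ ‖f x‖ + ε / 2 := by positivity
    rw [Real.norm_of_nonneg h3, Real.norm_eq_abs, Real.norm_eq_abs]
    linarith
  have a2 : |∫ x, g x ∂(gp (IX k)) - ∫ x, f x ∂(gp (IX k))| ≤ ε / 2 := by
    rw [← integral_sub eg.intp hc.intp, ← Real.norm_eq_abs]
    refine (norm_integral_le_of_norm_le_const (ae_of_all _ fun A => hgf A)).trans ?_
    simp
  have b1 := abs_le.1 a1
  have b2 := abs_le.1 a2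
  have b3 := abs_le.1 key
  rw [abs_le]
  constructor <;> linarith [b1.1, b1.2, b2.1, b2.2, b3.1, b3.2]

lemma HL.wsc (h : HL ν R) (hn : n ≠ 0) (hkn : k ≤ n) (hk : 2 ≤ k) (c : ℝ) :
    ∫ A, Wsc ((Real.sqrt k)⁻¹ • c • cor hkn A) ∂ν ≤ 26000 * (Real.sqrt (Real.log k) / k) + 2 * ∫ A, qq hkn c A ∂ν := by
  have hk0 : k ≠ 0 := by omega
  have hk' : (k:ℝ) ≠ 0 := by exact_mod_cast hk0
  have h1 := h.interp' hn hkn (by positivity : (0:ℝ) ≤ (k:ℝ)⁻¹) (Wsc_EB hk0) (Wsc_lip hk0) c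
  have h2 := gue_rate hk
  have e : ∫ A, Wsc ((Real.sqrt k)⁻¹ • c • cor hkn A) ∂ν = ∫ A, Wsc ((Real.sqrt k)⁻¹ • TT (mA hkn c A)) ∂ν := by
    refine integral_congr_ae ?_
    filter_upwards [h.herm] with A hA
    rw [TT_mA hkn c hA]
  rw [inv_mul_cancel₀ hk', one_mul] at h1
  rw [e]
  have := abs_le.1 h1
  linarith [this.2]

end moll

-- Part PF
section PF
variable {n k : ℕ} {Ω : Type*} [MeasurableSpace Ω] {P : Measure Ω} {U : Ω → Matrix (Fin n) (Fin n) ℂ}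

lemma jensen2 [IsProbabilityMeasure P] {X : Ω → ℝ} {s : ℝ} (hs : 0 ≤ s) (h1 : Integrable X P) (h2 : Integrable (fun ω => X ω ^ 2) P) (h : ∫ ω, X ω ^ 2 ∂P ≤ s ^ 2) : ∫ ω, X ω ∂P ≤ s := by
  set t := ∫ ω, X ω ∂P with ht
  have e : ∫ ω, (2 * t) * X ω ∂P ≤ ∫ ω, (X ω ^ 2 + t ^ 2) ∂P :=
    integral_mono (h1.const_mul _) (h2.add (integrable_const _)) fun ω => by nlinarith [sq_nonneg (X ω - t)]
  rw [integral_const_mul, integral_add h2 (integrable_const _), ← ht] at e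
  simp only [integral_const, probReal_univ, one_smul] at e
  exact abs_le_of_sq_le_sq' (by nlinarith) hs |>.2

lemma HU.corfro (h : HU P U) (hn : n ≠ 0) (hkn : k ≤ n) {D : Matrix (Fin n) (Fin n) ℂ} (hD : D.IsHermitian) (ht : D.trace = 0) :
    Integrable (fun ω => fro (cor hkn (U ω * D * (U ω)ᴴ))) P ∧ Integrable (fun ω => fro (cor hkn (U ω * D * (U ω)ᴴ)) ^ 2) P ∧
      ∫ ω, fro (cor hkn (U ω * D * (U ω)ᴴ)) ^ 2 ∂P ≤ (2 * k * fro D / n) ^ 2 := by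
  have hl := h.law hD ht
  have c1 : Continuous fun A : Matrix (Fin n) (Fin n) ℂ => fro (cor hkn A) := fro_cont.comp (cor_cont hkn)
  have i1 := (hl.integrable _ c1).comp_measurable (h.cmeas D)
  have i2 := (hl.integrable _ (c1.pow 2)).comp_measurable (h.cmeas D)
  refine ⟨i1, i2, ?_⟩
  have i3 : ∀ i j : Fin n, Integrable (fun ω => ‖(U ω * D * (U ω)ᴴ) i j‖ ^ 2) P := fun i j => by
    have c3 : Continuous fun A : Matrix (Fin n) (Fin n) ℂ => ‖A i j‖ ^ 2 := by fun_prop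
    exact (hl.integrable _ c3).comp_measurable (h.cmeas D)
  simp only [fro_sq]
  have e : ∀ ω, ∑ i, ∑ j, ‖cor hkn (U ω * D * (U ω)ᴴ) i j‖ ^ 2 = ∑ i : Fin k, ∑ j : Fin k, ‖(U ω * D * (U ω)ᴴ) (Fin.castLE hkn i) (Fin.castLE hkn j)‖ ^ 2 := fun ω => rfl
  simp only [e]
  rw [integral_finsetSum _ fun i _ => integrable_finsetSum _ fun j _ => i3 _ _]
  have b : ∀ i : Fin k, ∫ ω, ∑ j : Fin k, ‖(U ω * D * (U ω)ᴴ) (Fin.castLE hkn i) (Fin.castLE hkn j)‖ ^ 2 ∂P ≤ k * (4 * fro D ^ 2 / (n:ℝ) ^ 2) := by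
    intro i
    rw [integral_finsetSum _ fun j _ => i3 _ _]
    refine (Finset.sum_le_sum fun j _ => h.entry hn hD ht _ _).trans (le_of_eq ?_)
    simp
  refine (Finset.sum_le_sum fun i _ => b i).trans (le_of_eq ?_)
  simp; ring

/-- facts on the diagonal matrix -/
lemma diag_facts {Λ : Matrix (Fin n) (Fin n) ℝ} (hd : Λ.IsDiag) (h0 : Λ ≠ 0) (ht : Λ.trace = 0) :
    let D := Λ.map (fun x => (x : ℂ))
    let D2 := D * D - (hsNormR Λ ^ 2 / n) • (1 : Matrix (Fin n) (Fin n) ℂ)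
    0 < hsNormR Λ ∧ hsNormR Λ ^ 2 ≤ n * opNormR Λ ^ 2 ∧ D.IsHermitian ∧ D.trace = 0 ∧ fro D = hsNormR Λ ∧
      D2.IsHermitian ∧ D2.trace = 0 ∧ fro D2 ≤ opNormR Λ * hsNormR Λ := by
  intro D D2
  obtain ⟨d, rfl⟩ : ∃ d, Λ = Matrix.diagonal d := ⟨Λ.diag, hd.diagonal_diag.symm⟩
  have hr : hsNormR (Matrix.diagonal d) = Real.sqrt (∑ i, d i ^ 2) := by
    unfold hsNormR
    rw [diagonal_transpose, diagonal_mul_diagonal, trace_diagonal]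
    simp only [sq]
  have hr2 : hsNormR (Matrix.diagonal d) ^ 2 = ∑ i, d i ^ 2 := by
    rw [hr, Real.sq_sqrt (Finset.sum_nonneg fun i _ => sq_nonneg _)]
  have hop : ∀ i, |d i| ≤ opNormR (Matrix.diagonal d) := by
    intro i
    have h1 := (Matrix.toEuclideanCLM (𝕜 := ℝ) (Matrix.diagonal d)).le_opNorm (EuclideanSpace.single i (1:ℝ))
    rw [EuclideanSpace.norm_single, norm_one, mul_one] at h1
    refine le_trans ?_ h1
    refine le_trans (le_of_eq ?_) (PiLp.norm_apply_le _ i)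
    rw [Real.norm_eq_abs]
    congr 1
    have : (Matrix.toEuclideanCLM (𝕜 := ℝ) (Matrix.diagonal d) (EuclideanSpace.single i (1:ℝ))).ofLp = Matrix.diagonal d *ᵥ (Pi.single i 1) := by
      simp
    rw [this]
    simp [Matrix.mulVec_single]
  have hop2 : ∀ i, d i ^ 2 ≤ opNormR (Matrix.diagonal d) ^ 2 := fun i => by
    rw [← sq_abs (d i)]; have := hop i; have := abs_nonneg (d i); gcongr
  have hrp : 0 < ∑ i, d i ^ 2 := by
    have hne : ∃ i, d i ≠ 0 := by
      by_contra hh; push Not at hh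
      exact h0 (by rw [show d = 0 from funext hh]; simp)
    obtain ⟨i, hi⟩ := hne
    exact Finset.sum_pos' (fun i _ => sq_nonneg _) ⟨i, Finset.mem_univ _, by positivity⟩
  have hn : n ≠ 0 := by
    rintro rfl; simp at hrp
  have hn' : (n:ℝ) ≠ 0 := by exact_mod_cast hn
  have hnc : (n:ℂ) ≠ 0 := by exact_mod_cast hn
  have hrpos : 0 < hsNormR (Matrix.diagonal d) := by rw [hr]; exact Real.sqrt_pos.2 hrp
  have eD : D = Matrix.diagonal fun i => (d i : ℂ) := by
    ext i j
    simp only [D, Matrix.map_apply, Matrix.diagonal_apply]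
    split_ifs <;> simp
  have fd : ∀ e : Fin n → ℝ, fro (Matrix.diagonal fun i => (e i : ℂ)) ^ 2 = ∑ i, e i ^ 2 := by
    intro e
    rw [fro_sq]
    refine Finset.sum_congr rfl fun i _ => ?_
    rw [Finset.sum_eq_single i]
    · simp
    · intro j _ hj; simp [Matrix.diagonal_apply_ne _ hj.symm]
    · simp
  have hd_herm : ∀ e : Fin n → ℝ, (Matrix.diagonal fun i => (e i : ℂ)).IsHermitian := by
    intro e
    unfold Matrix.IsHermitian
    rw [diagonal_conjTranspose]
    congr 1; funext i; simp
  set m : ℝ := hsNormR (Matrix.diagonal d) ^ 2 / n with hm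
  have eD2 : D2 = Matrix.diagonal fun i => ((d i ^ 2 - m : ℝ) : ℂ) := by
    simp only [D2, eD]
    ext i j
    rw [diagonal_mul_diagonal]
    by_cases hij : i = j
    · subst hij; simp [sq]; rw [hm]; push_cast; ring
    · simp [hij]
  have trd : ∑ i, d i = 0 := by rw [trace_diagonal] at ht; exact ht
  have hsm : ∑ i : Fin n, (d i ^ 2 - m) = 0 := by
    rw [Finset.sum_sub_distrib, ← hr2, hm]; simp; field_simp; simp
  refine ⟨hrpos, ?_, ?_, ?_, ?_, ?_, ?_, ?_⟩
  · rw [hr2]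
    refine (Finset.sum_le_sum fun i _ => hop2 i).trans (le_of_eq ?_)
    simp
  · rw [eD]; exact hd_herm d
  · rw [eD, trace_diagonal, ← Complex.ofReal_sum, trd]; simp
  · have := fd d
    rw [← eD, ← hr2] at this
    exact (sq_eq_sq₀ (fro_nonneg _) hrpos.le).1 this
  · rw [eD2]; exact hd_herm fun i => d i ^ 2 - m
  · rw [eD2, trace_diagonal, ← Complex.ofReal_sum, hsm]; simp
  · have hop0 : 0 ≤ opNormR (Matrix.diagonal d) := norm_nonneg _
    refine (sq_le_sq₀ (fro_nonneg _) (by positivity)).1 ?_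
    rw [eD2, fd fun i => d i ^ 2 - m]
    have e1 : ∑ i : Fin n, (d i ^ 2 - m) ^ 2 = ∑ i, (d i ^ 2) ^ 2 - m * ∑ i, d i ^ 2 - m * ∑ i : Fin n, (d i ^ 2 - m) := by
      rw [Finset.mul_sum, Finset.mul_sum, ← Finset.sum_sub_distrib, ← Finset.sum_sub_distrib]
      refine Finset.sum_congr rfl fun i _ => by ring
    have hm0 : 0 ≤ m := by positivity
    have e2 : ∑ i, (d i ^ 2) ^ 2 ≤ opNormR (Matrix.diagonal d) ^ 2 * ∑ i, d i ^ 2 := by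
      rw [Finset.mul_sum]
      refine Finset.sum_le_sum fun i _ => ?_
      rw [sq (d i ^ 2)]
      exact mul_le_mul_of_nonneg_right (hop2 i) (sq_nonneg _)
    rw [e1, hsm, mul_pow, hr2]
    nlinarith [mul_nonneg hm0 hrp.le]

end PF

-- Part PG
section PG
variable {n k : ℕ} {Ω : Type*} [MeasurableSpace Ω] {P : Measure Ω} {U : Ω → Matrix (Fin n) (Fin n) ℂ}

lemma fro_one_le (hk : 1 ≤ k) : fro (1 : Matrix (Fin k) (Fin k) ℂ) ≤ k := by
  have hk' : (1:ℝ) ≤ k := by exact_mod_cast hk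
  refine (sq_le_sq₀ (fro_nonneg _) (by positivity)).1 ?_
  rw [fro_sq]
  have : ∀ i : Fin k, ∑ j, ‖(1 : Matrix (Fin k) (Fin k) ℂ) i j‖ ^ 2 = 1 := by
    intro i
    rw [Finset.sum_eq_single i]
    · simp
    · intro j _ hj; simp [Matrix.one_apply_ne hj.symm]
    · simp
  simp only [this]
  simp
  nlinarith

lemma qq_point {hkn : k ≤ n} (hk : 1 ≤ k) (hn : 1 ≤ n) {V D : Matrix (Fin n) (Fin n) ℂ} (hV : V ∈ Matrix.unitaryGroup (Fin n) ℂ)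
    {r c : ℝ} (hr : 0 < r) (hc : c ^ 2 = ((n:ℝ) ^ 2 - 1) / r ^ 2) :
    qq hkn c (V * D * Vᴴ) ≤ k / (n:ℝ) ^ 2 + (n / r ^ 2) * fro (cor hkn (V * (D * D - (r ^ 2 / (n:ℝ)) • (1 : Matrix (Fin n) (Fin n) ℂ)) * Vᴴ))
      + (n / r ^ 2) * fro (cor hkn (V * D * Vᴴ)) ^ 2 := by
  have u1 : V * Vᴴ = 1 := Matrix.mem_unitaryGroup_iff.1 hV
  have u2 : Vᴴ * V = 1 := Matrix.mem_unitaryGroup_iff'.1 hV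
  have hn' : (1:ℝ) ≤ n := by exact_mod_cast hn
  have hn0 : (n:ℝ) ≠ 0 := by positivity
  set D2 := D * D - (r ^ 2 / (n:ℝ)) • (1 : Matrix (Fin n) (Fin n) ℂ) with hD2
  have e1 : (V * D * Vᴴ) * (V * D * Vᴴ) = V * D2 * Vᴴ + (r ^ 2 / (n:ℝ)) • (1 : Matrix (Fin n) (Fin n) ℂ) := by
    have : (V * D * Vᴴ) * (V * D * Vᴴ) = V * (D * D) * Vᴴ := by
      calc _ = V * D * (Vᴴ * V) * D * Vᴴ := by simp only [Matrix.mul_assoc]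
        _ = _ := by rw [u2]; simp only [Matrix.mul_assoc, Matrix.mul_one]
    rw [this, hD2, Matrix.mul_sub, Matrix.sub_mul, Matrix.mul_smul, Matrix.smul_mul, Matrix.mul_one, u1, sub_add_cancel]
  have c1 : cor hkn (1 : Matrix (Fin n) (Fin n) ℂ) = 1 := by
    unfold cor
    exact Matrix.submatrix_one _ (Fin.castLE_injective hkn)
  have hcn : c ^ 2 / n ≤ n / r ^ 2 := by
    rw [hc, div_div, div_le_div_iff₀ (by positivity) (by positivity)]
    nlinarith [sq_nonneg r, mul_pos hr hr]
  have hcn0 : 0 ≤ c ^ 2 / (n:ℝ) := by positivity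
  have e2 : (1 : Matrix (Fin k) (Fin k) ℂ) - (c ^ 2 / n) • cor hkn ((V * D * Vᴴ) * (V * D * Vᴴ)) =
      (1 / (n:ℝ) ^ 2) • (1 : Matrix (Fin k) (Fin k) ℂ) + (-(c ^ 2 / n)) • cor hkn (V * D2 * Vᴴ) := by
    rw [e1, cor_add, cor_smul, c1, smul_add, smul_smul]
    have : c ^ 2 / n * (r ^ 2 / n) = 1 - 1 / (n:ℝ) ^ 2 := by
      rw [hc]; field_simp
    rw [this, sub_smul, one_smul, neg_smul]
    abel
  unfold qq
  rw [e2]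
  have t1 := fro_add_le ((1 / (n:ℝ) ^ 2) • (1 : Matrix (Fin k) (Fin k) ℂ)) ((-(c ^ 2 / n)) • cor hkn (V * D2 * Vᴴ))
  rw [fro_rsmul, fro_rsmul, abs_neg, abs_of_nonneg hcn0, abs_of_nonneg (by positivity)] at t1
  have t2 : 1 / (n:ℝ) ^ 2 * fro (1 : Matrix (Fin k) (Fin k) ℂ) ≤ k / (n:ℝ) ^ 2 := by
    have := mul_le_mul_of_nonneg_left (fro_one_le hk) (by positivity : 0 ≤ 1 / (n:ℝ) ^ 2)
    refine this.trans (le_of_eq (by ring))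
  have t3 := mul_le_mul_of_nonneg_right hcn (fro_nonneg (cor hkn (V * D2 * Vᴴ)))
  have t4 := mul_le_mul_of_nonneg_right hcn (sq_nonneg (fro (cor hkn (V * D * Vᴴ))))
  linarith

lemma final_arith {k n : ℕ} (hk : 2 ≤ k) (hkn : k ≤ n) {E Q s : ℝ} (hs : 0 ≤ s) (hns : 1 ≤ n * s ^ 2)
    (h7 : E ≤ 7) (hE : E ≤ 26000 * (Real.sqrt (Real.log k) / k) + 2 * Q) (hQ : Q ≤ k / (n:ℝ) ^ 2 + 2 * k * s + 4 * k ^ 2 / n) :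
    E ≤ 18 * k ^ 2 * Real.sqrt n * s ^ 2 + 26012 * Real.sqrt (Real.log k) / k := by
  have hk' : (2:ℝ) ≤ k := by exact_mod_cast hk
  have hn' : (k:ℝ) ≤ n := by exact_mod_cast hkn
  have hn0 : (0:ℝ) < n := by linarith
  have hl : 1 / 2 ≤ Real.sqrt (Real.log k) := by
    refine Real.le_sqrt_of_sq_le ?_
    have := Real.log_le_log (by norm_num) hk'
    have := Real.log_two_gt_d9
    norm_num; linarith
  have hlk : 0 ≤ Real.sqrt (Real.log k) / k := by positivity
  by_cases h : 7 ≤ 18 * k ^ 2 * Real.sqrt n * s ^ 2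
  · rw [mul_div_assoc]; linarith
  push Not at h
  have hsn : 1 ≤ Real.sqrt n * s := by
    have : (1:ℝ) ^ 2 ≤ (Real.sqrt n * s) ^ 2 := by rw [mul_pow, Real.sq_sqrt hn0.le]; linarith
    exact (sq_le_sq₀ (by norm_num) (by positivity)).1 this
  have hs1 : k ^ 2 * s ≤ 1 / 2 := by
    have : (k:ℝ) ^ 2 * s * 1 ≤ k ^ 2 * s * (Real.sqrt n * s) := mul_le_mul_of_nonneg_left hsn (by positivity)
    nlinarith
  have hinv : 1 / (n:ℝ) ≤ s ^ 2 := by rw [div_le_iff₀ hn0]; linarith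
  have hks : k * s ≤ 1 / (2 * k) := by
    rw [le_div_iff₀ (by positivity)]; nlinarith
  have hkn2 : (k:ℝ) ^ 2 / n ≤ 1 / (4 * k ^ 2) := by
    have h1 : (k:ℝ) ^ 2 / n ≤ (k * s) ^ 2 := by
      rw [div_eq_mul_one_div, mul_pow]; gcongr
    have h2 : (k * s) ^ 2 ≤ (1 / (2 * k)) ^ 2 := by gcongr
    refine (h1.trans h2).trans (le_of_eq ?_)
    field_simp; norm_num
  have hk3 : 1 / (4 * (k:ℝ) ^ 2) ≤ 1 / (8 * k) := by
    apply one_div_le_one_div_of_le (by positivity); nlinarith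
  have hk4 : (k:ℝ) / (n:ℝ) ^ 2 ≤ 1 / k := by
    rw [div_le_div_iff₀ (by positivity) (by positivity)]; nlinarith
  have e1 : 1 / (2 * (k:ℝ)) = 1 / 2 * (1 / k) := by field_simp
  have e2 : 1 / (8 * (k:ℝ)) = 1 / 8 * (1 / k) := by field_simp
  have hQ2 : Q ≤ 3 * (1 / k) := by
    rw [e1] at hks; rw [e2] at hk3
    have : 4 * (k:ℝ) ^ 2 / n = 4 * (k ^ 2 / n) := by ring
    have : 0 < 1 / (k:ℝ) := by positivity
    linarith
  have h6 : 1 / (k:ℝ) ≤ 2 * (Real.sqrt (Real.log k) / k) := by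
    rw [← mul_div_assoc]; gcongr; linarith
  have : 0 ≤ 18 * k ^ 2 * Real.sqrt n * s ^ 2 := by positivity
  rw [mul_div_assoc]
  linarith

lemma HU.main (h : HU P U) (hkn : k ≤ n) (hk : 2 ≤ k) {Λ : Matrix (Fin n) (Fin n) ℝ} (hd : Λ.IsDiag) (h0 : Λ ≠ 0) (ht : Λ.trace = 0) :
    ∫ ω, Wsc ((Real.sqrt k)⁻¹ • (Real.sqrt ((n : ℝ) ^ 2 - 1) / hsNormR Λ) • cor hkn (U ω * Λ.map (fun x => (x : ℂ)) * (U ω)ᴴ)) ∂P ≤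
      18 * k ^ 2 * Real.sqrt n * ((opNormR Λ) ^ 2 / (hsNormR Λ) ^ 2) + 26012 * Real.sqrt (Real.log k) / k := by
  have := h.prob
  obtain ⟨hr, hop, hD, htD, hfD, hD2, htD2, hfD2⟩ := diag_facts hd h0 ht
  set D := Λ.map (fun x => (x : ℂ)) with hDdef
  set r := hsNormR Λ with hrdef
  set D2 := D * D - (r ^ 2 / (n:ℝ)) • (1 : Matrix (Fin n) (Fin n) ℂ) with hD2def
  set c := Real.sqrt ((n : ℝ) ^ 2 - 1) / r with hcdef
  have hk0 : k ≠ 0 := by omega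
  have hn : n ≠ 0 := by omega
  have hk' : (2:ℝ) ≤ k := by exact_mod_cast hk
  have hn' : (k:ℝ) ≤ n := by exact_mod_cast hkn
  have hn0 : (0:ℝ) < n := by linarith
  have hop0 : 0 ≤ opNormR Λ := norm_nonneg _
  have hc : c ^ 2 = ((n:ℝ) ^ 2 - 1) / r ^ 2 := by
    rw [hcdef, div_pow, Real.sq_sqrt (by nlinarith)]
  have hl := h.law hD htD
  have hm := h.cmeas D
  have Wc : Continuous fun A : Matrix (Fin n) (Fin n) ℂ => Wsc ((Real.sqrt k)⁻¹ • TT (mA hkn c A)) := (Wsc_cont hk0).comp (mA_cont hkn c)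
  have ecg : (fun A : Matrix (Fin n) (Fin n) ℂ => Wsc ((Real.sqrt k)⁻¹ • TT (mA hkn c A))) =ᵐ[Measure.map (fun ω => U ω * D * (U ω)ᴴ) P]
      fun A => Wsc ((Real.sqrt k)⁻¹ • c • cor hkn A) := by
    filter_upwards [hl.herm] with A hA
    rw [TT_mA hkn c hA]
  have iW : Integrable (fun A => Wsc ((Real.sqrt k)⁻¹ • c • cor hkn A)) (Measure.map (fun ω => U ω * D * (U ω)ᴴ) P) :=
    (hl.integrable _ Wc).congr ecg
  have iW' : Integrable (fun ω => Wsc ((Real.sqrt k)⁻¹ • c • cor hkn (U ω * D * (U ω)ᴴ))) P := iW.comp_measurable hm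
  have eW := integral_map hm.aemeasurable iW.aestronglyMeasurable
  have eQ := integral_map hm.aemeasurable ((qq_cont hkn c).aestronglyMeasurable (μ := Measure.map (fun ω => U ω * D * (U ω)ᴴ) P))
  have hE := hl.wsc hn hkn hk c
  rw [eW, eQ] at hE
  have iq : Integrable (fun ω => qq hkn c (U ω * D * (U ω)ᴴ)) P := (hl.integrable _ (qq_cont hkn c)).comp_measurable hm
  obtain ⟨a1, a2, a3⟩ := h.corfro hn hkn hD htD
  obtain ⟨b1, b2, b3⟩ := h.corfro hn hkn hD2 htD2
  have b4 := jensen2 (div_nonneg (mul_nonneg (by positivity) (fro_nonneg _)) hn0.le) b1 b2 b3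
  rw [hfD] at a3
  have hQ : ∫ ω, qq hkn c (U ω * D * (U ω)ᴴ) ∂P ≤ k / (n:ℝ) ^ 2 + 2 * k * (opNormR Λ / r) + 4 * k ^ 2 / n := by
    have q1 : ∫ ω, qq hkn c (U ω * D * (U ω)ᴴ) ∂P ≤ ∫ ω, (k / (n:ℝ) ^ 2 + (n / r ^ 2) * fro (cor hkn (U ω * D2 * (U ω)ᴴ))
        + (n / r ^ 2) * fro (cor hkn (U ω * D * (U ω)ᴴ)) ^ 2) ∂P :=
      integral_mono iq (((integrable_const _).add (b1.const_mul _)).add (a2.const_mul _)) fun ω =>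
        qq_point (by omega) (by omega) (h.mem ω) hr hc
    have ii : Integrable (fun ω => k / (n:ℝ) ^ 2 + (n / r ^ 2) * fro (cor hkn (U ω * D2 * (U ω)ᴴ))) P := (integrable_const _).add (b1.const_mul _)
    rw [integral_add ii (a2.const_mul _), integral_add (integrable_const _) (b1.const_mul _),
      integral_const_mul, integral_const_mul] at q1
    simp only [integral_const, probReal_univ, one_smul] at q1
    have q2 : (n / r ^ 2) * ∫ ω, fro (cor hkn (U ω * D2 * (U ω)ᴴ)) ∂P ≤ 2 * k * (opNormR Λ / r) := by
      calc _ ≤ (n / r ^ 2) * (2 * k * (opNormR Λ * r) / n) := by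
            refine mul_le_mul_of_nonneg_left (b4.trans ?_) (by positivity)
            gcongr
        _ = _ := by field_simp
    have q3 : (n / r ^ 2) * ∫ ω, fro (cor hkn (U ω * D * (U ω)ᴴ)) ^ 2 ∂P ≤ 4 * k ^ 2 / n := by
      calc _ ≤ (n / r ^ 2) * (2 * k * r / n) ^ 2 := mul_le_mul_of_nonneg_left a3 (by positivity)
        _ = _ := by field_simp; norm_num
    linarith
  have h7 : ∫ ω, Wsc ((Real.sqrt k)⁻¹ • c • cor hkn (U ω * D * (U ω)ᴴ)) ∂P ≤ 7 := by
    have p1 : ∀ ω, Wsc ((Real.sqrt k)⁻¹ • c • cor hkn (U ω * D * (U ω)ᴴ)) ≤ 3 + ((k:ℝ) ^ 2)⁻¹ * c ^ 2 * fro (cor hkn (U ω * D * (U ω)ᴴ)) ^ 2 := by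
      intro ω
      have hH : (U ω * D * (U ω)ᴴ).IsHermitian := Matrix.isHermitian_mul_mul_conjTranspose _ hD
      refine (Wsc_trivial hk0 (smul_herm _ (smul_herm c (cor_herm hkn hH)))).trans (le_of_eq ?_)
      rw [fro_rsmul, fro_rsmul, mul_pow, mul_pow, sq_abs, sq_abs, inv_pow, Real.sq_sqrt (by positivity)]
      ring
    have ii : Integrable (fun ω => 3 + ((k:ℝ) ^ 2)⁻¹ * c ^ 2 * fro (cor hkn (U ω * D * (U ω)ᴴ)) ^ 2) P := (integrable_const _).add (a2.const_mul _)
    have p2 := integral_mono iW' ii p1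
    rw [integral_add (integrable_const _) (a2.const_mul _), integral_const_mul] at p2
    simp only [integral_const, probReal_univ, one_smul] at p2
    have p3 : ((k:ℝ) ^ 2)⁻¹ * c ^ 2 * ∫ ω, fro (cor hkn (U ω * D * (U ω)ᴴ)) ^ 2 ∂P ≤ 4 := by
      calc _ ≤ ((k:ℝ) ^ 2)⁻¹ * c ^ 2 * (2 * k * r / n) ^ 2 := mul_le_mul_of_nonneg_left a3 (by positivity)
        _ = 4 * (((n:ℝ) ^ 2 - 1) / n ^ 2) := by rw [hc]; field_simp; norm_num
        _ ≤ 4 * 1 := by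
          refine mul_le_mul_of_nonneg_left ?_ (by norm_num)
          rw [div_le_one (by positivity)]; linarith
        _ = 4 := by norm_num
    linarith
  have hns : 1 ≤ n * (opNormR Λ / r) ^ 2 := by
    rw [div_pow, ← mul_div_assoc, one_le_div (by positivity)]; exact hop
  have := final_arith hk hkn (by positivity : 0 ≤ opNormR Λ / r) hns h7 hE hQ
  rw [div_pow] at this
  exact this

end PG

end Proof

theorem stmt9 :
    ∃ C : ℝ, 0 < C ∧
      ∀ (n k : ℕ) (_ : k ≤ n) (_ : 2 ≤ k)
        (Λ : Matrix (Fin n) (Fin n) ℝ) (_ : Λ.IsDiag) (_ : Λ ≠ 0)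
        (_ : Λ.trace = 0)
        (Ω : Type u) [MeasurableSpace Ω] (P : Measure Ω) [IsProbabilityMeasure P]
        -- U is Haar distributed on the unitary group:
        (U : Ω → Matrix (Fin n) (Fin n) ℂ) (_ : Measurable U)
        (_ : ∀ ω, U ω ∈ Matrix.unitaryGroup (Fin n) ℂ)
        (_ : ∀ V ∈ Matrix.unitaryGroup (Fin n) ℂ,
          Measure.map (fun ω => V * U ω) P = Measure.map U P),
        (∫ ω, W1m (esd ((Real.sqrt k)⁻¹ •
            (Real.sqrt ((n : ℝ) ^ 2 - 1) / hsNormR Λ) •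
              ((U ω * Λ.map (fun x => (x : ℂ)) * (U ω)ᴴ).submatrix
                (Fin.castLE ‹k ≤ n›) (Fin.castLE ‹k ≤ n›)))) semicircle ∂P) ≤
          18 * k ^ 2 * Real.sqrt n * ((opNormR Λ) ^ 2 / (hsNormR Λ) ^ 2) +
            C * Real.sqrt (Real.log k) / k := by
  refine ⟨26012, by norm_num, ?_⟩
  intro n k hkn hk Λ hd h0 ht Ω _ P _ U hU hmem hinv
  exact HU.main (P := P) (U := U) ⟨inferInstance, hU, hmem, hinv⟩ hkn hk hd h0 ht
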